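/- Every 4-critical triangle-free graph drawn in the torus has representativity at least 2. -/

import Mathlib

open Set Topology

noncomputable section

/-- The circle `ℝ/ℤ`. -/
abbrev Circle1 : Type := AddCircle (1 : ℝ)

/-- The torus `(ℝ/ℤ) × (ℝ/ℤ)`. -/
abbrev Torus : Type := Circle1 × Circle1

/-- A set is an arc if it is homeomorphic to the open unit interval. -/
def IsArc {S : Type} [TopologicalSpace S] (A : Set S) : Prop :=
  Nonempty ((Set.Ioo (0 : ℝ) 1) ≃ₜ A)

/-- A drawing, in the space `S`, of a multigraph whose edges `E` have endpoints
given by `ends`.  Vertices are drawn as distinct points, edges as arcs whose closure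
adds exactly the endpoint vertices; arcs are pairwise disjoint and avoid all
vertex points. -/
structure MDrawing {V E : Type} (ends : E → Sym2 V) (S : Type) [TopologicalSpace S] where
  vmap : V → S
  vinj : Function.Injective vmap
  emap : E → Set S
  arc : ∀ e, IsArc (emap e)
  closure_emap : ∀ (e : E) (u w : V), ends e = s(u, w) →
    closure (emap e) = emap e ∪ {vmap u, vmap w}
  vertex_notin : ∀ (e : E) (x : V), vmap x ∉ emap e
  edges_disj : ∀ e f : E, e ≠ f → emap e ∩ emap f = ∅

namespace MDrawing

variable {V E S : Type} [TopologicalSpace S] {ends : E → Sym2 V}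

/-- The point set `|G|` of the drawing. -/
def image (d : MDrawing ends S) : Set S :=
  Set.range d.vmap ∪ ⋃ e, d.emap e

/-- A face: a connected component of the complement of the drawing. -/
def IsFace (d : MDrawing ends S) (f : Set S) : Prop :=
  ∃ x ∈ (d.image)ᶜ, f = connectedComponentIn (d.image)ᶜ x

/-- The length of a face: each edge drawn in the frontier of `g` contributes `2`
if `g` is the unique face whose frontier contains the arc, and `1` otherwise. -/
def faceLen (d : MDrawing ends S) (g : Set S) : ℕ :=
  2 * {e : E | d.emap e ⊆ frontier g ∧
        (∀ g', d.IsFace g' → d.emap e ⊆ frontier g' → g' = g)}.ncard +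
    {e : E | d.emap e ⊆ frontier g ∧
        ¬ (∀ g', d.IsFace g' → d.emap e ⊆ frontier g' → g' = g)}.ncard

end MDrawing

/-- A drawing of a simple graph `G`: a drawing of the multigraph whose edge set is
the edge set of `G`. -/
abbrev Drawing {V : Type} (G : SimpleGraph V) (S : Type) [TopologicalSpace S] :=
  MDrawing (fun e : G.edgeSet => (e : Sym2 V)) S

/-- The point set of (the drawing of) a walk: the vertex points of its support
together with the arcs of its edges. -/
def walkImage {V S : Type} [TopologicalSpace S] {G : SimpleGraph V} (d : Drawing G S)
    {a b : V} (w : G.Walk a b) : Set S :=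
  (⋃ v ∈ w.support, {d.vmap v}) ∪
    ⋃ (e : G.edgeSet) (_ : (e : Sym2 V) ∈ w.edges), d.emap e

/-- A closed curve is null-homotopic if it is homotopic to a constant map. -/
def NullHomotopic {S : Type} [TopologicalSpace S] (γ : C(Circle1, S)) : Prop :=
  ∃ c : S, ContinuousMap.Homotopic γ (ContinuousMap.const Circle1 c)

/-- A set is a contractible simple closed curve if it is the range of an injective
closed curve which is null-homotopic. -/
def ContractibleSet {S : Type} [TopologicalSpace S] (A : Set S) : Prop :=
  ∃ γ : C(Circle1, S), Function.Injective γ ∧ Set.range γ = A ∧ NullHomotopic γ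

/-- A cycle (given as a closed walk) is contractible if the closed curve tracing
its drawing is null-homotopic. -/
def ContractibleWalk {V S : Type} [TopologicalSpace S] {G : SimpleGraph V}
    (d : Drawing G S) {a : V} (w : G.Walk a a) : Prop :=
  ContractibleSet (walkImage d w)

/-- A graph is 4-critical if its chromatic number is `4` and every proper subgraph
has chromatic number at most `3`. -/
def FourCritical {V : Type} (G : SimpleGraph V) : Prop :=
  G.chromaticNumber = 4 ∧
    ∀ H : G.Subgraph, H ≠ ⊤ → H.coe.chromaticNumber ≤ 3

/-- A graph is triangle-free if it contains no 3-cycle. -/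
def TriangleFree {V : Type} (G : SimpleGraph V) : Prop :=
  ∀ (a : V) (w : G.Walk a a), w.IsCycle → w.length ≠ 3

/-- `f` is a `k`-face: a face bounded by a cycle of length `k`. -/
def IsKFace {V S : Type} [TopologicalSpace S] {G : SimpleGraph V} (d : Drawing G S)
    (f : Set S) (k : ℕ) : Prop :=
  d.IsFace f ∧ ∃ (a : V) (w : G.Walk a a), w.IsCycle ∧ w.length = k ∧
    frontier f = walkImage d w

/-- `f` is a face bounded by the 4-cycle `v1 v2 v3 v4`. -/
def IsQuadFace {V S : Type} [TopologicalSpace S] {G : SimpleGraph V} (d : Drawing G S)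
    (f : Set S) (v1 v2 v3 v4 : V) : Prop :=
  d.IsFace f ∧ ∃ w : G.Walk v1 v1, w.IsCycle ∧
    w.support = [v1, v2, v3, v4, v1] ∧ frontier f = walkImage d w

/-- A set is an open disk if it is homeomorphic to an open disk in the plane. -/
def IsOpenDisk {S : Type} [TopologicalSpace S] (A : Set S) : Prop :=
  Nonempty (A ≃ₜ (Metric.ball (0 : ℝ × ℝ) 1))

/-- The drawing has representativity at least `n`: every non-contractible simple
closed curve meeting the drawing in finitely many points meets it in at least `n`
points. -/
def RepAtLeast {V : Type} {G : SimpleGraph V} (d : Drawing G Torus) (n : ℕ) : Prop :=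
  ∀ γ : C(Circle1, Torus), Function.Injective γ → ¬ NullHomotopic γ →
    (Set.range γ ∩ d.image).Finite → n ≤ (Set.range γ ∩ d.image).ncard

namespace RepProof
open scoped Classical

section KY

/-- ordered number of adjacent pairs between `S` and `T` -/
def adjCount {V : Type} (G : SimpleGraph V) (S T : Finset V) : ℤ :=
  ∑ a ∈ S, ∑ b ∈ T, if G.Adj a b then 1 else 0

/-- twice the Kostochka-Yancey potential -/
def rho {V : Type} (G : SimpleGraph V) (S : Finset V) : ℤ :=
  10 * (S.card : ℤ) - 3 * adjCount G S S

def Col {V : Type} (G : SimpleGraph V) (S : Finset V) : Prop :=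
  ∃ φ : V → Fin 3, ∀ a ∈ S, ∀ b ∈ S, G.Adj a b → φ a ≠ φ b

def Crit {V : Type} (G : SimpleGraph V) (S : Finset V) : Prop :=
  ¬ Col G S ∧ ∀ T, T ⊂ S → Col G T

lemma exists_crit {V : Type} (G : SimpleGraph V) (S : Finset V) (h : ¬ Col G S) :
    ∃ T ⊆ S, Crit G T := by
  induction S using Finset.strongInduction with
  | H S ih =>
    by_cases hS : ∀ T, T ⊂ S → Col G T
    · exact ⟨S, le_rfl, h, hS⟩
    · push Not at hS
      obtain ⟨T, hT, hcT⟩ := hS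
      obtain ⟨U, hU, hc⟩ := ih T hT hcT
      exact ⟨U, hU.trans hT.1, hc⟩

lemma Col.mono {V : Type} {G : SimpleGraph V} {S T : Finset V} (h : Col G T) (hST : S ⊆ T) :
    Col G S := by
  obtain ⟨φ, hφ⟩ := h
  exact ⟨φ, fun a ha b hb => hφ a (hST ha) b (hST hb)⟩

lemma adjCount_comm {V : Type} (G : SimpleGraph V) (S T : Finset V) :
    adjCount G S T = adjCount G T S := by
  unfold adjCount
  rw [Finset.sum_comm]
  simp only [G.adj_comm]

lemma adjCount_nonneg {V : Type} (G : SimpleGraph V) (S T : Finset V) :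
    0 ≤ adjCount G S T := by
  unfold adjCount
  refine Finset.sum_nonneg fun a _ => Finset.sum_nonneg fun b _ => ?_
  split_ifs <;> simp

lemma adjCount_union_left {V : Type} (G : SimpleGraph V) (S T U : Finset V) (h : Disjoint S T) :
    adjCount G (S ∪ T) U = adjCount G S U + adjCount G T U := by
  unfold adjCount
  rw [Finset.sum_union h]

lemma adjCount_union_right {V : Type} (G : SimpleGraph V) (S T U : Finset V) (h : Disjoint S T) :
    adjCount G U (S ∪ T) = adjCount G U S + adjCount G U T := by
  rw [adjCount_comm, adjCount_union_left G S T U h, adjCount_comm G S, adjCount_comm G T]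

lemma adjCount_union_self {V : Type} (G : SimpleGraph V) (S T : Finset V) (h : Disjoint S T) :
    adjCount G (S ∪ T) (S ∪ T) = adjCount G S S + adjCount G T T + 2 * adjCount G S T := by
  rw [adjCount_union_left G S T _ h, adjCount_union_right G S T _ h,
    adjCount_union_right G S T _ h, adjCount_comm G T S]
  ring

lemma adjCount_self_le {V : Type} (G : SimpleGraph V) (S : Finset V) :
    adjCount G S S ≤ S.card * (S.card - 1) := by
  unfold adjCount
  have : ∀ a ∈ S, (∑ b ∈ S, if G.Adj a b then (1:ℤ) else 0) ≤ S.card - 1 := by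
    intro a ha
    rw [← Finset.add_sum_erase _ _ ha]
    have h1 : (∑ b ∈ S.erase a, if G.Adj a b then (1:ℤ) else 0) ≤ ∑ b ∈ S.erase a, 1 := by
      refine Finset.sum_le_sum fun b _ => ?_
      split_ifs <;> simp
    have h2 : (((S.erase a).card : ℕ) : ℤ) = S.card - 1 := by
      rw [Finset.card_erase_of_mem ha]
      have := Finset.card_pos.mpr ⟨a, ha⟩
      push_cast [Nat.cast_sub this]
      rfl
    simp only [SimpleGraph.irrefl, if_false]
    simp only [Finset.sum_const, nsmul_eq_mul, mul_one] at h1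
    linarith
  calc _ ≤ ∑ a ∈ S, ((S.card : ℤ) - 1) := Finset.sum_le_sum this
    _ = _ := by simp; try ring

def Ygraph {V : Type} (G : SimpleGraph V) (R : Finset V) (φ : V → Fin 3) :
    SimpleGraph (V ⊕ Fin 3) where
  Adj p q := match p, q with
    | .inl a, .inl b => G.Adj a b
    | .inl a, .inr i => ∃ r ∈ R, φ r = i ∧ G.Adj a r
    | .inr i, .inl a => ∃ r ∈ R, φ r = i ∧ G.Adj a r
    | .inr i, .inr j => i ≠ j
  symm := by
    constructor
    rintro (a | i) (b | j) h
    · exact SimpleGraph.Adj.symm h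
    · exact h
    · exact h
    · exact Ne.symm h
  loopless := by
    constructor
    rintro (a | i) h
    · exact G.loopless.irrefl _ h
    · exact h rfl

/-- induction hypothesis -/
def IHyp (n : ℕ) : Prop :=
  ∀ (V : Type) (G : SimpleGraph V) (S : Finset V), S.card < n → Crit G S → rho G S ≤ 4

lemma IHyp.get {n : ℕ} (ih : IHyp n) {V : Type} (G : SimpleGraph V) (S : Finset V)
    (hn : S.card < n) (h : ¬ Col G S) : ∃ W ⊆ S, Crit G W ∧ rho G W ≤ 4 := by
  obtain ⟨W, hW, hc⟩ := exists_crit G S h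
  exact ⟨W, hW, hc, ih V G W (lt_of_le_of_lt (Finset.card_le_card hW) hn) hc⟩

lemma ygraph_not_col {V : Type} {G : SimpleGraph V} {S R : Finset V} (hS : ¬ Col G S)
    (φ : V → Fin 3) (hφ : ∀ a ∈ R, ∀ b ∈ R, G.Adj a b → φ a ≠ φ b) :
    ¬ Col (Ygraph G R φ) ((S \ R).disjSum Finset.univ) := by
  rintro ⟨ψ, hψ⟩
  apply hS
  have hinj : ∀ i j : Fin 3, i ≠ j → ψ (.inr i) ≠ ψ (.inr j) := by
    intro i j hij
    exact hψ _ (by simp) _ (by simp) hij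
  refine ⟨fun v => if v ∈ R then ψ (.inr (φ v)) else ψ (.inl v), ?_⟩
  intro a ha b hb hab
  by_cases haR : a ∈ R <;> by_cases hbR : b ∈ R <;> simp only [haR, hbR, if_true, if_false]
  · exact hinj _ _ (hφ a haR b hbR hab)
  · refine hψ _ (by simp) _ (by simp [hb, hbR]) ?_
    exact ⟨a, haR, rfl, hab.symm⟩
  · refine hψ _ (by simp [ha, haR]) _ (by simp) ?_
    exact ⟨b, hbR, rfl, hab⟩
  · exact hψ _ (by simp [ha, haR]) _ (by simp [hb, hbR]) hab

lemma ygraph_cross {V : Type} (G : SimpleGraph V) (R : Finset V) (φ : V → Fin 3)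
    (Z : Finset (Fin 3)) (v : V) :
    (∑ i ∈ Z, if (∃ r ∈ R, φ r = i ∧ G.Adj v r) then (1:ℤ) else 0) +
      (∑ r ∈ R, if (G.Adj v r ∧ φ r ∉ Z) then (1:ℤ) else 0) ≤
    ∑ r ∈ R, if G.Adj v r then (1:ℤ) else 0 := by
  have h1 : (∑ r ∈ R, if G.Adj v r then (1:ℤ) else 0) =
      (∑ r ∈ R, ∑ i ∈ Z, if (φ r = i ∧ G.Adj v r) then (1:ℤ) else 0) +
      (∑ r ∈ R, if (G.Adj v r ∧ φ r ∉ Z) then (1:ℤ) else 0) := by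
    rw [← Finset.sum_add_distrib]
    refine Finset.sum_congr rfl fun r _ => ?_
    by_cases hr : G.Adj v r <;> by_cases hz : φ r ∈ Z <;> simp [hr, hz]
  rw [h1, Finset.sum_comm]
  refine add_le_add (Finset.sum_le_sum fun i _ => ?_) le_rfl
  have hnn : ∀ r ∈ R, (0:ℤ) ≤ if (φ r = i ∧ G.Adj v r) then (1:ℤ) else 0 := by
    intro r _; split_ifs <;> simp
  split_ifs with h
  · obtain ⟨r, hr, h2⟩ := h
    have := Finset.single_le_sum hnn hr
    simpa [h2] using this
  · exact Finset.sum_nonneg hnn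

lemma ygraph_rho {V : Type} (G : SimpleGraph V) (R : Finset V) (φ : V → Fin 3)
    (W : Finset V) (Z : Finset (Fin 3)) (hd : Disjoint W R) :
    rho G (W ∪ R) + 6 * (∑ v ∈ W, ∑ r ∈ R, if (G.Adj v r ∧ φ r ∉ Z) then (1:ℤ) else 0) ≤
      rho (Ygraph G R φ) (W.disjSum Z) - (10 * Z.card - 3 * (Z.card * (Z.card - 1))) + rho G R := by
  have hY : adjCount (Ygraph G R φ) (W.disjSum Z) (W.disjSum Z) = adjCount G W W +
      2 * (∑ v ∈ W, ∑ i ∈ Z, if (∃ r ∈ R, φ r = i ∧ G.Adj v r) then (1:ℤ) else 0)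
      + Z.card * (Z.card - 1) := by
    unfold adjCount
    rw [Finset.sum_disjSum]
    simp only [Finset.sum_disjSum, Finset.sum_add_distrib]
    have e1 : ∀ a b, (Ygraph G R φ).Adj (.inl a) (.inl b) ↔ G.Adj a b := fun a b => Iff.rfl
    have e2 : ∀ a i, (Ygraph G R φ).Adj (.inl a) (.inr i) ↔ ∃ r ∈ R, φ r = i ∧ G.Adj a r :=
      fun a b => Iff.rfl
    have e3 : ∀ a i, (Ygraph G R φ).Adj (.inr i) (.inl a) ↔ ∃ r ∈ R, φ r = i ∧ G.Adj a r :=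
      fun a b => Iff.rfl
    have e4 : ∀ i j, (Ygraph G R φ).Adj (.inr i) (.inr j) ↔ i ≠ j := fun a b => Iff.rfl
    simp only [e1, e2, e3, e4]
    rw [Finset.sum_comm (s := Z) (t := W)]
    have e5 : (∑ i ∈ Z, ∑ j ∈ Z, if i ≠ j then (1:ℤ) else 0) = Z.card * (Z.card - 1) := by
      have : ∀ i ∈ Z, (∑ j ∈ Z, if i ≠ j then (1:ℤ) else 0) = Z.card - 1 := by
        intro i hi
        have : ∀ j ∈ Z, (if i ≠ j then (1:ℤ) else 0) = 1 - if i = j then 1 else 0 := by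
          intro j _; by_cases h : i = j <;> simp [h]
        rw [Finset.sum_congr rfl this, Finset.sum_sub_distrib]
        simp [hi]
      rw [Finset.sum_congr rfl this]; simp; try ring
    rw [e5]; ring
  have hc := Finset.sum_le_sum (fun v (_ : v ∈ W) => ygraph_cross G R φ Z v)
  rw [Finset.sum_add_distrib] at hc
  have hA : adjCount G W R = ∑ v ∈ W, ∑ r ∈ R, if G.Adj v r then (1:ℤ) else 0 := rfl
  rw [← hA] at hc
  unfold rho
  rw [hY, adjCount_union_self G W R hd, Finset.card_union_of_disjoint hd, Finset.card_disjSum]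
  push_cast
  linarith

lemma ygraph_ext {V : Type} {G : SimpleGraph V} {S R : Finset V} (ih : IHyp S.card)
    (hS : Crit G S) (hR : R ⊂ S) (h4 : 4 ≤ R.card)
    (φ : V → Fin 3) (hφ : ∀ a ∈ R, ∀ b ∈ R, G.Adj a b → φ a ≠ φ b) :
    ∃ W ⊆ S \ R, ∃ Z : Finset (Fin 3), Z.Nonempty ∧
      rho G (W ∪ R) + 6 * (∑ v ∈ W, ∑ r ∈ R, if (G.Adj v r ∧ φ r ∉ Z) then (1:ℤ) else 0) ≤
      4 - (10 * Z.card - 3 * (Z.card * (Z.card - 1))) + rho G R := by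
  obtain ⟨U, hU, hc, hr⟩ := ih.get (Ygraph G R φ) ((S \ R).disjSum Finset.univ) (by
    rw [Finset.card_disjSum, Finset.card_sdiff_of_subset hR.1]
    have := Finset.card_le_card hR.1
    simp; omega) (ygraph_not_col hS.1 φ hφ)
  have hU2 : U.toLeft.disjSum U.toRight = U := Finset.toLeft_disjSum_toRight
  have hW : U.toLeft ⊆ S \ R := by
    intro v hv
    have := hU (Finset.mem_toLeft.mp hv)
    simpa using this
  refine ⟨U.toLeft, hW, U.toRight, ?_, ?_⟩
  · rw [Finset.nonempty_iff_ne_empty]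
    intro he
    apply hc.1
    have hss : U.toLeft ⊂ S := by
      refine Finset.ssubset_of_subset_of_ssubset hW ?_
      rw [Finset.ssubset_iff_of_subset Finset.sdiff_subset]
      have : R.Nonempty := Finset.card_pos.mp (by omega)
      obtain ⟨r, hr⟩ := this
      exact ⟨r, hR.1 hr, by simp [hr]⟩
    obtain ⟨ψ, hψ⟩ := hS.2 _ hss
    refine ⟨Sum.elim ψ (fun _ => 0), ?_⟩
    rw [← hU2, he]
    rintro (a | i) ha (b | j) hb hab
    · exact hψ a (by simpa using ha) b (by simpa using hb) hab
    · simp at hb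
    · simp at ha
    · simp at ha
  · have := ygraph_rho G R φ U.toLeft U.toRight
      (Finset.disjoint_of_subset_left hW Finset.sdiff_disjoint)
    rw [hU2] at this
    linarith

lemma zcard_bound (Z : Finset (Fin 3)) (h : Z.Nonempty) :
    (10:ℤ) ≤ 10 * Z.card - 3 * (Z.card * (Z.card - 1)) ∧
    (2 ≤ Z.card → (12:ℤ) ≤ 10 * Z.card - 3 * (Z.card * (Z.card - 1))) := by
  have h1 := Finset.card_pos.mpr h
  have h2 : Z.card ≤ 3 := by simpa using Finset.card_le_univ Z
  interval_cases Z.card <;> norm_num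

lemma claim8 {V : Type} {G : SimpleGraph V} {S : Finset V} (ih : IHyp S.card)
    (hS : Crit G S) (hrho : 4 < rho G S) (R : Finset V) (hR : R ⊂ S) (h2 : 2 ≤ R.card) :
    10 < rho G R := by
  by_contra hcon
  push Not at hcon
  -- choose R minimal
  obtain ⟨R0, hR0, hmin⟩ := Finset.exists_min_image
    (S.powerset.filter (fun R => R ≠ S ∧ 2 ≤ R.card)) (rho G)
    ⟨R, by simp [hR.1, hR.ne, h2]⟩
  simp only [Finset.mem_filter, Finset.mem_powerset] at hR0 hmin
  have hle : rho G R0 ≤ 10 := (hmin R ⟨hR.1, hR.ne, h2⟩).trans hcon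
  have hss : R0 ⊂ S := hR0.1.ssubset_of_ne hR0.2.1
  have hcard : 4 ≤ R0.card := by
    by_contra h
    have h3 := adjCount_self_le G R0
    unfold rho at hle
    have : R0.card = 2 ∨ R0.card = 3 := by omega
    rcases this with h | h <;> rw [h] at h3 hle <;> norm_num at h3 hle <;> linarith
  obtain ⟨φ, hφ⟩ := hS.2 R0 hss
  obtain ⟨W, hW, Z, hZ, h⟩ := ygraph_ext ih hS hss hcard φ hφ
  have hnn : (0:ℤ) ≤ ∑ v ∈ W, ∑ r ∈ R0, if (G.Adj v r ∧ φ r ∉ Z) then (1:ℤ) else 0 := by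
    refine Finset.sum_nonneg fun a _ => Finset.sum_nonneg fun b _ => ?_
    split_ifs <;> simp
  have hz := (zcard_bound Z hZ).1
  by_cases he : W ∪ R0 = S
  · rw [he] at h; linarith
  · have := hmin (W ∪ R0) ⟨Finset.union_subset (hW.trans Finset.sdiff_subset) hR0.1, he,
      hR0.2.2.trans (Finset.card_le_card Finset.subset_union_right)⟩
    linarith

/-- permuting colours so that two colours agree -/
lemma col_glue {V : Type} {G : SimpleGraph V} {S T : Finset V} (u : V)
    (hS : Col G S) (hT : Col G T) (hu : u ∈ S) (huT : u ∈ T) (hST : ∀ x ∈ S, x ∈ T → x = u)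
    (hE : ∀ a ∈ S, ∀ b ∈ T, G.Adj a b → a = u ∨ b = u) : Col G (S ∪ T) := by
  obtain ⟨φ, hφ⟩ := hS
  obtain ⟨ψ, hψ⟩ := hT
  let σ : Equiv.Perm (Fin 3) := Equiv.swap (ψ u) (φ u)
  have hσ : σ (ψ u) = φ u := Equiv.swap_apply_left _ _
  have key : ∀ a ∈ S, ∀ b ∈ T, G.Adj a b → φ a ≠ σ (ψ b) := by
    intro a ha b hb hab
    rcases hE a ha b hb hab with rfl | rfl
    · rw [← hσ]
      exact fun h => hψ _ huT _ hb hab (σ.injective h)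
    · rw [hσ]; exact hφ a ha _ hu hab
  refine ⟨fun v => if v ∈ S then φ v else σ (ψ v), ?_⟩
  intro a ha b hb hab
  by_cases h1 : a ∈ S <;> by_cases h2 : b ∈ S <;> simp only [h1, h2, if_true, if_false]
  · exact hφ a h1 b h2 hab
  · exact key a h1 b ((Finset.mem_union.mp hb).resolve_left h2) hab
  · exact (key b h2 a ((Finset.mem_union.mp ha).resolve_left h1) hab.symm).symm
  · intro h
    exact hψ a ((Finset.mem_union.mp ha).resolve_left h1) b
      ((Finset.mem_union.mp hb).resolve_left h2) hab (σ.injective h)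

lemma boundary_two {V : Type} {G : SimpleGraph V} {S R : Finset V} 
    (hS : Crit G S) (hR : R ⊂ S) (h2 : 2 ≤ R.card) :
    ∃ u ∈ R, ∃ v ∈ R, u ≠ v ∧ (∃ a ∈ S \ R, G.Adj a u) ∧ (∃ b ∈ S \ R, G.Adj b v) := by
  by_contra hcon
  push Not at hcon
  have : ∃ u ∈ R, ∀ v ∈ R, v ≠ u → ∀ b ∈ S \ R, ¬ G.Adj b v := by
    by_cases h : ∃ u ∈ R, ∃ a ∈ S \ R, G.Adj a u
    · obtain ⟨u, hu, a, ha, hau⟩ := h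
      exact ⟨u, hu, fun v hv hvu => hcon u hu v hv hvu.symm ⟨a, ha, hau⟩⟩
    · push Not at h
      obtain ⟨u, hu⟩ := Finset.card_pos.mp (by omega : 0 < R.card)
      exact ⟨u, hu, fun v hv _ => h v hv⟩
  obtain ⟨u, hu, hb⟩ := this
  apply hS.1
  have hT : insert u (S \ R) ⊂ S := by
    obtain ⟨w, hw, hwu⟩ := Finset.exists_mem_ne (by omega : 1 < R.card) u
    rw [Finset.ssubset_iff_of_subset]
    · exact ⟨w, hR.1 hw, by simp [hw, hwu]⟩
    · intro x hx
      rcases Finset.mem_insert.mp hx with rfl | hx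
      · exact hR.1 hu
      · exact (Finset.mem_sdiff.mp hx).1
  have := col_glue u (hS.2 R hR) (hS.2 _ hT) hu (by simp) (by
    intro x hx hx2
    rcases Finset.mem_insert.mp hx2 with h | h
    · exact h
    · exact absurd hx (Finset.mem_sdiff.mp h).2) (by
    intro a ha b hb' hab
    rcases Finset.mem_insert.mp hb' with h | h
    · exact Or.inr h
    · left; by_contra hne
      exact hb a ha hne b h hab.symm)
  refine this.mono ?_
  intro x hx
  by_cases h : x ∈ R <;> simp [h, hx]

/-- the graph with an additional edge -/
def addE {V : Type} (G : SimpleGraph V) (u v : V) : SimpleGraph V := G ⊔ SimpleGraph.edge u v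

lemma rho_addE {V : Type} (G : SimpleGraph V) (u v : V) (T : Finset V) :
    rho G T ≤ rho (addE G u v) T + 6 := by
  have : adjCount (addE G u v) T T ≤ adjCount G T T + 2 := by
    have h1 : ∀ a b, (if (addE G u v).Adj a b then (1:ℤ) else 0) ≤ (if G.Adj a b then 1 else 0) +
        ((if a = u then (if b = v then 1 else 0) else 0) +
          (if a = v then (if b = u then 1 else 0) else 0)) := by
      intro a b
      simp only [addE, SimpleGraph.sup_adj, SimpleGraph.edge_adj]
      by_cases h : G.Adj a b
      · simp only [h, true_or, if_true]; split_ifs <;> simp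
      · simp only [h, false_or, if_false]
        by_cases h1 : a = u <;> by_cases h2 : b = v <;> by_cases h3 : a = v <;>
          by_cases h4 : b = u <;> simp [h1, h2, h3, h4] <;> aesop
    calc _ ≤ ∑ a ∈ T, ∑ b ∈ T, _ := Finset.sum_le_sum fun a _ => Finset.sum_le_sum fun b _ => h1 a b
      _ = adjCount G T T + (∑ a ∈ T, (if a = u then (if v ∈ T then 1 else 0) else 0)  +
           ∑ a ∈ T, (if a = v then (if u ∈ T then 1 else 0) else 0)) := by
          simp only [Finset.sum_add_distrib, adjCount]
          congr 2 <;>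
          · refine Finset.sum_congr rfl fun a _ => ?_
            split_ifs <;> simp [*]
      _ ≤ _ := by
          rw [Finset.sum_ite_eq', Finset.sum_ite_eq']
          split_ifs <;> simp
  unfold rho; linarith

lemma addE_col {V : Type} {G : SimpleGraph V} {u v : V} {S : Finset V} (h : Col (addE G u v) S)
    (huv : u ≠ v) (hu : u ∈ S) (hv : v ∈ S) : ∃ φ : V → Fin 3,
      (∀ a ∈ S, ∀ b ∈ S, G.Adj a b → φ a ≠ φ b) ∧ φ u ≠ φ v := by
  obtain ⟨φ, hφ⟩ := h
  refine ⟨φ, fun a ha b hb hab => hφ a ha b hb (Or.inl hab), hφ u hu v hv (Or.inr ?_)⟩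
  rw [SimpleGraph.edge_adj]; exact ⟨Or.inl ⟨rfl, rfl⟩, huv⟩

lemma Crit.two_le {V : Type} {G : SimpleGraph V} {S : Finset V} (h : Crit G S) : 2 ≤ S.card := by
  by_contra hc
  apply h.1
  have : S.card ≤ 1 := by omega
  rw [Finset.card_le_one] at this
  refine ⟨fun _ => 0, fun a ha b hb hab => ?_⟩
  exact absurd (this a ha b hb) hab.ne

/-- adding an edge inside a proper subset keeps colourability -/
lemma claim_add {V : Type} {G : SimpleGraph V} {S : Finset V} (ih : IHyp S.card)
    (hS : Crit G S) (hrho : 4 < rho G S) (R : Finset V) (hR : R ⊂ S) (u v : V) :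
    Col (addE G u v) R := by
  by_contra hcon
  obtain ⟨W, hW, hc, hr⟩ := ih.get _ R (Finset.card_lt_card hR) hcon
  have h1 := rho_addE G u v W
  have := claim8 ih hS hrho W (Finset.ssubset_of_subset_of_ssubset hW hR) hc.two_le
  linarith

lemma claim9 {V : Type} {G : SimpleGraph V} {S : Finset V} (ih : IHyp S.card)
    (hS : Crit G S) (hrho : 4 < rho G S) (R : Finset V) (hR : R ⊂ S) (h4 : 4 ≤ R.card) :
    12 < rho G R := by
  by_contra hcon
  push Not at hcon
  obtain ⟨u, hu, v, hv, huv, ⟨a, ha, hau⟩, ⟨b, hb, hbv⟩⟩ := boundary_two hS hR (by omega)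
  obtain ⟨φ, hφ, hne⟩ := addE_col (claim_add ih hS hrho R hR u v) huv hu hv
  obtain ⟨W, hW, Z, hZ, h⟩ := ygraph_ext ih hS hR h4 φ hφ
  have hnn0 : ∀ v ∈ W, (0:ℤ) ≤ ∑ r ∈ R, if (G.Adj v r ∧ φ r ∉ Z) then (1:ℤ) else 0 := by
    refine fun a _ => Finset.sum_nonneg fun b _ => ?_
    split_ifs <;> simp
  have hnn := Finset.sum_nonneg hnn0
  obtain ⟨hz1, hz2⟩ := zcard_bound Z hZ
  have hWS : W ∪ R ⊆ S := Finset.union_subset (hW.trans Finset.sdiff_subset) hR.1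
  have he : W ∪ R = S := by
    by_contra he
    have := claim8 ih hS hrho (W ∪ R) (hWS.ssubset_of_ne he)
      (le_trans (by omega) (Finset.card_le_card Finset.subset_union_right))
    linarith
  by_cases hz : 2 ≤ Z.card
  · have := hz2 hz
    rw [he] at h; linarith
  · have hz1' : Z.card ≤ 1 := by omega
    rw [Finset.card_le_one] at hz1'
    have hW' : ∀ x ∈ S \ R, x ∈ W := by
      intro x hx
      rw [Finset.mem_sdiff] at hx
      have : x ∈ W ∪ R := he ▸ hx.1
      exact (Finset.mem_union.mp this).resolve_right hx.2
    have hone : (1:ℤ) ≤ ∑ v ∈ W, ∑ r ∈ R, if (G.Adj v r ∧ φ r ∉ Z) then (1:ℤ) else 0 := by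
      have aux : ∀ c ∈ S \ R, ∀ w ∈ R, G.Adj c w → φ w ∉ Z →
          (1:ℤ) ≤ ∑ v ∈ W, ∑ r ∈ R, if (G.Adj v r ∧ φ r ∉ Z) then (1:ℤ) else 0 := by
        intro c hc w hw hcw hwz
        refine le_trans ?_ (Finset.single_le_sum hnn0 (hW' c hc))
        refine le_trans ?_ (Finset.single_le_sum (f := fun r =>
          if (G.Adj c r ∧ φ r ∉ Z) then (1:ℤ) else 0) (fun r _ => by split_ifs <;> simp) hw)
        simp [hcw, hwz]
      by_cases huZ : φ u ∈ Z
      · exact aux b hb v hv hbv (fun hvZ => hne (hz1' _ huZ _ hvZ))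
      · exact aux a ha u hu hau huZ
    rw [he] at h; linarith

end KY
end RepProof

namespace RepProof
open scoped Classical

section KY2

def IsNb {V : Type} (G : SimpleGraph V) (S : Finset V) (x y p q : V) : Prop :=
  x ∈ S ∧ y ∈ S ∧ p ∈ S ∧ q ∈ S ∧ G.Adj x y ∧ G.Adj x p ∧ G.Adj x q ∧ y ≠ p ∧ y ≠ q ∧ p ≠ q ∧
    ∀ b ∈ S, G.Adj x b → b = y ∨ b = p ∨ b = q

lemma rho_insert {V : Type} (G : SimpleGraph V) (T N : Finset V) (v : V) (hv : v ∉ T)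
    (hN : N ⊆ T) (hadj : ∀ w ∈ N, G.Adj v w) :
    rho G (insert v T) ≤ rho G T + 10 - 6 * N.card := by
  have h1 : insert v T = {v} ∪ T := rfl
  have hd : Disjoint {v} T := by simpa using hv
  have h2 : (N.card : ℤ) ≤ adjCount G {v} T := by
    unfold adjCount
    rw [Finset.sum_singleton]
    have : (N.card : ℤ) = ∑ b ∈ N, if G.Adj v b then (1:ℤ) else 0 := by
      rw [Finset.sum_congr rfl (fun b hb => if_pos (hadj b hb))]; simp
    rw [this]
    exact Finset.sum_le_sum_of_subset_of_nonneg hN (fun b _ _ => by split_ifs <;> simp)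
  unfold rho
  rw [h1, adjCount_union_self G _ _ hd, Finset.card_union_of_disjoint hd]
  have h3 := adjCount_nonneg G {v} {v}
  push_cast [Finset.card_singleton]
  linarith

lemma ext_one {V : Type} {G : SimpleGraph V} {T : Finset V} (φ : V → Fin 3)
    (hφ : ∀ a ∈ T, ∀ b ∈ T, G.Adj a b → φ a ≠ φ b) (v : V) (hv : v ∉ T) (c : Fin 3)
    (hc : ∀ b ∈ T, G.Adj v b → c ≠ φ b) :
    ∀ a ∈ insert v T, ∀ b ∈ insert v T, G.Adj a b →
      Function.update φ v c a ≠ Function.update φ v c b := by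
  intro a ha b hb hab
  rw [Finset.mem_insert] at ha hb
  have hne : ∀ t ∈ T, t ≠ v := fun t ht h => hv (h ▸ ht)
  rcases ha with rfl | ha <;> rcases hb with rfl | hb
  · exact absurd rfl hab.ne
  · rw [Function.update_self, Function.update_of_ne (hne b hb)]; exact hc b hb hab
  · rw [Function.update_self, Function.update_of_ne (hne a ha)]; exact (hc a ha hab.symm).symm
  · rw [Function.update_of_ne (hne b hb), Function.update_of_ne (hne a ha)]; exact hφ a ha b hb hab

lemma min_deg {V : Type} {G : SimpleGraph V} {S : Finset V} (hS : Crit G S) (v : V) (hv : v ∈ S) :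
    3 ≤ (S.filter (G.Adj v)).card := by
  by_contra hcon
  obtain ⟨φ, hφ⟩ := hS.2 (S.erase v) (Finset.erase_ssubset hv)
  have h1 : ((S.filter (G.Adj v)).image φ).card < (Finset.univ : Finset (Fin 3)).card := by
    refine lt_of_le_of_lt Finset.card_image_le ?_
    simp; omega
  obtain ⟨c, -, hc⟩ := Finset.exists_mem_notMem_of_card_lt_card h1
  apply hS.1
  refine ⟨_, (Finset.insert_erase hv) ▸ ext_one φ hφ v (by simp) c ?_⟩
  intro b hb hvb h
  apply hc
  rw [Finset.mem_image]
  exact ⟨b, by simp [hvb, Finset.mem_of_mem_erase hb], h.symm⟩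

lemma ext_two {V : Type} {G : SimpleGraph V} {S : Finset V} {x y p q r s : V}
    (hx : IsNb G S x y p q) (hy : IsNb G S y x r s) (φ : V → Fin 3)
    (hφ : ∀ a ∈ (S.erase x).erase y, ∀ b ∈ (S.erase x).erase y, G.Adj a b → φ a ≠ φ b)
    (c d : Fin 3) (hcd : c ≠ d) (hp : c ≠ φ p) (hq : c ≠ φ q) (hr : d ≠ φ r) (hs : d ≠ φ s) :
    Col G S := by
  obtain ⟨hxS, hyS, hpS, hqS, hxy, hxp, hxq, hyp, hyq, hpq, hxN⟩ := hx
  obtain ⟨-, -, hrS, hsS, hyx, hyr, hys, hxr, hxs, hrs, hyN⟩ := hy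
  have h1 := ext_one φ hφ y (by simp) d (by
    intro b hb hyb
    simp only [Finset.mem_erase] at hb
    rcases hyN b hb.2.2 hyb with rfl | rfl | rfl
    · exact absurd rfl hb.2.1
    · exact hr
    · exact hs)
  have e1 : insert y ((S.erase x).erase y) = S.erase x :=
    Finset.insert_erase (by simp [hyS, hxy.ne.symm])
  rw [e1] at h1
  have h2 := ext_one _ h1 x (by simp) c (by
    intro b hb hxb
    simp only [Finset.mem_erase] at hb
    rcases hxN b hb.2 hxb with rfl | rfl | rfl
    · simpa using hcd
    · rw [Function.update_of_ne hyp.symm]; exact hp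
    · rw [Function.update_of_ne hyq.symm]; exact hq)
  rw [Finset.insert_erase hxS] at h2
  exact ⟨_, h2⟩

/-- p absorbs q -/
def identG {V : Type} (G : SimpleGraph V) (p q : V) : SimpleGraph V where
  Adj a b := a ≠ b ∧ (G.Adj a b ∨ (a = p ∧ G.Adj q b) ∨ (b = p ∧ G.Adj q a))
  symm := by
    constructor
    rintro a b ⟨h, h'⟩
    refine ⟨h.symm, ?_⟩
    rcases h' with h' | h' | h'
    · exact Or.inl h'.symm
    · exact Or.inr (Or.inr h')
    · exact Or.inr (Or.inl h')
  loopless := by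
    constructor
    rintro a ⟨h, -⟩
    exact h rfl

lemma identG_rho {V : Type} (G : SimpleGraph V) (p q : V) (W : Finset V) (hq : q ∉ W)
    (hp : p ∈ W) : rho G (insert q W) ≤ rho (identG G p q) W + 10 := by
  have h1 : insert q W = {q} ∪ W := rfl
  have hd : Disjoint {q} W := by simpa using hq
  have key : adjCount (identG G p q) W W ≤ adjCount G W W + 2 * adjCount G {q} W := by
    have h1 : ∀ a b, (if (identG G p q).Adj a b then (1:ℤ) else 0) ≤ (if G.Adj a b then 1 else 0) +
        ((if a = p then (if G.Adj q b then 1 else 0) else 0) +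
          (if b = p then (if G.Adj q a then 1 else 0) else 0)) := by
      intro a b
      by_cases h : (identG G p q).Adj a b
      · rw [if_pos h]
        obtain ⟨-, h | ⟨h, h'⟩ | ⟨h, h'⟩⟩ := h
        · rw [if_pos h]; split_ifs <;> simp
        · rw [if_pos h, if_pos h']; split_ifs <;> simp
        · rw [if_pos h, if_pos h']; split_ifs <;> simp
      · rw [if_neg h]; split_ifs <;> simp
    calc _ ≤ ∑ a ∈ W, ∑ b ∈ W, _ := Finset.sum_le_sum fun a _ => Finset.sum_le_sum fun b _ => h1 a b
      _ = adjCount G W W + ((∑ a ∈ W, (if a = p then ∑ b ∈ W, (if G.Adj q b then 1 else 0) else 0))  +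
           ∑ b ∈ W, (if b = p then ∑ a ∈ W, (if G.Adj q a then 1 else 0) else 0)) := by
          simp only [Finset.sum_add_distrib, adjCount]
          congr 2
          · refine Finset.sum_congr rfl fun a _ => ?_
            split_ifs <;> simp
          · rw [Finset.sum_comm]
            refine Finset.sum_congr rfl fun a _ => ?_
            split_ifs <;> simp
      _ ≤ _ := by
          rw [Finset.sum_ite_eq', if_pos hp]
          unfold adjCount
          rw [Finset.sum_singleton]; linarith
  unfold rho
  rw [h1, adjCount_union_self G _ _ hd, Finset.card_union_of_disjoint hd]
  have h3 := adjCount_nonneg G {q} {q}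
  push_cast [Finset.card_singleton]
  linarith

/-- either the identification is colourable or there is a set of small potential -/
lemma ident_alt {V : Type} {G : SimpleGraph V} {S : Finset V} (ih : IHyp S.card)
    (hS : Crit G S) {T : Finset V} {p q : V} (hT : insert q T ⊂ S) (hq : q ∉ T)
    (hp : p ∈ T) (hpq : ¬ G.Adj p q) :
    (∃ φ : V → Fin 3, (∀ a ∈ insert q T, ∀ b ∈ insert q T, G.Adj a b → φ a ≠ φ b) ∧ φ p = φ q) ∨
    ∃ W ⊆ T, p ∈ W ∧ 2 ≤ W.card ∧ rho G (insert q W) ≤ 14 := by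
  have hqp : q ≠ p := fun h => hq (h ▸ hp)
  have hTS : T ⊂ S := Finset.ssubset_of_subset_of_ssubset (Finset.subset_insert _ _) hT
  by_cases hc : Col (identG G p q) T
  · left
    obtain ⟨φ, hφ⟩ := hc
    refine ⟨Function.update φ q (φ p), ?_, ?_⟩
    · apply ext_one φ (fun a ha b hb hab => hφ a ha b hb ⟨hab.ne, Or.inl hab⟩) q hq
      intro b hb hqb
      refine hφ p hp b hb ⟨?_, Or.inr (Or.inl ⟨rfl, hqb⟩)⟩
      rintro rfl
      exact hpq hqb.symm
    · rw [Function.update_self, Function.update_of_ne hqp.symm]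
  · right
    obtain ⟨W, hW, hcr, hr⟩ := ih.get _ T (Finset.card_lt_card hTS) hc
    have hpW : p ∈ W := by
      by_contra hpW
      apply hcr.1
      obtain ⟨φ, hφ⟩ := hS.2 W (Finset.ssubset_of_subset_of_ssubset hW hTS)
      refine ⟨φ, fun a ha b hb hab => hφ a ha b hb ?_⟩
      obtain ⟨-, h | ⟨h, h'⟩ | ⟨h, h'⟩⟩ := hab
      · exact h
      · exact absurd (h ▸ ha) hpW
      · exact absurd (h ▸ hb) hpW
    refine ⟨W, hW, hpW, hcr.two_le, ?_⟩
    have := identG_rho G p q W (fun h => hq (hW h)) hpW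
    linarith

lemma claim10 {V : Type} {G : SimpleGraph V} {S : Finset V} (ih : IHyp S.card)
    (hS : Crit G S) (hrho : 4 < rho G S) {x y p q r s : V}
    (hx : IsNb G S x y p q) (hy : IsNb G S y x r s) : G.Adj p q := by
  by_contra hpq
  have hx' := hx
  have hy' := hy
  obtain ⟨hxS, hyS, hpS, hqS, hxy, hxp, hxq, hyp, hyq, hne, hxN⟩ := hx'
  have e1 : insert q (((S.erase x).erase y).erase q) = (S.erase x).erase y :=
    Finset.insert_erase (by simp [hqS, hyq.symm, hxq.ne.symm])
  rcases ident_alt ih hS (T := ((S.erase x).erase y).erase q) (p := p) (q := q) (by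
    rw [e1]
    exact Finset.ssubset_of_subset_of_ssubset (Finset.erase_subset _ _) (Finset.erase_ssubset hxS))
    (by simp) (by simp [hpS, hne, hyp.symm, hxp.ne.symm]) hpq with ⟨φ, hφ, hpp⟩ | ⟨W, hW, hpW, h2, hr⟩
  · rw [e1] at hφ
    apply hS.1
    have : ∀ p r s : Fin 3, ∃ c d : Fin 3, c ≠ d ∧ c ≠ p ∧ d ≠ r ∧ d ≠ s := by decide
    obtain ⟨c, d, h1, h2, h3, h4⟩ := this (φ p) (φ r) (φ s)
    exact ext_two hx hy φ hφ c d h1 h2 (hpp ▸ h2) h3 h4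
  · have hxW : x ∉ insert q W := by
      intro h
      rcases Finset.mem_insert.mp h with h | h
      · exact hxq.ne h
      · simpa using hW h
    have hqW : q ∉ W := fun h => by simpa using hW h
    have h5 := rho_insert G (insert q W) {p, q} x hxW (by
      intro w hw; simp only [Finset.mem_insert, Finset.mem_singleton] at hw ⊢
      rcases hw with rfl | rfl <;> simp [hpW]) (by
      intro w hw; simp only [Finset.mem_insert, Finset.mem_singleton] at hw
      rcases hw with rfl | rfl <;> assumption)
    rw [Finset.card_pair hne] at h5
    have h6 : insert x (insert q W) ⊂ S := by
      rw [Finset.ssubset_iff_of_subset]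
      · refine ⟨y, hyS, ?_⟩
        simp only [Finset.mem_insert, not_or]
        exact ⟨hxy.ne.symm, hyq, fun h => by simpa using hW h⟩
      · intro w hw
        simp only [Finset.mem_insert] at hw
        rcases hw with rfl | rfl | hw
        · exact hxS
        · exact hqS
        · have := hW hw
          simp only [Finset.mem_erase] at this
          exact this.2.2.2
    have := claim9 ih hS hrho _ h6 (by
      rw [Finset.card_insert_of_notMem hxW, Finset.card_insert_of_notMem hqW]; omega)
    push_cast at h5
    linarith

lemma claim11 {V : Type} {G : SimpleGraph V} {S : Finset V} (ih : IHyp S.card)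
    (hS : Crit G S) (hrho : 4 < rho G S) {x y z a b : V}
    (hx : IsNb G S x y z a) (hy : IsNb G S y x z b) : False := by
  have hx' := hx
  have hy' := hy
  obtain ⟨hxS, hyS, hzS, haS, hxy, hxz, hxa, hyz, hya, hza, hxN⟩ := hx'
  obtain ⟨-, -, -, hbS, -, hyz', hyb, -, hxb, hzb, hyN⟩ := hy'
  have hss : (S.erase x).erase y ⊂ S :=
    Finset.ssubset_of_subset_of_ssubset (Finset.erase_subset _ _) (Finset.erase_ssubset hxS)
  by_cases hab : a = b
  · subst hab
    have hadj : G.Adj z a := claim10 ih hS hrho hx hy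
    -- K4
    have hK : ({x, y, z, a} : Finset V) = S := by
      by_contra hne
      have hsub : ({x, y, z, a} : Finset V) ⊆ S := by
        intro w hw
        simp only [Finset.mem_insert, Finset.mem_singleton] at hw
        rcases hw with rfl | rfl | rfl | rfl <;> assumption
      obtain ⟨φ, hφ⟩ := hS.2 _ (hsub.ssubset_of_ne hne)
      have h1 := hφ x (by simp) y (by simp) hxy
      have h2 := hφ x (by simp) z (by simp) hxz
      have h3 := hφ x (by simp) a (by simp) hxa
      have h4 := hφ y (by simp) z (by simp) hyz'
      have h5 := hφ y (by simp) a (by simp) hyb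
      have h6 := hφ z (by simp) a (by simp) hadj
      generalize φ x = X at *
      generalize φ y = Y at *
      generalize φ z = Z at *
      generalize φ a = A at *
      revert X Y Z A
      decide
    have hr : rho G {x, y, z, a} ≤ 4 := by
      have e0 : rho G {a} ≤ 10 := by
        unfold rho
        have := adjCount_nonneg G {a} {a}
        simp; linarith
      have e1 := rho_insert G {a} {a} z (by simp [hza]) (by simp) (by simpa using hadj)
      have e2 := rho_insert G {z, a} {z, a} y (by simp [hyz, hya]) (by simp) (by simp [hyz', hyb])
      have e3 := rho_insert G {y, z, a} {y, z, a} x (by simp [hxy.ne, hxz.ne, hxa.ne]) (by simp)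
        (by simp [hxy, hxz, hxa])
      rw [Finset.card_singleton] at e1
      rw [Finset.card_pair hza] at e2
      rw [Finset.card_eq_three.mpr ⟨y, z, a, hyz, hya, hza, rfl⟩] at e3
      push_cast at e1 e2 e3
      linarith
    rw [hK] at hr
    linarith
  · obtain ⟨φ, hφ, hne⟩ := addE_col (claim_add ih hS hrho _ hss a b) hab
      (by simp [haS, hya.symm, hxa.ne.symm]) (by simp [hbS, hxb.symm, hyb.ne.symm])
    apply hS.1
    have : ∀ z a b : Fin 3, a ≠ b → ∃ c d : Fin 3, c ≠ d ∧ c ≠ z ∧ c ≠ a ∧ d ≠ z ∧ d ≠ b := by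
      decide
    obtain ⟨c, d, h1, h2, h3, h4, h5⟩ := this (φ z) _ _ hne
    exact ext_two hx hy φ hφ c d h1 h2 h3 h4 h5

lemma isNb_of_card {V : Type} {G : SimpleGraph V} {S : Finset V} {x y : V} (hx : x ∈ S)
    (hy : y ∈ S) (hxy : G.Adj x y) (h : (S.filter (G.Adj x)).card = 3) :
    ∃ p q, IsNb G S x y p q := by
  have hm : y ∈ S.filter (G.Adj x) := by simp [hy, hxy]
  have h2 : ((S.filter (G.Adj x)).erase y).card = 2 := by rw [Finset.card_erase_of_mem hm, h]
  obtain ⟨p, q, hpq, he⟩ := Finset.card_eq_two.mp h2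
  have hp : p ∈ (S.filter (G.Adj x)).erase y := by rw [he]; simp
  have hq : q ∈ (S.filter (G.Adj x)).erase y := by rw [he]; simp
  simp only [Finset.mem_erase, Finset.mem_filter] at hp hq
  refine ⟨p, q, hx, hy, hp.2.1, hq.2.1, hxy, hp.2.2, hq.2.2, hp.1.symm, hq.1.symm, hpq, ?_⟩
  intro b hb hxb
  by_cases hby : b = y
  · exact Or.inl hby
  · right
    have : b ∈ (S.filter (G.Adj x)).erase y := by simp [hby, hb, hxb]
    rw [he] at this
    simpa using this

lemma IsNb.swap23 {V : Type} {G : SimpleGraph V} {S : Finset V} {x y p q : V}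
    (h : IsNb G S x y p q) : IsNb G S x y q p := by
  obtain ⟨h1, h2, h3, h4, h5, h6, h7, h8, h9, h10, h11⟩ := h
  exact ⟨h1, h2, h4, h3, h5, h7, h6, h9, h8, h10.symm, fun b hb hh => by
    rcases h11 b hb hh with h | h | h <;> simp [h]⟩

lemma IsNb.rot {V : Type} {G : SimpleGraph V} {S : Finset V} {x y p q : V}
    (h : IsNb G S x y p q) : IsNb G S x p y q := by
  obtain ⟨h1, h2, h3, h4, h5, h6, h7, h8, h9, h10, h11⟩ := h
  exact ⟨h1, h3, h2, h4, h6, h5, h7, h8.symm, h10, h9, fun b hb hh => by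
    rcases h11 b hb hh with h | h | h <;> simp [h]⟩

/-- a degree three vertex has at most one neighbour of degree three -/
lemma deg3_nbr {V : Type} {G : SimpleGraph V} {S : Finset V} (ih : IHyp S.card)
    (hS : Crit G S) (hrho : 4 < rho G S) {x : V} (hxS : x ∈ S)
    (hx : (S.filter (G.Adj x)).card = 3) :
    2 ≤ (S.filter (fun w => G.Adj x w ∧ 4 ≤ (S.filter (G.Adj w)).card)).card := by
  by_contra hcon
  have hsplit := Finset.card_filter_add_card_filter_not (s := S.filter (G.Adj x))
    (fun w => 4 ≤ (S.filter (G.Adj w)).card)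
  rw [Finset.filter_filter, Finset.filter_filter, hx] at hsplit
  have h2 : 1 < (S.filter (fun w => G.Adj x w ∧ ¬ 4 ≤ (S.filter (G.Adj w)).card)).card := by omega
  obtain ⟨y1, h1, y2, h2, hne⟩ := Finset.one_lt_card.mp h2
  simp only [Finset.mem_filter] at h1 h2
  have hd1 : (S.filter (G.Adj y1)).card = 3 := by
    have := min_deg hS y1 h1.1; omega
  have hd2 : (S.filter (G.Adj y2)).card = 3 := by
    have := min_deg hS y2 h2.1; omega
  have main : ∃ w, IsNb G S x y1 y2 w := by
    obtain ⟨p, q, hpq⟩ := isNb_of_card hxS h1.1 h1.2.1 hx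
    rcases hpq.2.2.2.2.2.2.2.2.2.2 y2 h2.1 h2.2.1 with h | h | h
    · exact absurd h.symm hne
    · exact ⟨q, h ▸ hpq⟩
    · exact ⟨p, h ▸ hpq.swap23⟩
  obtain ⟨w, hw⟩ := main
  obtain ⟨r, s, hrs⟩ := isNb_of_card h1.1 hxS h1.2.1.symm hd1
  have hadj := claim10 ih hS hrho hw hrs
  -- y2 ~ w, and y2 ~ x, x ~ w
  obtain ⟨p, q, hpq⟩ := isNb_of_card h2.1 hxS h2.2.1.symm hd2
  have hwS : w ∈ S := hw.2.2.2.1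
  have hxw : G.Adj x w := hw.2.2.2.2.2.2.1
  have : ∃ b, IsNb G S y2 x w b := by
    rcases hpq.2.2.2.2.2.2.2.2.2.2 w hwS hadj with h | h | h
    · exact absurd h.symm hxw.ne
    · exact ⟨q, h ▸ hpq⟩
    · exact ⟨p, h ▸ hpq.swap23⟩
  obtain ⟨b, hb⟩ := this
  exact claim11 ih hS hrho (hw.rot.swap23) hb

theorem KY_aux (n : ℕ) : IHyp n := by
  induction n with
  | zero => intro V G S h; omega
  | succ n ihn =>
    intro V G S hlt hS
    rcases Nat.lt_succ_iff_lt_or_eq.mp hlt with h | h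
    · exact ihn V G S h hS
    by_contra hcon
    push Not at hcon
    have ih : IHyp S.card := h ▸ ihn
    set d : V → ℕ := fun v => (S.filter (G.Adj v)).card with hd
    have hA : adjCount G S S = ∑ v ∈ S, (d v : ℤ) := by
      unfold adjCount
      refine Finset.sum_congr rfl fun v _ => ?_
      simp [hd]
    have h3 : ∀ v ∈ S, 3 ≤ d v := fun v hv => min_deg hS v hv
    set X : ℤ := ∑ v ∈ S, ∑ w ∈ S, if (d v = 3 ∧ G.Adj v w ∧ 4 ≤ d w) then (1:ℤ) else 0 with hX
    have hX1 : ∑ v ∈ S, (if d v = 3 then (2:ℤ) else 0) ≤ X := by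
      refine Finset.sum_le_sum fun v hv => ?_
      split_ifs with h
      · have := deg3_nbr ih hS hcon hv h
        simp only [h, true_and]
        simp only [Finset.sum_boole]
        exact_mod_cast this
      · refine Finset.sum_nonneg fun w _ => ?_
        split_ifs <;> simp
    have hX2 : X ≤ ∑ w ∈ S, (if 4 ≤ d w then (d w : ℤ) else 0) := by
      rw [hX, Finset.sum_comm]
      refine Finset.sum_le_sum fun w hw => ?_
      split_ifs with h
      · have : (d w : ℤ) = ∑ v ∈ S, if G.Adj w v then (1:ℤ) else 0 := by simp [hd]
        rw [this]
        refine Finset.sum_le_sum fun v _ => ?_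
        by_cases h5 : G.Adj w v
        · rw [if_pos h5]; split_ifs <;> simp
        · rw [if_neg h5, if_neg (fun hh => h5 hh.2.1.symm)]
      · refine le_of_eq (Finset.sum_eq_zero fun v _ => ?_)
        rw [if_neg (fun hh => h hh.2.2)]
    have hX3 : ∑ w ∈ S, (if 4 ≤ d w then (d w : ℤ) else 0) - ∑ v ∈ S, (if d v = 3 then (2:ℤ) else 0)
        ≤ ∑ v ∈ S, (6 * (d v : ℤ) - 20) := by
      rw [← Finset.sum_sub_distrib]
      refine Finset.sum_le_sum fun v hv => ?_
      have := h3 v hv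
      split_ifs <;> omega
    rw [Finset.sum_sub_distrib, ← Finset.mul_sum, ← hA] at hX3
    simp only [Finset.sum_const, nsmul_eq_mul] at hX3
    unfold rho at hcon
    linarith

theorem KY_main {V : Type} {G : SimpleGraph V} {S : Finset V} (hS : Crit G S) : rho G S ≤ 4 :=
  KY_aux (S.card + 1) V G S (by omega) hS

end KY2
end RepProof

namespace RepProof
open scoped Classical

section Mac

lemma zmod2_cases (x : ZMod 2) : x = 0 ∨ x = 1 := by revert x; decide
lemma zmod2_add_self (x : ZMod 2) : x + x = 0 := by revert x; decide
lemma zmod2_eq_of_add {x y : ZMod 2} (h : x + y = 0) : x = y := by revert x y; decide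

/-- mod 2 chains on ordered pairs -/
abbrev Chn (V : Type) := V → V → ZMod 2

lemma chn_add_self {V : Type} (c : Chn V) : c + c = 0 := by
  funext a b; exact zmod2_add_self _

def SuppOn {V : Type} (G : SimpleGraph V) (c : Chn V) : Prop :=
  (∀ a b, c a b = c b a) ∧ ∀ a b, ¬ G.Adj a b → c a b = 0

def bd {V : Type} [Fintype V] (c : Chn V) (v : V) : ZMod 2 := ∑ w, c v w

def IsCyc {V : Type} [Fintype V] (G : SimpleGraph V) (c : Chn V) : Prop :=
  SuppOn G c ∧ ∀ v, bd c v = 0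

def E {V : Type} (x y : V) : Chn V := fun a b => if (a = x ∧ b = y) ∨ (a = y ∧ b = x) then 1 else 0

def dl {V : Type} (x : V) : V → ZMod 2 := fun v => if v = x then 1 else 0

lemma SuppOn.add {V : Type} {G : SimpleGraph V} {c d : Chn V} (hc : SuppOn G c) (hd : SuppOn G d) :
    SuppOn G (c + d) := by
  refine ⟨fun a b => ?_, fun a b h => ?_⟩
  · simp [hc.1 a b, hd.1 a b]
  · simp [hc.2 a b h, hd.2 a b h]

lemma SuppOn.zero {V : Type} (G : SimpleGraph V) : SuppOn G (0 : Chn V) :=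
  ⟨fun _ _ => rfl, fun _ _ _ => rfl⟩

lemma SuppOn.sum {V ι : Type} {G : SimpleGraph V} (D : Finset ι) (c : ι → Chn V)
    (hc : ∀ i ∈ D, SuppOn G (c i)) : SuppOn G (∑ i ∈ D, c i) := by
  induction D using Finset.induction_on with
  | empty => simpa using SuppOn.zero G
  | insert a s ha ih =>
    rw [Finset.sum_insert ha]
    exact (hc a (by simp)).add (ih fun i hi => hc i (by simp [hi]))

lemma SuppOn.mono {V : Type} {G H : SimpleGraph V} {c : Chn V} (hc : SuppOn G c) (h : G ≤ H) :
    SuppOn H c := ⟨hc.1, fun a b hab => hc.2 a b fun h' => hab (h h')⟩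

lemma SuppOn.diag {V : Type} {G : SimpleGraph V} {c : Chn V} (hc : SuppOn G c) (a : V) :
    c a a = 0 := hc.2 a a (G.loopless.irrefl a)

lemma SuppOn.adj {V : Type} {G : SimpleGraph V} {c : Chn V} (hc : SuppOn G c) {a b : V}
    (h : c a b ≠ 0) : G.Adj a b := by
  by_contra h'; exact h (hc.2 a b h')

lemma E_symm {V : Type} (x y a b : V) : E x y a b = E x y b a := by
  unfold E; congr 1; apply propext; tauto

lemma E_comm {V : Type} (x y : V) : E x y = E y x := by
  funext a b; unfold E; congr 1; apply propext; tauto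

lemma E_supp {V : Type} {G : SimpleGraph V} {x y : V} (h : G.Adj x y) : SuppOn G (E x y) := by
  refine ⟨E_symm x y, fun a b hab => ?_⟩
  unfold E
  rw [if_neg]
  rintro (⟨rfl, rfl⟩ | ⟨rfl, rfl⟩)
  · exact hab h
  · exact hab h.symm

lemma bd_add {V : Type} [Fintype V] (c d : Chn V) (v : V) : bd (c + d) v = bd c v + bd d v := by
  simp [bd, Finset.sum_add_distrib]

lemma bd_sum {V ι : Type} [Fintype V] (D : Finset ι) (c : ι → Chn V) (v : V) :
    bd (∑ i ∈ D, c i) v = ∑ i ∈ D, bd (c i) v := by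
  simp only [bd, Finset.sum_apply]
  rw [Finset.sum_comm]

lemma bd_E {V : Type} [Fintype V] {x y : V} (h : x ≠ y) (v : V) : bd (E x y) v = dl x v + dl y v := by
  unfold bd E dl
  by_cases h1 : v = x
  · subst h1
    simp [h]
  · by_cases h2 : v = y
    · subst h2; simp [h1]
    · simp [h1, h2]

lemma IsCyc.add {V : Type} [Fintype V] {G : SimpleGraph V} {c d : Chn V} (hc : IsCyc G c)
    (hd : IsCyc G d) : IsCyc G (c + d) :=
  ⟨hc.1.add hd.1, fun v => by rw [bd_add, hc.2, hd.2, add_zero]⟩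

lemma IsCyc.zero {V : Type} [Fintype V] (G : SimpleGraph V) : IsCyc G (0 : Chn V) :=
  ⟨SuppOn.zero G, fun v => by simp [bd]⟩

lemma IsCyc.mono {V : Type} [Fintype V] {G H : SimpleGraph V} {c : Chn V} (hc : IsCyc G c)
    (h : G ≤ H) : IsCyc H c := ⟨hc.1.mono h, hc.2⟩

/-- every chain is a sum of elementary chains -/
lemma chain_induction {V : Type} [Fintype V] {G : SimpleGraph V} {P : Chn V → Prop}
    (h0 : P 0) (hadd : ∀ c d, P c → P d → P (c + d)) (hE : ∀ x y, G.Adj x y → P (E x y))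
    (c : Chn V) (hc : SuppOn G c) : P c := by
  suffices h : ∀ n (c : Chn V), SuppOn G c →
      (Finset.univ.filter (fun p : V × V => c p.1 p.2 ≠ 0)).card = n → P c from h _ c hc rfl
  intro n
  induction n using Nat.strong_induction_on with
  | _ n ih =>
    intro c hc hn
    by_cases hz : ∃ a b, c a b ≠ 0
    · obtain ⟨a, b, hab⟩ := hz
      have hadj := hc.adj hab
      have h1 : P (c + E a b) := by
        refine ih _ ?_ _ (hc.add (E_supp hadj)) rfl
        rw [← hn]
        apply Finset.card_lt_card
        have hab1 : c a b = 1 := (zmod2_cases _).resolve_left hab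
        have hba1 : c b a = 1 := by rw [hc.1]; exact hab1
        rw [Finset.ssubset_iff_of_subset]
        · refine ⟨(a, b), by simp [hab], ?_⟩
          intro hm
          apply (Finset.mem_filter.mp hm).2
          simp [E, hab1, zmod2_add_self]
        · rintro ⟨p, q⟩ hpq
          simp only [Finset.mem_filter, Finset.mem_univ, true_and, Pi.add_apply] at hpq ⊢
          intro h
          rw [h, zero_add] at hpq
          unfold E at hpq
          split_ifs at hpq with h'
          · rcases h' with ⟨rfl, rfl⟩ | ⟨rfl, rfl⟩
            · exact hab h
            · rw [hba1] at h; exact one_ne_zero h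
          · exact hpq rfl
      have h2 : c = (c + E a b) + E a b := by rw [add_assoc, chn_add_self, add_zero]
      rw [h2]
      exact hadd _ _ h1 (hE a b hadj)
    · push Not at hz
      have : c = 0 := by funext a b; exact hz a b
      rw [this]; exact h0

structure IsMac {V ι : Type} [Fintype V] [Fintype ι] (G : SimpleGraph V) (F : ι → Chn V) : Prop where
  cyc : ∀ i, IsCyc G (F i)
  two : ∀ a b, (Finset.univ.filter (fun i => F i a b ≠ 0)).card ≤ 2
  sum : ∑ i, F i = 0
  gen : ∀ c, IsCyc G c → ∃ D : Finset ι, c = ∑ i ∈ D, F i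

lemma IsMac.pair {V ι : Type} [Fintype V] [Fintype ι] {G : SimpleGraph V} {F : ι → Chn V}
    (h : IsMac G F) {a b : V} {i : ι} (hi : F i a b ≠ 0) :
    ∃ j, j ≠ i ∧ F j a b ≠ 0 ∧ (∀ k, F k a b ≠ 0 → k = i ∨ k = j) ∧
      ∀ D : Finset ι, (∑ k ∈ D, F k) a b = (if i ∈ D then 1 else 0) + (if j ∈ D then 1 else 0) := by
  have h2 := h.two a b
  have hs : ∑ k, F k a b = 0 := by
    have := congrFun (congrFun h.sum a) b
    simpa [Finset.sum_apply] using this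
  have hex : ∃ j, j ≠ i ∧ F j a b ≠ 0 := by
    by_contra hcon
    push Not at hcon
    rw [Finset.sum_eq_single i (fun j _ hj => hcon j hj) (by simp)] at hs
    exact hi hs
  obtain ⟨j, hji, hj⟩ := hex
  have hk : ∀ k, F k a b ≠ 0 → k = i ∨ k = j := by
    intro k hk
    by_contra hcon
    push Not at hcon
    have : ({i, j, k} : Finset ι) ⊆ Finset.univ.filter (fun i => F i a b ≠ 0) := by
      intro m hm
      simp only [Finset.mem_insert, Finset.mem_singleton] at hm
      rcases hm with rfl | rfl | rfl <;> simpa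
    have h3 := Finset.card_le_card this
    rw [Finset.card_eq_three.mpr ⟨i, j, k, hji.symm, hcon.1.symm, hcon.2.symm, rfl⟩] at h3
    omega
  refine ⟨j, hji, hj, hk, fun D => ?_⟩
  rw [Finset.sum_apply, Finset.sum_apply]
  have e : ∀ k, F k a b = (if k = i then 1 else 0) + (if k = j then 1 else 0) := by
    intro k
    by_cases h1 : k = i
    · subst h1; simp [hji.symm, (zmod2_cases _).resolve_left hi]
    · by_cases h2 : k = j
      · subst h2; simp [h1, (zmod2_cases _).resolve_left hj]
      · simp only [h1, h2, if_false, add_zero]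
        by_contra h3
        rcases hk k h3 with h | h
        · exact h1 h
        · exact h2 h
  simp only [e, Finset.sum_add_distrib, Finset.sum_ite_eq']

/-- deleting an edge -/
lemma IsMac.del {V ι : Type} [Fintype V] [Fintype ι] {G : SimpleGraph V} {F : ι → Chn V}
    (h : IsMac G F) {a b : V} {i j : ι} (hij : i ≠ j) (hi : F i a b ≠ 0) (hj : F j a b ≠ 0) :
    IsMac (G.deleteEdges {s(a, b)}) (fun k => F k + if k = i ∨ k = j then F j else 0) := by
  obtain ⟨j', hjpi, hj'0, hk, hD⟩ := h.pair hi
  have : j' = j := ((hk j hj).resolve_left hij.symm).symm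
  subst this
  have hi1 : F i a b = 1 := (zmod2_cases _).resolve_left hi
  have hj1 : F j' a b = 1 := (zmod2_cases _).resolve_left hj
  have hsumD : ∀ D : Finset ι, ∑ k ∈ D, (F k + if k = i ∨ k = j' then F j' else 0) =
      ∑ k ∈ D, F k + ((if i ∈ D then F j' else 0) + (if j' ∈ D then F j' else 0)) := by
    intro D
    rw [Finset.sum_add_distrib]
    congr 1
    rw [← Finset.sum_ite_eq' D i (fun _ => F j'), ← Finset.sum_ite_eq' D j' (fun _ => F j'),
      ← Finset.sum_add_distrib]
    refine Finset.sum_congr rfl fun k _ => ?_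
    by_cases h1 : k = i
    · subst h1; simp [hij]
    · simp [h1]
  have hF' : ∀ k, (F k + if k = i ∨ k = j' then F j' else 0) a b = 0 := by
    intro k
    by_cases h1 : k = i
    · subst h1; simp [hi1, hj1, zmod2_add_self]
    · by_cases h2 : k = j'
      · subst h2; simp [zmod2_add_self]
      · simp only [h1, h2, or_self, if_false, add_zero]
        by_contra h3
        rcases hk k h3 with h | h
        · exact h1 h
        · exact h2 h
  have hcyc : ∀ k, IsCyc G (F k + if k = i ∨ k = j' then F j' else 0) := by
    intro k
    split_ifs
    · exact (h.cyc k).add (h.cyc j')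
    · exact (h.cyc k).add (IsCyc.zero G)
  refine ⟨fun k => ?_, fun p q => ?_, ?_, fun c hc => ?_⟩
  · refine ⟨⟨(hcyc k).1.1, fun p q hpq => ?_⟩, (hcyc k).2⟩
    by_cases hadj : G.Adj p q
    · have : s(p, q) = s(a, b) := by
        by_contra hne
        exact hpq (by rw [SimpleGraph.deleteEdges_adj]; exact ⟨hadj, by simpa using hne⟩)
      rw [Sym2.eq_iff] at this
      rcases this with ⟨rfl, rfl⟩ | ⟨rfl, rfl⟩
      · exact hF' k
      · rw [(hcyc k).1.1]; exact hF' k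
    · exact (hcyc k).1.2 p q hadj
  · refine le_trans ?_ (h.two p q)
    by_cases h1 : F i p q = 0
    · by_cases h2 : F j' p q = 0
      · apply Finset.card_le_card
        intro k
        simp only [Finset.mem_filter, Finset.mem_univ, true_and]
        intro hh hk0
        apply hh
        simp only [Pi.add_apply, hk0, zero_add]
        split_ifs <;> simp [h2]
      · rw [← Finset.card_map (Equiv.swap i j').toEmbedding]
        apply Finset.card_le_card
        intro k
        simp only [Finset.mem_map, Finset.mem_filter, Finset.mem_univ, true_and,
          Equiv.coe_toEmbedding]
        rintro ⟨m, hm, rfl⟩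
        by_cases hmi : m = i
        · subst hmi; simpa using h2
        · by_cases hmj : m = j'
          · subst hmj; simp [zmod2_add_self] at hm
          · rw [Equiv.swap_apply_of_ne_of_ne hmi hmj]
            simpa [hmi, hmj] using hm
    · apply Finset.card_le_card
      intro k
      simp only [Finset.mem_filter, Finset.mem_univ, true_and]
      intro hh hk0
      apply hh
      have hki : k ≠ i := by rintro rfl; exact h1 hk0
      by_cases hkj : k = j'
      · subst hkj; simp [hk0]
      · simp [hki, hkj, hk0]
  · rw [hsumD]; simp [h.sum, chn_add_self]
  · obtain ⟨D, hcD⟩ := h.gen c (hc.mono (SimpleGraph.deleteEdges_le _))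
    refine ⟨D, ?_⟩
    have hcab : c a b = 0 := hc.1.2 a b (by simp)
    rw [hsumD, ← hcD]
    have h5 := hD D
    rw [← hcD, hcab] at h5
    by_cases h6 : i ∈ D <;> by_cases h7 : j' ∈ D <;> simp [h6, h7, chn_add_self] at h5 ⊢

lemma IsMac.del_ex {V ι : Type} [Fintype V] [Fintype ι] {G : SimpleGraph V} {F : ι → Chn V}
    (h : IsMac G F) (a b : V) :
    ∃ F' : ι → Chn V, IsMac (G.deleteEdges {s(a, b)}) F' ∧ ∀ k, F k a b = 0 → F' k = F k := by
  by_cases hz : ∃ i, F i a b ≠ 0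
  · obtain ⟨i, hi⟩ := hz
    obtain ⟨j, hji, hj, -, -⟩ := h.pair hi
    refine ⟨_, h.del hji.symm hi hj, fun k hk => ?_⟩
    have h1 : k ≠ i := by rintro rfl; exact hi hk
    have h2 : k ≠ j := by rintro rfl; exact hj hk
    simp [h1, h2]
  · push Not at hz
    refine ⟨F, ⟨fun k => ⟨⟨(h.cyc k).1.1, fun p q hpq => ?_⟩, (h.cyc k).2⟩, h.two, h.sum,
      fun c hc => h.gen c (hc.mono (SimpleGraph.deleteEdges_le _))⟩, fun _ _ => rfl⟩
    by_cases hadj : G.Adj p q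
    · have : s(p, q) = s(a, b) := by
        by_contra hne
        exact hpq (by rw [SimpleGraph.deleteEdges_adj]; exact ⟨hadj, by simpa using hne⟩)
      rw [Sym2.eq_iff] at this
      rcases this with ⟨rfl, rfl⟩ | ⟨rfl, rfl⟩
      · exact hz k
      · rw [(h.cyc k).1.1]; exact hz k
    · exact (h.cyc k).1.2 p q hadj

/-- passing to a subgraph; faces contained in the subgraph survive -/
lemma IsMac.sub {V ι : Type} [Fintype V] [Fintype ι] {G H : SimpleGraph V} {F : ι → Chn V}
    (h : IsMac G F) (hHG : H ≤ G) :
    ∃ F' : ι → Chn V, IsMac H F' ∧ ∀ k, SuppOn H (F k) → F' k = F k := by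
  suffices hs : ∀ n (G : SimpleGraph V) (F : ι → Chn V), IsMac G F → H ≤ G →
      (Finset.univ.filter (fun p : V × V => G.Adj p.1 p.2)).card = n →
      ∃ F' : ι → Chn V, IsMac H F' ∧ ∀ k, SuppOn H (F k) → F' k = F k from hs _ G F h hHG rfl
  intro n
  induction n using Nat.strong_induction_on with
  | _ n ih =>
    intro G F h hHG hn
    by_cases hz : ∃ a b, G.Adj a b ∧ ¬ H.Adj a b
    · obtain ⟨a, b, hab, hnab⟩ := hz
      obtain ⟨F1, hF1, hk1⟩ := h.del_ex a b
      obtain ⟨F2, hF2, hk2⟩ := ih _ (by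
        rw [← hn]
        apply Finset.card_lt_card
        rw [Finset.ssubset_iff_of_subset]
        · exact ⟨(a, b), by simp [hab], by simp⟩
        · intro p
          simp only [Finset.mem_filter, Finset.mem_univ, true_and]
          exact fun hp => SimpleGraph.deleteEdges_le _ hp) (G.deleteEdges {s(a, b)}) F1 hF1 (by
        intro p q hpq
        rw [SimpleGraph.deleteEdges_adj]
        refine ⟨hHG hpq, ?_⟩
        intro h
        simp only [Set.mem_singleton_iff, Sym2.eq_iff] at h
        rcases h with ⟨rfl, rfl⟩ | ⟨rfl, rfl⟩
        · exact hnab hpq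
        · exact hnab hpq.symm) rfl
      refine ⟨F2, hF2, fun k hk => ?_⟩
      have h1 := hk1 k (hk.2 a b hnab)
      rw [← h1]
      exact hk2 k (h1 ▸ hk)
    · push Not at hz
      have : G = H := le_antisymm (fun a b hab => hz a b hab) hHG
      subst this
      exact ⟨F, h, fun _ _ => rfl⟩

/-! ### push forward -/

def push {V V' : Type} [Fintype V] (f : V → V') (c : Chn V) : Chn V' :=
  fun x y => ∑ a, ∑ b, if f a = x ∧ f b = y then c a b else 0

lemma push_add {V V' : Type} [Fintype V] (f : V → V') (c d : Chn V) :
    push f (c + d) = push f c + push f d := by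
  funext x y
  simp only [push, Pi.add_apply]
  rw [← Finset.sum_add_distrib]
  refine Finset.sum_congr rfl fun a _ => ?_
  rw [← Finset.sum_add_distrib]
  refine Finset.sum_congr rfl fun b _ => ?_
  split_ifs <;> simp

lemma push_zero {V V' : Type} [Fintype V] (f : V → V') : push f (0 : Chn V) = 0 := by
  funext x y; simp [push]

lemma push_sum {V V' ι : Type} [Fintype V] (f : V → V') (D : Finset ι) (c : ι → Chn V) :
    push f (∑ i ∈ D, c i) = ∑ i ∈ D, push f (c i) := by
  induction D using Finset.induction_on with
  | empty => simp [push_zero]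
  | insert a s ha ih => rw [Finset.sum_insert ha, Finset.sum_insert ha, push_add, ih]

lemma push_E {V V' : Type} [Fintype V] (f : V → V') (a b : V) (h : f a ≠ f b) :
    push f (E a b) = E (f a) (f b) := by
  have hab : a ≠ b := fun h' => h (h' ▸ rfl)
  have e : ∀ p q, E a b p q = (if p = a then (if q = b then 1 else 0) else 0) +
      (if p = b then (if q = a then (1 : ZMod 2) else 0) else 0) := by
    intro p q
    unfold E
    by_cases h1 : p = a
    · subst h1; simp [hab]
    · simp only [h1, false_and, false_or, if_false, zero_add]
      by_cases h2 : p = b <;> simp [h2]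
  funext x y
  have : push f (E a b) x y = (if f a = x ∧ f b = y then 1 else 0) +
      (if f b = x ∧ f a = y then 1 else 0) := by
    unfold push
    simp only [e]
    have e2 : ∀ p q, (if f p = x ∧ f q = y then ((if p = a then (if q = b then 1 else 0) else 0) +
      (if p = b then (if q = a then (1 : ZMod 2) else 0) else 0)) else 0) =
      (if q = b then (if p = a then (if f a = x ∧ f b = y then 1 else 0) else 0) else 0) +
      (if q = a then (if p = b then (if f b = x ∧ f a = y then 1 else 0) else 0) else 0) := by
      intro p q
      by_cases h1 : p = a
      · subst h1
        simp only [hab, if_true, if_false, add_zero, ite_self]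
        by_cases h2 : q = b <;> simp [h2]
      · simp only [h1, if_false, zero_add, ite_self]
        by_cases h2 : p = b
        · subst h2; by_cases h3 : q = a <;> simp [h3]
        · simp [h2]
    simp only [e2, Finset.sum_add_distrib, Finset.sum_ite_eq', Finset.mem_univ, if_true]
  rw [this]
  unfold E
  by_cases h1 : f a = x ∧ f b = y
  · have : ¬ (f b = x ∧ f a = y) := by
      rintro ⟨h2, -⟩; exact h (h1.1.trans h2.symm)
    rw [if_pos h1, if_neg this, add_zero, if_pos (Or.inl ⟨h1.1.symm, h1.2.symm⟩)]
  · by_cases h2 : f b = x ∧ f a = y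
    · rw [if_neg h1, if_pos h2, zero_add, if_pos (Or.inr ⟨h2.1.symm, h2.2.symm⟩)]
    · rw [if_neg h1, if_neg h2, if_neg, add_zero]
      rintro (⟨h3, h4⟩ | ⟨h3, h4⟩)
      · exact h1 ⟨h3.symm, h4.symm⟩
      · exact h2 ⟨h3.symm, h4.symm⟩

lemma push_symm {V V' : Type} [Fintype V] (f : V → V') (c : Chn V) (hc : ∀ a b, c a b = c b a)
    (x y : V') : push f c x y = push f c y x := by
  unfold push
  rw [Finset.sum_comm]
  refine Finset.sum_congr rfl fun a _ => Finset.sum_congr rfl fun b _ => ?_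
  rw [hc b a]; congr 1; apply propext; tauto

lemma sum_symm_zero {V : Type} [Fintype V] (c : Chn V) (hc : ∀ a b, c a b = c b a)
    (hd : ∀ a, c a a = 0) (S : Finset V) : ∑ a ∈ S, ∑ b ∈ S, c a b = 0 := by
  induction S using Finset.induction_on with
  | empty => simp
  | insert x s hx ih =>
    rw [Finset.sum_insert hx]
    simp only [Finset.sum_insert hx]
    rw [Finset.sum_add_distrib, ih, hd]
    have : ∑ a ∈ s, c a x = ∑ a ∈ s, c x a := Finset.sum_congr rfl fun a _ => hc a x
    rw [this, add_zero, zero_add, zmod2_add_self]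

lemma push_diag {V V' : Type} [Fintype V] (f : V → V') (c : Chn V) (hc : ∀ a b, c a b = c b a)
    (hd : ∀ a, c a a = 0) (x : V') : push f c x x = 0 := by
  have := sum_symm_zero c hc hd (Finset.univ.filter (fun a => f a = x))
  rw [← this]
  unfold push
  rw [Finset.sum_filter]
  refine Finset.sum_congr rfl fun a _ => ?_
  rw [Finset.sum_filter]
  by_cases h : f a = x <;> simp [h]

lemma bd_push {V V' : Type} [Fintype V] [Fintype V'] (f : V → V') (c : Chn V) (x : V') :
    bd (push f c) x = ∑ a, if f a = x then bd c a else 0 := by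
  unfold bd push
  rw [Finset.sum_comm]
  refine Finset.sum_congr rfl fun a _ => ?_
  by_cases h : f a = x
  · simp only [h, true_and, if_true]
    rw [Finset.sum_comm]
    refine Finset.sum_congr rfl fun b _ => ?_
    simp
  · simp [h]

lemma push_supp {V V' : Type} [Fintype V] {f : V → V'} {G : SimpleGraph V} {G' : SimpleGraph V'}
    (h1 : ∀ a b, G.Adj a b → f a = f b ∨ G'.Adj (f a) (f b)) {c : Chn V} (hc : SuppOn G c) :
    SuppOn G' (push f c) := by
  refine ⟨push_symm f c hc.1, fun x y hxy => ?_⟩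
  by_cases he : x = y
  · subst he; exact push_diag f c hc.1 hc.diag x
  · unfold push
    refine Finset.sum_eq_zero fun a _ => Finset.sum_eq_zero fun b _ => ?_
    split_ifs with h
    · obtain ⟨rfl, rfl⟩ := h
      apply hc.2
      intro hab
      rcases h1 a b hab with h | h
      · exact he h
      · exact hxy h
    · rfl

lemma push_lift {V V' : Type} [Fintype V] [Fintype V'] {f : V → V'} {G : SimpleGraph V}
    {G' : SimpleGraph V'}
    (hE : ∀ x y, G'.Adj x y → ∃ a b, G.Adj a b ∧ f a = x ∧ f b = y)
    (hcon : ∀ a b, f a = f b → ∃ κ, SuppOn G κ ∧ (∀ v, bd κ v = dl a v + dl b v) ∧ push f κ = 0)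
    {c' : Chn V'} (hc' : IsCyc G' c') : ∃ c, IsCyc G c ∧ push f c = c' := by
  have h0 : ∃ c, SuppOn G c ∧ push f c = c' := by
    refine chain_induction (G := G') (P := fun c' => ∃ c, SuppOn G c ∧ push f c = c')
      ⟨0, SuppOn.zero G, push_zero f⟩ ?_ ?_ c' hc'.1
    · rintro c d ⟨c1, hc1, rfl⟩ ⟨d1, hd1, rfl⟩
      exact ⟨c1 + d1, hc1.add hd1, push_add f _ _⟩
    · intro x y hxy
      obtain ⟨a, b, hab, rfl, rfl⟩ := hE x y hxy
      exact ⟨E a b, E_supp hab, push_E f a b hxy.ne⟩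
  obtain ⟨c, hc, rfl⟩ := h0
  obtain ⟨r, hr1, hr2⟩ : ∃ r : V → V, (∀ a, f (r a) = f a) ∧ ∀ a b, f a = f b → r a = r b := by
    refine ⟨fun a => (Quotient.mk (Setoid.ker f) a).out, fun a => ?_, fun a b h => ?_⟩
    · exact Quotient.mk_out (s := Setoid.ker f) a
    · have : Quotient.mk (Setoid.ker f) a = Quotient.mk (Setoid.ker f) b := Quotient.sound h
      simp only [this]
  choose κ hκ1 hκ2 hκ3 using fun a => hcon a (r a) (hr1 a).symm
  set K : Chn V := ∑ a ∈ Finset.univ.filter (fun a => bd c a ≠ 0), κ a with hK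
  refine ⟨c + K, ⟨hc.add (SuppOn.sum _ _ fun a _ => hκ1 a), fun v => ?_⟩, ?_⟩
  · rw [bd_add, hK, bd_sum, Finset.sum_filter]
    have e : ∀ a, (if bd c a ≠ 0 then bd (κ a) v else 0) =
        bd c a * dl a v + bd c a * dl (r a) v := by
      intro a
      rw [hκ2]
      rcases zmod2_cases (bd c a) with h | h <;> simp [h]
    simp only [e, Finset.sum_add_distrib]
    have e1 : ∑ a, bd c a * dl a v = bd c v := by simp [dl]
    have e2 : ∑ a, bd c a * dl (r a) v = 0 := by
      by_cases hv : r v = v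
      · have := hc'.2 (f v)
        rw [bd_push] at this
        rw [← this]
        refine Finset.sum_congr rfl fun a _ => ?_
        unfold dl
        by_cases h : f a = f v
        · rw [if_pos h, if_pos ((hr2 a v h).trans hv).symm, mul_one]
        · rw [if_neg h, if_neg, mul_zero]
          intro h'; apply h; rw [h', hr1]
      · refine Finset.sum_eq_zero fun a _ => ?_
        unfold dl
        rw [if_neg, mul_zero]
        intro h'
        apply hv
        have : f v = f a := by rw [h', hr1]
        rw [hr2 v a this, ← h']
    rw [e1, e2, add_zero, zmod2_add_self]
  · rw [push_add, hK, push_sum, Finset.sum_eq_zero (fun a _ => hκ3 a), add_zero]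

lemma IsMac.push {V V' ι : Type} [Fintype V] [Fintype V'] [Fintype ι] {f : V → V'}
    {G : SimpleGraph V} {G' : SimpleGraph V'} {F : ι → Chn V} (h : IsMac G F)
    (h1 : ∀ a b, G.Adj a b → f a = f b ∨ G'.Adj (f a) (f b))
    (hE : ∀ x y, G'.Adj x y → ∃ a b, G.Adj a b ∧ f a = x ∧ f b = y)
    (hcon : ∀ a b, f a = f b → ∃ κ, SuppOn G κ ∧ (∀ v, bd κ v = dl a v + dl b v) ∧
      RepProof.push f κ = 0)
    (htwo : ∀ x y, G'.Adj x y →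
      (Finset.univ.filter (fun i => RepProof.push f (F i) x y ≠ 0)).card ≤ 2) :
    IsMac G' (fun i => RepProof.push f (F i)) := by
  have hs : ∀ i, SuppOn G' (RepProof.push f (F i)) := fun i => push_supp h1 (h.cyc i).1
  refine ⟨fun i => ⟨hs i, fun v => ?_⟩, fun x y => ?_, ?_, fun c hc => ?_⟩
  · rw [bd_push]
    refine Finset.sum_eq_zero fun a _ => ?_
    rw [(h.cyc i).2, ite_self]
  · by_cases hxy : G'.Adj x y
    · exact htwo x y hxy
    · have : (Finset.univ.filter (fun i => RepProof.push f (F i) x y ≠ 0)) = ∅ := by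
        ext i; simp [(hs i).2 x y hxy]
      rw [this]; simp
  · rw [← push_sum, h.sum, push_zero]
  · obtain ⟨c0, hc0, rfl⟩ := push_lift hE hcon hc
    obtain ⟨D, rfl⟩ := h.gen c0 hc0
    exact ⟨D, push_sum f D F⟩

end Mac
end RepProof

namespace RepProof
open scoped Classical

section Mac2

def imgG {V V' : Type} (f : V → V') (G : SimpleGraph V) : SimpleGraph V' where
  Adj a b := a ≠ b ∧ ∃ a' b', G.Adj a' b' ∧ f a' = a ∧ f b' = b
  symm := by
    constructor
    rintro a b ⟨h, a', b', h1, h2, h3⟩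
    exact ⟨h.symm, b', a', h1.symm, h3, h2⟩
  loopless := by
    constructor
    rintro a ⟨h, -⟩
    exact h rfl

def idf {V : Type} (x z : V) (v : V) : V := if v = z then x else v

def cyc4 {V : Type} (x y z u : V) : Chn V := E x y + E y z + E z u + E u x

lemma idf_eq_iff {V : Type} {x z q b : V} (hqx : q ≠ x) (hqz : q ≠ z) : idf x z b = q ↔ b = q := by
  unfold idf
  split_ifs with h
  · constructor
    · intro h'; exact absurd h'.symm hqx
    · rintro rfl; exact absurd h hqz
  · rfl

lemma idf_eq_x {V : Type} {x z b : V} : idf x z b = x ↔ b = x ∨ b = z := by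
  unfold idf
  split_ifs with h
  · simp [h]
  · simp [h]

lemma push_idf_x {V : Type} [Fintype V] {x z q : V} (c : Chn V) (hxz : x ≠ z) (hqx : q ≠ x)
    (hqz : q ≠ z) : push (idf x z) c x q = c x q + c z q := by
  unfold push
  have : ∀ a, (∑ b, if idf x z a = x ∧ idf x z b = q then c a b else 0) =
      (if a = x then c a q else 0) + (if a = z then c a q else 0) := by
    intro a
    simp only [idf_eq_iff hqx hqz, idf_eq_x]
    by_cases h1 : a = x
    · subst h1; simp [hxz]
    · by_cases h2 : a = z <;> simp [h1, h2, hxz.symm]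
  simp only [this, Finset.sum_add_distrib, Finset.sum_ite_eq', Finset.mem_univ, if_true]

lemma push_idf_ne {V : Type} [Fintype V] {x z p q : V} (c : Chn V) (hpx : p ≠ x) (hpz : p ≠ z)
    (hqx : q ≠ x) (hqz : q ≠ z) : push (idf x z) c p q = c p q := by
  unfold push
  simp only [idf_eq_iff hqx hqz, idf_eq_iff hpx hpz]
  have : ∀ a, (∑ b, if a = p ∧ b = q then c a b else 0) = (if a = p then c a q else 0) := by
    intro a
    by_cases h1 : a = p <;> simp [h1]
  simp only [this, Finset.sum_ite_eq', Finset.mem_univ, if_true]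

lemma IsMac.ident {V ι : Type} [Fintype V] [Fintype ι] {G : SimpleGraph V} {F : ι → Chn V}
    (h : IsMac G F) {i0 : ι} {x y z u : V} (hF : F i0 = cyc4 x y z u) (hxz : x ≠ z) (hyu : y ≠ u)
    (hxy : G.Adj x y) (hyz : G.Adj y z) (hzu : G.Adj z u) (hux : G.Adj u x) (hnxz : ¬ G.Adj x z) :
    ∃ F' : ι → Chn V, IsMac (imgG (idf x z) G) F' := by
  let H : SimpleGraph V :=
    { Adj := fun a b => G.Adj a b ∧ ¬ (a = z ∧ G.Adj x b ∧ b ≠ y ∧ b ≠ u) ∧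
        ¬ (b = z ∧ G.Adj x a ∧ a ≠ y ∧ a ≠ u)
      symm := by constructor; rintro a b ⟨h1, h2, h3⟩; exact ⟨h1.symm, h3, h2⟩
      loopless := by constructor; rintro a ⟨h1, -⟩; exact G.loopless.irrefl a h1 }
  have hHG : H ≤ G := fun a b hab => hab.1
  have Hxy : H.Adj x y := ⟨hxy, fun h => hxz h.1, fun h => hyz.ne h.1⟩
  have Hyz : H.Adj y z := ⟨hyz, fun h => hyz.ne h.1, fun h => h.2.2.1 rfl⟩
  have Hzu : H.Adj z u := ⟨hzu, fun h => h.2.2.2 rfl, fun h => hzu.ne h.1.symm⟩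
  have Hux : H.Adj u x := ⟨hux, fun h => hzu.ne h.1.symm, fun h => hxz h.1⟩
  obtain ⟨F1, hF1, hk⟩ := h.sub hHG
  have hF10 : F1 i0 = cyc4 x y z u := by
    rw [hk i0, hF]
    rw [hF]
    exact (((E_supp Hxy).add (E_supp Hyz)).add (E_supp Hzu)).add (E_supp Hux)
  have hfz : idf x z z = x := by simp [idf]
  have hfne : ∀ v, v ≠ z → idf x z v = v := fun v hv => by simp [idf, hv]
  refine ⟨_, hF1.push (f := idf x z) (G' := imgG (idf x z) G) ?_ ?_ ?_ ?_⟩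
  · intro a b hab
    by_cases he : idf x z a = idf x z b
    · exact Or.inl he
    · exact Or.inr ⟨he, a, b, hab.1, rfl, rfl⟩
  · rintro p q ⟨hpq, a, b, hab, rfl, rfl⟩
    by_cases h1 : a = z ∧ G.Adj x b ∧ b ≠ y ∧ b ≠ u
    · obtain ⟨rfl, hxb, -, -⟩ := h1
      refine ⟨x, b, ⟨hxb, fun h => hxz h.1, fun h => hab.ne h.1.symm⟩, ?_, rfl⟩
      rw [hfz, hfne x hxz]
    · by_cases h2 : b = z ∧ G.Adj x a ∧ a ≠ y ∧ a ≠ u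
      · obtain ⟨rfl, hxa, -, -⟩ := h2
        refine ⟨a, x, ⟨hxa.symm, fun h => hab.ne h.1, fun h => hxz h.1⟩, rfl, ?_⟩
        rw [hfz, hfne x hxz]
      · exact ⟨a, b, ⟨hab, h1, h2⟩, rfl, rfl⟩
  · intro a b hab
    have hpath : SuppOn H (E x y + E y z) ∧ (∀ v, bd (E x y + E y z) v = dl x v + dl z v) ∧
        RepProof.push (idf x z) (E x y + E y z) = 0 := by
      refine ⟨(E_supp Hxy).add (E_supp Hyz), fun v => ?_, ?_⟩
      · rw [bd_add, bd_E hxy.ne, bd_E hyz.ne]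
        have := zmod2_add_self (dl y v)
        linear_combination this
      · have hfy := hfne y hyz.ne
        rw [push_add, push_E _ _ _ (by rw [hfne x hxz, hfy]; exact hxy.ne),
          push_E _ _ _ (by rw [hfz, hfy]; exact hxy.ne.symm), hfne x hxz, hfy, hfz, E_comm y x,
          chn_add_self]
    by_cases he : a = b
    · subst he
      exact ⟨0, SuppOn.zero _, fun v => by simp [bd, zmod2_add_self], push_zero _⟩
    · by_cases ha : a = z
      · subst ha
        rw [hfz, eq_comm, idf_eq_x] at hab
        have hb : b = x := hab.resolve_right (fun h => he h.symm)
        subst hb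
        exact ⟨_, hpath.1, fun v => by rw [hpath.2.1, add_comm], hpath.2.2⟩
      · rw [hfne a ha] at hab
        by_cases hb : b = z
        · subst hb
          rw [hfz] at hab
          subst hab
          exact ⟨_, hpath⟩
        · rw [hfne b hb] at hab
          exact absurd hab he
  · have key : ∀ q, q ≠ x → q ≠ z →
        (Finset.univ.filter (fun i => F1 i x q + F1 i z q ≠ 0)).card ≤ 2 := by
      intro q hqx hqz
      by_cases hyu' : q = y ∨ q = u
      · have hone : F1 i0 x q ≠ 0 ∧ F1 i0 z q ≠ 0 := by
          rw [hF10]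
          have := hxy.ne
          have := hyz.ne
          have := hzu.ne
          have := hux.ne
          rcases hyu' with rfl | rfl
          · constructor <;> simp [cyc4, E] <;> grind
          · constructor <;> simp [cyc4, E] <;> grind
        obtain ⟨j, -, -, hj, -⟩ := hF1.pair hone.1
        obtain ⟨k, -, -, hk, -⟩ := hF1.pair hone.2
        refine le_trans (Finset.card_le_card (t := {j, k}) ?_) Finset.card_le_two
        intro i hi
        simp only [Finset.mem_filter, Finset.mem_univ, true_and] at hi
        have hi0 : i ≠ i0 := by
          rintro rfl
          apply hi
          rw [(zmod2_cases _).resolve_left hone.1, (zmod2_cases _).resolve_left hone.2]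
          decide
        simp only [Finset.mem_insert, Finset.mem_singleton]
        by_cases h1 : F1 i x q = 0
        · rw [h1, zero_add] at hi
          exact Or.inr ((hk i hi).resolve_left hi0)
        · exact Or.inl ((hj i h1).resolve_left hi0)
      · push Not at hyu'
        by_cases hq : G.Adj x q
        · have : ∀ i, F1 i z q = 0 := fun i =>
            (hF1.cyc i).1.2 z q (fun hh => hh.2.1 ⟨rfl, hq, hyu'.1, hyu'.2⟩)
          simp only [this, add_zero]
          exact hF1.two x q
        · have : ∀ i, F1 i x q = 0 := fun i => (hF1.cyc i).1.2 x q (fun hh => hq hh.1)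
          simp only [this, zero_add]
          exact hF1.two z q
    rintro p q ⟨hpq, a, b, hab, ha, hb⟩
    have hnz : ∀ v, idf x z v ≠ z := by
      intro v hv
      unfold idf at hv
      split_ifs at hv with h
      · exact hxz hv
      · exact h hv
    have hpz : p ≠ z := ha ▸ hnz a
    have hqz : q ≠ z := hb ▸ hnz b
    by_cases hp : p = x
    · subst hp
      simp only [push_idf_x _ hxz hpq.symm hqz]
      exact key q hpq.symm hqz
    · by_cases hq : q = x
      · subst hq
        have : ∀ i, RepProof.push (idf q z) (F1 i) p q = F1 i q p + F1 i z p := by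
          intro i
          rw [push_symm _ _ (hF1.cyc i).1.1, push_idf_x _ hxz hp hpz]
        simp only [this]
        exact key p hp hpz
      · simp only [push_idf_ne _ hp hpz hq hqz]
        exact hF1.two p q

/-! ### walks and the crossing lemma -/

def wch {V : Type} {G : SimpleGraph V} : {a b : V} → G.Walk a b → Chn V
  | _, _, .nil => 0
  | a, _, .cons (v := v) _ p => E a v + wch p

lemma wch_supp {V : Type} {G : SimpleGraph V} {a b : V} (w : G.Walk a b) : SuppOn G (wch w) := by
  induction w with
  | nil => exact SuppOn.zero G
  | cons h p ih => exact (E_supp h).add ih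

lemma wch_bd {V : Type} [Fintype V] {G : SimpleGraph V} {a b : V} (w : G.Walk a b) (v : V) :
    bd (wch w) v = dl a v + dl b v := by
  induction w with
  | nil => simp [wch, bd, zmod2_add_self]
  | @cons a c b h p ih =>
    rw [wch, bd_add, ih, bd_E h.ne]
    have := zmod2_add_self (dl c v)
    linear_combination this

lemma wch_mem {V : Type} {G : SimpleGraph V} {a b : V} (w : G.Walk a b) {p q : V}
    (hp : p ∉ w.support) : wch w p q = 0 := by
  induction w with
  | nil => rfl
  | @cons a c b h w ih =>
    simp only [SimpleGraph.Walk.support_cons, List.mem_cons, not_or] at hp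
    rw [wch, Pi.add_apply, Pi.add_apply, ih hp.2, add_zero]
    unfold E
    rw [if_neg]
    rintro (⟨h1, -⟩ | ⟨h1, -⟩)
    · exact hp.1 h1
    · apply hp.2; rw [h1]; exact w.start_mem_support

lemma wch_mem' {V : Type} {G : SimpleGraph V} {a b : V} (w : G.Walk a b) {p q : V}
    (hq : q ∉ w.support) : wch w p q = 0 := by
  rw [(wch_supp w).1]; exact wch_mem w hq

lemma IsMac.gen' {V ι : Type} [Fintype V] [Fintype ι] {G : SimpleGraph V} {F : ι → Chn V}
    (h : IsMac G F) (i0 : ι) (c : Chn V) (hc : IsCyc G c) :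
    ∃ D : Finset ι, i0 ∉ D ∧ c = ∑ i ∈ D, F i := by
  obtain ⟨D, hD⟩ := h.gen c hc
  by_cases h0 : i0 ∈ D
  · refine ⟨Dᶜ, by simp [h0], ?_⟩
    have h1 : ∑ i ∈ D, F i + ∑ i ∈ Dᶜ, F i = 0 := by rw [Finset.sum_add_sum_compl, h.sum]
    rw [← hD] at h1
    calc c = c + (c + ∑ i ∈ Dᶜ, F i) := by rw [h1, add_zero]
      _ = _ := by rw [← add_assoc, chn_add_self, zero_add]
  · exact ⟨D, h0, hD⟩

lemma IsMac.cross {V ι : Type} [Fintype V] [Fintype ι] {G : SimpleGraph V} {F : ι → Chn V}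
    (h : IsMac G F) {i0 : ι} {x y z u : V} (hF : F i0 = cyc4 x y z u)
    (hxz : x ≠ z) (hyu : y ≠ u)
    (hxy : G.Adj x y) (hyz : G.Adj y z) (hzu : G.Adj z u) (hux : G.Adj u x)
    (P : G.Walk x z) (R : G.Walk y u) (hPR : ∀ v ∈ P.support, v ∉ R.support) : False := by
  set Y : Finset V := R.support.toFinset with hY
  have hxP : x ∈ P.support := P.start_mem_support
  have hzP : z ∈ P.support := P.end_mem_support
  have hyR : y ∈ R.support := R.start_mem_support
  have huR : u ∈ R.support := R.end_mem_support
  have hxR := hPR x hxP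
  have hzR := hPR z hzP
  have hyP : y ∉ P.support := fun h => hPR y h hyR
  have huP : u ∉ P.support := fun h => hPR u h huR
  obtain ⟨D1, hD1, hc1⟩ := h.gen' i0 (wch P + (E x y + E y z))
    ⟨(wch_supp P).add ((E_supp hxy).add (E_supp hyz)), fun v => by
      rw [bd_add, bd_add, wch_bd, bd_E hxy.ne, bd_E hyz.ne]
      have h1 := zmod2_add_self (dl x v)
      have h2 := zmod2_add_self (dl y v)
      have h3 := zmod2_add_self (dl z v)
      linear_combination h1 + h2 + h3⟩
  obtain ⟨D2, hD2, hc2⟩ := h.gen' i0 (wch R + (E y z + E z u))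
    ⟨(wch_supp R).add ((E_supp hyz).add (E_supp hzu)), fun v => by
      rw [bd_add, bd_add, wch_bd, bd_E hyz.ne, bd_E hzu.ne]
      have h1 := zmod2_add_self (dl u v)
      have h2 := zmod2_add_self (dl y v)
      have h3 := zmod2_add_self (dl z v)
      linear_combination h1 + h2 + h3⟩
  set k : Chn V := ∑ i ∈ D1 ∩ D2, F i with hk
  have hks : SuppOn G k := SuppOn.sum _ _ fun i _ => (h.cyc i).1
  have hkb : ∀ v, bd k v = 0 := fun v => by
    rw [hk, bd_sum]; exact Finset.sum_eq_zero fun i _ => (h.cyc i).2 v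
  have hsum : ∑ a ∈ Y, ∑ b ∈ Yᶜ, k a b = 0 := by
    have h1 : ∑ a ∈ Y, bd k a = 0 := Finset.sum_eq_zero fun a _ => hkb a
    have h2 := sum_symm_zero k hks.1 hks.diag Y
    have h3 : ∑ a ∈ Y, bd k a = ∑ a ∈ Y, ∑ b ∈ Y, k a b + ∑ a ∈ Y, ∑ b ∈ Yᶜ, k a b := by
      rw [← Finset.sum_add_distrib]
      refine Finset.sum_congr rfl fun a _ => ?_
      rw [Finset.sum_add_sum_compl]; rfl
    rw [h1, h2, zero_add] at h3
    exact h3.symm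
  -- coefficients
  have hval : ∀ a ∈ Y, ∀ b ∈ Yᶜ, k a b = if a = y then (if b = z then 1 else 0) else 0 := by
    intro a ha b hb
    have haR : a ∈ R.support := by simpa [hY] using ha
    have hbR : b ∉ R.support := by simpa [hY] using hb
    have haP : a ∉ P.support := fun h => hPR a h haR
    have v1 : (wch P + (E x y + E y z)) a b = E x y a b + E y z a b := by
      simp [wch_mem P haP]
    have v2 : (wch R + (E y z + E z u)) a b = E y z a b + E z u a b := by
      simp [wch_mem' R hbR]
    rw [hc1] at v1
    rw [hc2] at v2
    have hax : a ≠ x := by rintro rfl; exact hxR haR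
    have haz : a ≠ z := by rintro rfl; exact hzR haR
    have hby : b ≠ y := by rintro rfl; exact hbR hyR
    have hbu : b ≠ u := by rintro rfl; exact hbR huR
    have e1 : E x y a b = if (a = y ∧ b = x) then 1 else 0 := by simp [E, hax]
    have e2 : E y z a b = if (a = y ∧ b = z) then 1 else 0 := by simp [E, haz]
    have e3 : E z u a b = if (a = u ∧ b = z) then 1 else 0 := by simp [E, haz]
    have e4 : E u x a b = if (a = u ∧ b = x) then 1 else 0 := by simp [E, hax]
    rw [e1, e2] at v1
    rw [e2, e3] at v2
    by_cases h0 : F i0 a b ≠ 0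
    · obtain ⟨q, -, -, -, hq⟩ := h.pair h0
      rw [hk, hq]
      rw [hq] at v1 v2
      simp only [hD1, hD2, if_false, zero_add, Finset.mem_inter, false_and] at v1 v2 ⊢
      by_cases q1 : a = y
      · subst q1
        by_cases q2 : b = z
        · subst q2
          simp only [hxz.symm, hyu, and_true, and_false, true_and, false_and, if_true, if_false, zero_add, add_zero] at v1 v2 ⊢
          split_ifs at v1 v2 with w1 w2
          · simp [w1, w2]
          · exact absurd v2 (by decide)
          · exact absurd v1 (by decide)
          · exact absurd v1 (by decide)
        · simp only [hyu, q2, and_true, and_false, true_and, false_and, if_true, if_false, zero_add, add_zero] at v1 v2 ⊢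
          split_ifs at v2 with w2
          · exact absurd v2 (by decide)
          · simp [w2]
      · simp only [q1, and_true, and_false, true_and, false_and, if_true, if_false, zero_add, add_zero] at v1 v2 ⊢
        split_ifs at v1 with w1
        · exact absurd v1 (by decide)
        · simp [w1]
    · push Not at h0
      rw [hF] at h0
      simp only [cyc4, Pi.add_apply, e1, e2, e3, e4] at h0
      have n1 : ¬ (a = y ∧ b = x) := by
        rintro ⟨rfl, rfl⟩; simp [hxz, hyu] at h0
      have n2 : ¬ (a = y ∧ b = z) := by
        rintro ⟨rfl, rfl⟩; simp [hxz.symm, hyu] at h0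
      have n3 : ¬ (a = u ∧ b = z) := by
        rintro ⟨rfl, rfl⟩; simp [hxz.symm, hyu.symm] at h0
      rw [if_neg n1, if_neg n2, add_zero] at v1
      rw [if_neg n2, if_neg n3, add_zero] at v2
      have hgoal : (if a = y then (if b = z then (1 : ZMod 2) else 0) else 0) = 0 := by
        rw [← ite_and, if_neg n2]
      rw [hgoal]
      by_cases hz : ∃ i, F i a b ≠ 0
      · obtain ⟨i, hi⟩ := hz
        obtain ⟨q, -, -, -, hq⟩ := h.pair hi
        rw [hk, hq]
        rw [hq] at v1 v2
        simp only [Finset.mem_inter]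
        by_cases w1 : i ∈ D1 <;> by_cases w2 : q ∈ D1 <;> by_cases w3 : i ∈ D2 <;>
          by_cases w4 : q ∈ D2 <;> simp [w1, w2, w3, w4] at v1 v2 ⊢ <;> decide
      · push Not at hz
        rw [hk, Finset.sum_apply, Finset.sum_apply]
        exact Finset.sum_eq_zero fun i _ => hz i
  rw [Finset.sum_congr rfl (fun a ha => Finset.sum_congr rfl (hval a ha))] at hsum
  have hyY : y ∈ Y := by simpa [hY] using hyR
  have hzY : z ∈ Yᶜ := by simpa [hY] using hzR
  have e : ∀ a, (∑ b ∈ Yᶜ, if a = y then (if b = z then (1 : ZMod 2) else 0) else 0) =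
      if a = y then 1 else 0 := by
    intro a
    split_ifs
    · rw [Finset.sum_ite_eq', if_pos hzY]
    · simp
  simp only [e] at hsum
  rw [Finset.sum_ite_eq', if_pos hyY] at hsum
  exact one_ne_zero hsum

end Mac2
end RepProof

namespace RepProof
open scoped Classical

section Mac3

/-- chain of an edge function -/
def ech {V : Type} (G : SimpleGraph V) : (G.edgeSet → ZMod 2) →ₗ[ZMod 2] Chn V where
  toFun s := fun a b => if h : G.Adj a b then s ⟨s(a, b), h⟩ else 0
  map_add' s t := by
    funext a b; simp only [Pi.add_apply]; split_ifs <;> simp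
  map_smul' r s := by
    funext a b; simp only [Pi.smul_apply, RingHom.id_apply]; split_ifs <;> simp

lemma ech_inj {V : Type} (G : SimpleGraph V) : Function.Injective (ech G) := by
  intro s t h
  funext ⟨e, he⟩
  induction e using Sym2.ind with
  | _ a b =>
    have := congrFun (congrFun h a) b
    have he' : G.Adj a b := he
    simpa [ech, he'] using this

lemma ech_supp {V : Type} (G : SimpleGraph V) (s : G.edgeSet → ZMod 2) : SuppOn G (ech G s) := by
  refine ⟨fun a b => ?_, fun a b h => ?_⟩
  · simp only [ech, LinearMap.coe_mk, AddHom.coe_mk]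
    by_cases h : G.Adj a b
    · rw [dif_pos h, dif_pos h.symm]; congr 2; exact Sym2.eq_swap
    · rw [dif_neg h, dif_neg (fun h' => h h'.symm)]
  · simp [ech, h]

def bdL {V : Type} [Fintype V] : Chn V →ₗ[ZMod 2] (V → ZMod 2) where
  toFun c := bd c
  map_add' c d := by funext v; exact bd_add c d v
  map_smul' r c := by funext v; simp [bd, Finset.mul_sum]

lemma IsMac.euler {V ι : Type} [Fintype V] [Fintype ι] {G : SimpleGraph V} {F : ι → Chn V}
    (h : IsMac G F) (X : Finset V) (hX : ∀ a b, G.Adj a b → a ∈ X) (hne : X.Nonempty) :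
    (G.edgeFinset.card + 1 ≤ X.card ∧ ∀ i, F i = 0) ∨
    G.edgeFinset.card + 2 ≤ X.card + (Finset.univ.filter (fun i => F i ≠ 0)).card := by
  obtain ⟨x0, hx0⟩ := hne
  have hXc : (X.erase x0).card = X.card - 1 := Finset.card_erase_of_mem hx0
  have hXp : 0 < X.card := Finset.card_pos.mpr ⟨x0, hx0⟩
  set rest : (V → ZMod 2) →ₗ[ZMod 2] ({v // v ∈ X.erase x0} → ZMod 2) :=
    LinearMap.funLeft (ZMod 2) (ZMod 2) (fun v => (v : V)) with hrest
  set L : (G.edgeSet → ZMod 2) →ₗ[ZMod 2] ({v // v ∈ X.erase x0} → ZMod 2) :=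
    rest ∘ₗ bdL ∘ₗ ech G with hL
  have hrk := LinearMap.finrank_range_add_finrank_ker L
  have h1 : Module.finrank (ZMod 2) (LinearMap.range L) ≤ X.card - 1 := by
    refine (Submodule.finrank_le _).trans ?_
    rw [Module.finrank_fintype_fun_eq_card, Fintype.card_coe, hXc]
  have h2 : Module.finrank (ZMod 2) (G.edgeSet → ZMod 2) = G.edgeFinset.card := by
    rw [Module.finrank_fintype_fun_eq_card, SimpleGraph.edgeFinset, Set.toFinset_card]
  have hker : ∀ s ∈ LinearMap.ker L, IsCyc G (ech G s) := by
    intro s hs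
    refine ⟨ech_supp G s, ?_⟩
    have hs' : ∀ v ∈ X.erase x0, bd (ech G s) v = 0 := by
      intro v hv
      have := congrFun (LinearMap.mem_ker.mp hs) ⟨v, hv⟩
      exact this
    have hout : ∀ v, v ∉ X → bd (ech G s) v = 0 := by
      intro v hv
      refine Finset.sum_eq_zero fun w _ => (ech_supp G s).2 v w (fun hh => hv (hX v w hh))
    have htot : ∑ v, bd (ech G s) v = 0 :=
      sum_symm_zero _ (ech_supp G s).1 (ech_supp G s).diag Finset.univ
    have hother : ∀ v, v ≠ x0 → bd (ech G s) v = 0 := by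
      intro v hv
      by_cases hvX : v ∈ X
      · exact hs' v (Finset.mem_erase.mpr ⟨hv, hvX⟩)
      · exact hout v hvX
    intro v
    by_cases hv : v = x0
    · subst hv
      rw [Finset.sum_eq_single v (fun w _ hw => hother w hw) (by simp)] at htot
      exact htot
    · exact hother v hv
  by_cases hz : ∃ i, F i ≠ 0
  · right
    obtain ⟨i1, hi1⟩ := hz
    set I := (Finset.univ.filter (fun i => F i ≠ 0)) with hI
    have hi1I : i1 ∈ I := by simp [hI, hi1]
    have h3 : Module.finrank (ZMod 2) (LinearMap.ker L) ≤ I.card - 1 := by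
      have e : Module.finrank (ZMod 2) ((LinearMap.ker L).map (ech G)) =
          Module.finrank (ZMod 2) (LinearMap.ker L) :=
        (Submodule.equivMapOfInjective (ech G) (ech_inj G) _).finrank_eq.symm
      rw [← e]
      have hle : (LinearMap.ker L).map (ech G) ≤
          Submodule.span (ZMod 2) (((I.erase i1).image F : Finset (Chn V)) : Set (Chn V)) := by
        rintro c ⟨s, hs, rfl⟩
        obtain ⟨D, hD, hDs⟩ := h.gen' i1 _ (hker s hs)
        rw [hDs]
        refine Submodule.sum_mem _ fun i hi => ?_
        by_cases h0 : F i = 0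
        · rw [h0]; exact Submodule.zero_mem _
        · apply Submodule.subset_span
          rw [Finset.mem_coe, Finset.mem_image]
          refine ⟨i, ?_, rfl⟩
          rw [Finset.mem_erase]
          exact ⟨fun h => hD (h ▸ hi), by simp [hI, h0]⟩
      refine (Submodule.finrank_mono hle).trans ((finrank_span_finset_le_card _).trans ?_)
      rw [← Finset.card_erase_of_mem hi1I]
      exact Finset.card_image_le
    have : 0 < I.card := Finset.card_pos.mpr ⟨_, hi1I⟩
    omega
  · left
    push Not at hz
    refine ⟨?_, hz⟩
    have h3 : LinearMap.ker L = ⊥ := by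
      rw [eq_bot_iff]
      intro s hs
      obtain ⟨D, hD⟩ := h.gen _ (hker s hs)
      rw [Finset.sum_eq_zero (fun i _ => hz i)] at hD
      rw [Submodule.mem_bot]
      apply ech_inj G
      rw [hD, map_zero]
    rw [h3, finrank_bot] at hrk
    omega

/-- support graph of a chain -/
def sg {V : Type} (c : Chn V) : SimpleGraph V where
  Adj a b := a ≠ b ∧ c a b ≠ 0 ∧ c b a ≠ 0
  symm := by constructor; rintro a b ⟨h1, h2, h3⟩; exact ⟨h1.symm, h3, h2⟩
  loopless := by constructor; rintro a ⟨h1, -⟩; exact h1 rfl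

lemma sg_adj {V : Type} {G : SimpleGraph V} {c : Chn V} (hc : SuppOn G c) {a b : V} :
    (sg c).Adj a b ↔ c a b ≠ 0 := by
  constructor
  · exact fun h => h.2.1
  · intro h
    exact ⟨(hc.adj h).ne, h, by rwa [hc.1]⟩

lemma sg_le {V : Type} {G : SimpleGraph V} {c : Chn V} (hc : SuppOn G c) : sg c ≤ G :=
  fun _ _ hab => hc.adj hab.2.1

lemma IsMac.double_count {V ι : Type} [Fintype V] [Fintype ι] {G : SimpleGraph V} {F : ι → Chn V}
    (h : IsMac G F) : ∑ i, (sg (F i)).edgeFinset.card ≤ 2 * G.edgeFinset.card := by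
  have e : ∀ i, (sg (F i)).edgeFinset.card =
      ∑ e ∈ G.edgeFinset, if e ∈ (sg (F i)).edgeFinset then 1 else 0 := by
    intro i
    rw [Finset.sum_ite_mem, Finset.sum_const, smul_eq_mul, mul_one,
      Finset.inter_eq_right.mpr (SimpleGraph.edgeFinset_mono (sg_le (h.cyc i).1))]
  simp only [e]
  rw [Finset.sum_comm, mul_comm, ← smul_eq_mul, ← Finset.sum_const]
  refine Finset.sum_le_sum fun e _ => ?_
  induction e using Sym2.ind with
  | _ a b =>
    refine le_trans ?_ (h.two a b)
    rw [Finset.sum_boole, Nat.cast_id]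
    apply Finset.card_le_card
    intro i
    simp only [Finset.mem_filter, Finset.mem_univ, true_and, SimpleGraph.mem_edgeFinset,
      SimpleGraph.mem_edgeSet]
    exact fun h => h.2.1

lemma second_nbr {V : Type} [Fintype V] {G : SimpleGraph V} {c : Chn V} (hc : IsCyc G c) {a b : V}
    (hab : c a b ≠ 0) : ∃ a', a' ≠ b ∧ c a a' ≠ 0 := by
  by_contra hcon
  push Not at hcon
  have := hc.2 a
  unfold bd at this
  rw [Finset.sum_eq_single b (fun w _ hw => hcon w hw) (by simp)] at this
  exact hab this

/-- the elementary notion of triangle-freeness we use -/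
def NoTri {V : Type} (G : SimpleGraph V) : Prop :=
  ∀ a b c, G.Adj a b → G.Adj b c → ¬ G.Adj a c

lemma face_size {V : Type} [Fintype V] {G : SimpleGraph V} (ht : NoTri G) {c : Chn V}
    (hc : IsCyc G c) (h0 : c ≠ 0) :
    (4 ≤ (sg c).edgeFinset.card ∧ ∃ x y z u, x ≠ z ∧ y ≠ u ∧ G.Adj x y ∧ G.Adj y z ∧ G.Adj z u ∧
      G.Adj u x ∧ c = cyc4 x y z u) ∨ 5 ≤ (sg c).edgeFinset.card := by
  have hex : ∃ a b, c a b ≠ 0 := by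
    by_contra hcon
    push Not at hcon
    exact h0 (by funext a b; exact hcon a b)
  have hmem : ∀ a b, c a b ≠ 0 → s(a, b) ∈ (sg c).edgeFinset := by
    intro a b h
    rw [SimpleGraph.mem_edgeFinset, SimpleGraph.mem_edgeSet, sg_adj hc.1]; exact h
  have hsym : ∀ a b, c a b ≠ 0 → c b a ≠ 0 := fun a b h => by rwa [hc.1.1]
  obtain ⟨a, b, hab⟩ := hex
  obtain ⟨a', hapb, haa'⟩ := second_nbr hc hab
  obtain ⟨b', hbpa, hbb'⟩ := second_nbr hc (hsym _ _ hab)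
  obtain ⟨a'', happa, hapa''⟩ := second_nbr hc (hsym _ _ haa')
  obtain ⟨b'', hbppb, hbpb''⟩ := second_nbr hc (hsym _ _ hbb')
  have gab := hc.1.adj hab
  have gaa' := hc.1.adj haa'
  have gbb' := hc.1.adj hbb'
  have gapa'' := hc.1.adj hapa''
  have gbpb'' := hc.1.adj hbpb''
  have n1 : a' ≠ b' := by
    rintro rfl; exact ht a b a' gab gbb' gaa'
  have n2 : a'' ≠ b := by
    rintro rfl; exact ht a a' a'' gaa' gapa'' gab
  have n3 : b'' ≠ a := by
    rintro rfl; exact ht b b' b'' gbb' gbpb'' gab.symm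
  have five : ∀ e1 e2 e3 e4 e5 : Sym2 V, e1 ∈ (sg c).edgeFinset → e2 ∈ (sg c).edgeFinset →
      e3 ∈ (sg c).edgeFinset → e4 ∈ (sg c).edgeFinset → e5 ∈ (sg c).edgeFinset →
      [e1, e2, e3, e4, e5].Nodup → 5 ≤ (sg c).edgeFinset.card := by
    intro e1 e2 e3 e4 e5 h1 h2 h3 h4 h5 hnd
    have : [e1, e2, e3, e4, e5].toFinset ⊆ (sg c).edgeFinset := by
      intro e he
      simp only [List.mem_toFinset, List.mem_cons, List.not_mem_nil, or_false] at he
      rcases he with rfl | rfl | rfl | rfl | rfl <;> assumption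
    have h6 := Finset.card_le_card this
    rw [List.toFinset_card_of_nodup hnd] at h6
    simpa using h6
  have m1 := gab.ne
  have m2 := gaa'.ne
  have m3 := gbb'.ne
  have m4 := gapa''.ne
  have m5 := gbpb''.ne
  by_cases hq : a'' = b'
  · subst hq
    -- 4-cycle a' a b a''
    by_cases hall : ∀ p q, c p q ≠ 0 → s(p, q) = s(a', a) ∨ s(p, q) = s(a, b) ∨
        s(p, q) = s(b, a'') ∨ s(p, q) = s(a'', a')
    · left
      refine ⟨?_, a', a, b, a'', hapb, hbpa.symm, gaa'.symm, gab, gbb', gapa''.symm, ?_⟩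
      · have : [s(a', a), s(a, b), s(b, a''), s(a'', a')].toFinset ⊆ (sg c).edgeFinset := by
          intro e he
          simp only [List.mem_toFinset, List.mem_cons, List.not_mem_nil, or_false] at he
          rcases he with rfl | rfl | rfl | rfl <;> apply hmem
          · exact hsym _ _ haa'
          · exact hab
          · exact hbb'
          · exact hsym _ _ hapa''
        have h6 := Finset.card_le_card this
        rw [List.toFinset_card_of_nodup (by simp [Sym2.eq_iff]; grind)] at h6
        simpa using h6
      · funext p q
        by_cases hpq : c p q = 0
        · rw [hpq]
          have o1 : E a' a p q = 0 := by
            unfold E; rw [if_neg]; rintro (⟨rfl, rfl⟩ | ⟨rfl, rfl⟩)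
            · exact hsym _ _ haa' hpq
            · exact haa' hpq
          have o2 : E a b p q = 0 := by
            unfold E; rw [if_neg]; rintro (⟨rfl, rfl⟩ | ⟨rfl, rfl⟩)
            · exact hab hpq
            · exact hsym _ _ hab hpq
          have o3 : E b a'' p q = 0 := by
            unfold E; rw [if_neg]; rintro (⟨rfl, rfl⟩ | ⟨rfl, rfl⟩)
            · exact hbb' hpq
            · exact hsym _ _ hbb' hpq
          have o4 : E a'' a' p q = 0 := by
            unfold E; rw [if_neg]; rintro (⟨rfl, rfl⟩ | ⟨rfl, rfl⟩)
            · exact hsym _ _ hapa'' hpq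
            · exact hapa'' hpq
          simp [cyc4, o1, o2, o3, o4]
        · rw [(zmod2_cases _).resolve_left hpq]
          have := hall p q hpq
          simp only [Sym2.eq_iff] at this
          simp only [cyc4, Pi.add_apply, E]
          grind
    · right
      push Not at hall
      obtain ⟨p, q, hpq, k1, k2, k3, k4⟩ := hall
      refine five s(a', a) s(a, b) s(b, a'') s(a'', a') s(p, q) (hmem _ _ (hsym _ _ haa'))
        (hmem _ _ hab) (hmem _ _ hbb') (hmem _ _ (hsym _ _ hapa'')) (hmem _ _ hpq) ?_
      have k5 : [s(a', a), s(a, b), s(b, a''), s(a'', a')].Nodup := by simp [Sym2.eq_iff]; grind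
      simp only [List.nodup_cons, List.mem_cons, not_or, List.not_mem_nil, not_false_iff,
        and_true, List.nodup_nil] at k5 ⊢
      grind
  · right
    refine five s(a, b) s(a, a') s(b, b') s(a', a'') s(b', b'') (hmem _ _ hab) (hmem _ _ haa')
      (hmem _ _ hbb') (hmem _ _ hapa'') (hmem _ _ hbpb'') ?_
    simp [Sym2.eq_iff]
    grind

end Mac3
end RepProof

namespace RepProof
open scoped Classical

section Mac4

def GoodCol {V : Type} (G : SimpleGraph V) (v1 v2 : V) : Prop :=
  ∃ φ : V → Fin 3, (∀ a b, G.Adj a b → φ a ≠ φ b) ∧ φ v1 = φ v2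

lemma cyc4_flip {V : Type} (x y z u : V) : cyc4 x y z u = cyc4 z y x u := by
  unfold cyc4; rw [E_comm x y, E_comm y z, E_comm z u, E_comm u x]; abel

lemma cyc4_rot {V : Type} (x y z u : V) : cyc4 x y z u = cyc4 y z u x := by
  unfold cyc4; abel

lemma cyc4_flip' {V : Type} (x y z u : V) : cyc4 x y z u = cyc4 x u z y := by
  unfold cyc4; rw [E_comm x y, E_comm y z, E_comm z u, E_comm u x]; abel

/-- smaller triangle-free plane graphs are fine -/
def MinHyp (ι : Type) [Fintype ι] {V : Type} [Fintype V] (G : SimpleGraph V) (v1 v2 : V) : Prop :=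
  ∀ (G' : SimpleGraph V) (F' : ι → Chn V), IsMac G' F' → NoTri G' → ¬ G'.Adj v1 v2 →
    G'.edgeFinset.card < G.edgeFinset.card → GoodCol G' v1 v2

lemma ident_fail0 {V ι : Type} [Fintype V] [Fintype ι] {G : SimpleGraph V} {F : ι → Chn V}
    (h : IsMac G F) (ht : NoTri G) {v1 v2 : V} (hna : ¬ G.Adj v1 v2)
    (hbad : ¬ GoodCol G v1 v2) (hmin : MinHyp ι G v1 v2)
    {i : ι} {x y z u : V} (hF : F i = cyc4 x y z u) (hxz : x ≠ z) (hyu : y ≠ u)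
    (hxy : G.Adj x y) (hyz : G.Adj y z) (hzu : G.Adj z u) (hux : G.Adj u x)
    (hz1 : z ≠ v1) (hz2 : z ≠ v2) :
    (∃ a b, G.Adj x a ∧ G.Adj a b ∧ G.Adj b z) ∨ (x = v1 ∧ G.Adj z v2) ∨ (x = v2 ∧ G.Adj z v1) := by
  by_contra hcon
  push Not at hcon
  obtain ⟨hp, hs1, hs2⟩ := hcon
  have hnxz : ¬ G.Adj x z := ht x y z hxy hyz
  obtain ⟨F', hF'⟩ := h.ident hF hxz hyu hxy hyz hzu hux hnxz
  have hsy : ∀ a b, G.Adj a b → G.Adj b a := fun a b h => h.symm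
  have hir : ∀ a, ¬ G.Adj a a := fun a => G.irrefl
  have hfib : ∀ a b, idf x z a = idf x z b → a = b ∨ (a = x ∧ b = z) ∨ (a = z ∧ b = x) := by
    intro a b hab
    unfold idf at hab
    split_ifs at hab <;> grind
  have hT : NoTri (imgG (idf x z) G) := by
    rintro a b c ⟨hab, a1, b1, h1, rfl, rfl⟩ ⟨hbc, b2, c1, h2, e2, rfl⟩ ⟨hac, a2, c2, h3, e3, e4⟩
    have f1 := hfib _ _ e2
    have f2 := hfib _ _ e3
    have f3 := hfib _ _ e4
    have hfx : idf x z x = idf x z z := by simp [idf]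
    have t1 := ht a1 b1 c1
    grind [NoTri]
  have hN : ¬ (imgG (idf x z) G).Adj v1 v2 := by
    rintro ⟨-, a, b, hab, ha, hb⟩
    have hv1 : idf x z v1 = v1 := by simp [idf, hz1.symm]
    have hv2 : idf x z v2 = v2 := by simp [idf, hz2.symm]
    have f1 := hfib a v1 (by rw [ha, hv1])
    have f2 := hfib b v2 (by rw [hb, hv2])
    grind
  have hprop : ∀ a b, G.Adj a b → (imgG (idf x z) G).Adj (idf x z a) (idf x z b) := by
    intro a b hab
    refine ⟨fun he => ?_, a, b, hab, rfl, rfl⟩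
    have := hfib a b he
    grind
  have hcard : (imgG (idf x z) G).edgeFinset.card < G.edgeFinset.card := by
    have hmem : s(y, z) ∈ G.edgeFinset := by simpa using hyz
    have hsub : (imgG (idf x z) G).edgeFinset ⊆
        (G.edgeFinset.erase s(y, z)).image (Sym2.map (idf x z)) := by
      intro e
      induction e using Sym2.ind with
      | _ a b =>
        rw [SimpleGraph.mem_edgeFinset, SimpleGraph.mem_edgeSet]
        rintro ⟨hab, a1, b1, h1, rfl, rfl⟩
        rw [Finset.mem_image]
        by_cases he : s(a1, b1) = s(y, z)
        · refine ⟨s(y, x), ?_, ?_⟩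
          · rw [Finset.mem_erase]
            refine ⟨?_, by simpa using hxy.symm⟩
            simp [Sym2.eq_iff]; grind
          · have hfx : idf x z x = idf x z z := by simp [idf]
            have : Sym2.map (idf x z) s(y, x) = Sym2.map (idf x z) s(a1, b1) := by
              rw [he]; simp [Sym2.map_mk, hfx]
            rw [this]; rfl
        · refine ⟨s(a1, b1), ?_, rfl⟩
          rw [Finset.mem_erase]; exact ⟨he, by simpa using h1⟩
    refine lt_of_le_of_lt ((Finset.card_le_card hsub).trans Finset.card_image_le) ?_
    exact Finset.card_erase_lt_of_mem hmem
  obtain ⟨φ, h1, h2⟩ := hmin _ F' hF' hT hN hcard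
  refine hbad ⟨φ ∘ idf x z, fun a b hab => h1 _ _ (hprop a b hab), ?_⟩
  simp [idf, hz1.symm, hz2.symm, h2]

lemma ident_fail {V ι : Type} [Fintype V] [Fintype ι] {G : SimpleGraph V} {F : ι → Chn V}
    (h : IsMac G F) (ht : NoTri G) {v1 v2 : V} (hna : ¬ G.Adj v1 v2)
    (hnc : ∀ w, G.Adj v1 w → ¬ G.Adj v2 w)
    (hbad : ¬ GoodCol G v1 v2) (hmin : MinHyp ι G v1 v2)
    {i : ι} {x y z u : V} (hF : F i = cyc4 x y z u) (hxz : x ≠ z) (hyu : y ≠ u)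
    (hxy : G.Adj x y) (hyz : G.Adj y z) (hzu : G.Adj z u) (hux : G.Adj u x) :
    (∃ a b, G.Adj x a ∧ G.Adj a b ∧ G.Adj b z) ∨ (x = v1 ∧ G.Adj z v2) ∨ (x = v2 ∧ G.Adj z v1) ∨
      (z = v1 ∧ G.Adj x v2) ∨ (z = v2 ∧ G.Adj x v1) := by
  by_cases hz : z ≠ v1 ∧ z ≠ v2
  · have := ident_fail0 h ht hna hbad hmin hF hxz hyu hxy hyz hzu hux hz.1 hz.2
    rcases this with h1 | h1 | h1
    · exact Or.inl h1
    · exact Or.inr (Or.inl h1)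
    · exact Or.inr (Or.inr (Or.inl h1))
  · have hx : x ≠ v1 ∧ x ≠ v2 := by
      have := hxy.symm; have := hyz.symm
      grind
    rw [cyc4_flip] at hF
    have := ident_fail0 h ht hna hbad hmin hF hxz.symm hyu hyz.symm hxy.symm hux.symm hzu.symm
      hx.1 hx.2
    rcases this with ⟨a, b, h1, h2, h3⟩ | h4 | h4
    · exact Or.inl ⟨b, a, h3.symm, h2.symm, h1.symm⟩
    · exact Or.inr (Or.inr (Or.inr (Or.inl h4)))
    · exact Or.inr (Or.inr (Or.inr (Or.inr h4)))

lemma both_paths {V ι : Type} [Fintype V] [Fintype ι] {G : SimpleGraph V} {F : ι → Chn V}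
    (h : IsMac G F) (ht : NoTri G)
    {i : ι} {x y z u : V} (hF : F i = cyc4 x y z u) (hxz : x ≠ z) (hyu : y ≠ u)
    (hxy : G.Adj x y) (hyz : G.Adj y z) (hzu : G.Adj z u) (hux : G.Adj u x)
    {a b c d : V} (h1 : G.Adj x a) (h2 : G.Adj a b) (h3 : G.Adj b z)
    (h4 : G.Adj y c) (h5 : G.Adj c d) (h6 : G.Adj d u) : False := by
  have hsy : ∀ a b, G.Adj a b → G.Adj b a := fun a b h => h.symm
  have hir : ∀ a, ¬ G.Adj a a := fun a => G.irrefl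
  refine h.cross hF hxz hyu hxy hyz hzu hux (.cons h1 (.cons h2 (.cons h3 .nil)))
    (.cons h4 (.cons h5 (.cons h6 .nil))) ?_
  simp only [SimpleGraph.Walk.support_cons, SimpleGraph.Walk.support_nil, List.mem_cons,
    List.not_mem_nil, or_false, forall_eq_or_imp, forall_eq]
  unfold NoTri at ht
  refine ⟨?_, ?_, ?_, ?_⟩ <;> (push Not; refine ⟨?_, ?_, ?_, ?_⟩ <;> rintro rfl <;> grind)

structure T1 {V : Type} (G : SimpleGraph V) (Fi : Chn V) (v1 v2 y z u c d : V) : Prop where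
  hF : Fi = cyc4 v1 y z u
  hz : v1 ≠ z
  hyu : y ≠ u
  a1 : G.Adj v1 y
  a2 : G.Adj y z
  a3 : G.Adj z u
  a4 : G.Adj u v1
  a5 : G.Adj z v2
  a6 : G.Adj y c
  a7 : G.Adj c d
  a8 : G.Adj d u

lemma T1.refl {V : Type} {G : SimpleGraph V} {Fi : Chn V} {v1 v2 y z u c d : V}
    (h : T1 G Fi v1 v2 y z u c d) : T1 G Fi v1 v2 u z y d c :=
  ⟨by rw [h.hF, cyc4_flip'], h.hz, h.hyu.symm, h.a4.symm, h.a3.symm, h.a2.symm, h.a1.symm, h.a5,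
    h.a8.symm, h.a7.symm, h.a6.symm⟩

lemma face_T1 {V ι : Type} [Fintype V] [Fintype ι] {G : SimpleGraph V} {F : ι → Chn V}
    (h : IsMac G F) (ht : NoTri G) {v1 v2 : V} (hna : ¬ G.Adj v1 v2)
    (hnc : ∀ w, G.Adj v1 w → ¬ G.Adj v2 w)
    (hbad : ¬ GoodCol G v1 v2) (hmin : MinHyp ι G v1 v2)
    {i : ι} {x y z u : V} (hF : F i = cyc4 x y z u) (hxz : x ≠ z) (hyu : y ≠ u)
    (hxy : G.Adj x y) (hyz : G.Adj y z) (hzu : G.Adj z u) (hux : G.Adj u x) :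
    (∃ y z u c d, T1 G (F i) v1 v2 y z u c d) ∨ (∃ y z u c d, T1 G (F i) v2 v1 y z u c d) := by
  have hsy : ∀ a b, G.Adj a b → G.Adj b a := fun a b h => h.symm
  have hir : ∀ a, ¬ G.Adj a a := fun a => G.irrefl
  have key : ∀ x y z u, F i = cyc4 x y z u → x ≠ z → y ≠ u → G.Adj x y → G.Adj y z → G.Adj z u →
      G.Adj u x → ((x = v1 ∧ G.Adj z v2) ∨ (x = v2 ∧ G.Adj z v1) ∨
      (z = v1 ∧ G.Adj x v2) ∨ (z = v2 ∧ G.Adj x v1)) →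
      (∃ y z u c d, T1 G (F i) v1 v2 y z u c d) ∨ (∃ y z u c d, T1 G (F i) v2 v1 y z u c d) := by
    intro x y z u hF hxz hyu hxy hyz hzu hux hsp
    have hrot := hF
    rw [cyc4_rot] at hrot
    have := ident_fail h ht hna hnc hbad hmin hrot hyu hxz.symm hyz hzu hux hxy
    have hpath : ∃ a b, G.Adj y a ∧ G.Adj a b ∧ G.Adj b u := by
      rcases this with h1 | h1
      · exact h1
      · exfalso; grind
    obtain ⟨c, d, k1, k2, k3⟩ := hpath
    rcases hsp with ⟨rfl, h1⟩ | ⟨rfl, h1⟩ | ⟨rfl, h1⟩ | ⟨rfl, h1⟩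
    · left; exact ⟨y, z, u, c, d, hF, hxz, hyu, hxy, hyz, hzu, hux, h1, k1, k2, k3⟩
    · right; exact ⟨y, z, u, c, d, hF, hxz, hyu, hxy, hyz, hzu, hux, h1, k1, k2, k3⟩
    · left
      refine ⟨y, x, u, c, d, ?_, hxz.symm, hyu, hyz.symm, hxy.symm, hux.symm, hzu.symm, h1, k1, k2, k3⟩
      rw [hF, cyc4_flip]
    · right
      refine ⟨y, x, u, c, d, ?_, hxz.symm, hyu, hyz.symm, hxy.symm, hux.symm, hzu.symm, h1, k1, k2, k3⟩
      rw [hF, cyc4_flip]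
  rcases ident_fail h ht hna hnc hbad hmin hF hxz hyu hxy hyz hzu hux with ⟨a, b, h1, h2, h3⟩ | h1
  · have hrot := hF
    rw [cyc4_rot] at hrot
    rcases ident_fail h ht hna hnc hbad hmin hrot hyu hxz.symm hyz hzu hux hxy with
      ⟨c, d, h4, h5, h6⟩ | h4
    · exact (both_paths h ht hF hxz hyu hxy hyz hzu hux h1 h2 h3 h4 h5 h6).elim
    · exact key _ _ _ _ hrot hyu hxz.symm hyz hzu hux hxy h4
  · exact key _ _ _ _ hF hxz hyu hxy hyz hzu hux h1

lemma T1_caseI {V ι : Type} [Fintype V] [Fintype ι] {G : SimpleGraph V} {F : ι → Chn V}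
    (h : IsMac G F) (ht : NoTri G) {v1 v2 : V} (hna : ¬ G.Adj v1 v2)
    {i j : ι} {y z u d y' z' u' d' : V}
    (hi : T1 G (F i) v1 v2 y z u z' d) (hj : T1 G (F j) v1 v2 y' z' u' z d') : False := by
  have hsy : ∀ a b, G.Adj a b → G.Adj b a := fun a b h => h.symm
  have hir : ∀ a, ¬ G.Adj a a := fun a => G.irrefl
  obtain ⟨hF, hz, hyu, a1, a2, a3, a4, a5, a6, a7, a8⟩ := hi
  obtain ⟨hF', hz', hyu', a1', a2', a3', a4', a5', a6', a7', a8'⟩ := hj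
  unfold NoTri at ht
  by_cases hy : y' = y
  · refine h.cross hF hz hyu a1 a2 a3 a4 (.cons a4'.symm (.cons a8'.symm (.cons a7'.symm .nil)))
      (.cons a6 (.cons a7 (.cons a8 .nil))) ?_
    simp only [SimpleGraph.Walk.support_cons, SimpleGraph.Walk.support_nil, List.mem_cons,
      List.not_mem_nil, or_false, forall_eq_or_imp, forall_eq]
    refine ⟨?_, ?_, ?_, ?_⟩ <;> (push Not; refine ⟨?_, ?_, ?_, ?_⟩ <;> intro he <;> grind)
  · refine h.cross hF hz hyu a1 a2 a3 a4 (.cons a1' (.cons a6' .nil))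
      (.cons a6 (.cons a7 (.cons a8 .nil))) ?_
    simp only [SimpleGraph.Walk.support_cons, SimpleGraph.Walk.support_nil, List.mem_cons,
      List.not_mem_nil, or_false, forall_eq_or_imp, forall_eq]
    refine ⟨?_, ?_, ?_⟩ <;> (push Not; refine ⟨?_, ?_, ?_, ?_⟩ <;> intro he <;> grind)

lemma T1_caseII {V ι : Type} [Fintype V] [Fintype ι] {G : SimpleGraph V} {F : ι → Chn V}
    (h : IsMac G F) (ht : NoTri G) {v1 v2 : V} (hna : ¬ G.Adj v1 v2)
    (hnc : ∀ w, G.Adj v1 w → ¬ G.Adj v2 w)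
    {i j : ι} (hij : i ≠ j) {y z u c d z' c' d' : V}
    (hi : T1 G (F i) v1 v2 y z u c d) (hj : T1 G (F j) v1 v2 y z' u c' d') : False := by
  have hsy : ∀ a b, G.Adj a b → G.Adj b a := fun a b h => h.symm
  have hir : ∀ a, ¬ G.Adj a a := fun a => G.irrefl
  obtain ⟨hF, hz, hyu, a1, a2, a3, a4, a5, a6, a7, a8⟩ := hi
  obtain ⟨hF', hz', hyu', a1', a2', a3', a4', a5', a6', a7', a8'⟩ := hj
  unfold NoTri at ht
  have n1 : v1 ≠ c := by rintro rfl; grind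
  have n2 : v1 ≠ d := by rintro rfl; grind
  have n3 : z ≠ c := by rintro rfl; grind
  have n4 : z ≠ d := by rintro rfl; grind
  have n5 : z' ≠ c := by rintro rfl; grind
  have n6 : z' ≠ d := by rintro rfl; grind
  have n7 : v1 ≠ v2 := by rintro rfl; grind
  have hi1 : F i v1 y ≠ 0 := by
    rw [hF]; simp only [cyc4, Pi.add_apply, E]; have := a1.ne; have := a2.ne; have := a3.ne
    have := a4.ne; grind
  have hj1 : F j v1 y ≠ 0 := by
    rw [hF']; simp only [cyc4, Pi.add_apply, E]; have := a1.ne; have := a2'.ne; have := a3'.ne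
    have := a4.ne; grind
  by_cases hzz : z = z'
  · subst hzz
    have hi2 : F i y z ≠ 0 := by
      rw [hF]; simp only [cyc4, Pi.add_apply, E]; have := a1.ne; have := a2.ne; have := a3.ne
      have := a4.ne; grind
    have hj2 : F j y z ≠ 0 := by rw [hF', ← hF]; exact hi2
    have hC : IsCyc G (E v1 y + E y c + E c d + E d u + E u v1) := by
      refine ⟨((((E_supp a1).add (E_supp a6)).add (E_supp a7)).add (E_supp a8)).add (E_supp a4), ?_⟩
      intro v
      simp only [bd_add, bd_E a1.ne, bd_E a6.ne, bd_E a7.ne, bd_E a8.ne, bd_E a4.ne]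
      have k := zmod2_add_self
      have e1 := k (dl v1 v); have e2 := k (dl y v); have e3 := k (dl c v); have e4 := k (dl d v)
      have e5 := k (dl u v)
      linear_combination e1 + e2 + e3 + e4 + e5
    obtain ⟨D, hD⟩ := h.gen _ hC
    obtain ⟨j1, -, -, k1, p1⟩ := h.pair hi1
    obtain ⟨j2, -, -, k2, p2⟩ := h.pair hi2
    have q1 := (k1 j hj1).resolve_left hij.symm
    have q2 := (k2 j hj2).resolve_left hij.symm
    have r1 := p1 D
    have r2 := p2 D
    rw [← q1, ← hD] at r1
    rw [← q2, ← hD, ← r1] at r2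
    have := a1.ne; have := a2.ne; have := a3.ne; have := a4.ne; have := a6.ne; have := a7.ne
    have := a8.ne
    have w1 : (E v1 y + E y c + E c d + E d u + E u v1) v1 y = 1 := by
      simp only [Pi.add_apply, E]; grind
    have w2 : (E v1 y + E y c + E c d + E d u + E u v1) y z = 0 := by
      simp only [Pi.add_apply, E]; grind
    rw [w1, w2] at r2
    exact absurd r2 (by decide)
  · have hm := h.del hij hi1 hj1
    have hface : (fun k => F k + if k = i ∨ k = j then F j else 0) i = cyc4 y z u z' := by
      simp only [true_or, if_true]
      rw [hF, hF']
      unfold cyc4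
      have k1 := chn_add_self (E v1 y)
      have k2 := chn_add_self (E u v1)
      calc _ = (E v1 y + E v1 y) + (E u v1 + E u v1) + (E y z + E z u + E u z' + E z' y) := by
            rw [E_comm y z', E_comm z' u]; abel
        _ = _ := by rw [k1, k2]; simp
    have hdel : ∀ a b, G.Adj a b → a ≠ v1 → b ≠ v1 → (G.deleteEdges {s(v1, y)}).Adj a b := by
      intro a b hab h1 h2
      rw [SimpleGraph.deleteEdges_adj]
      refine ⟨hab, ?_⟩
      simp [Sym2.eq_iff]; grind
    have v1y := a1.ne.symm
    have v1u := a4.ne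
    refine hm.cross hface hyu hzz (hdel _ _ a2 v1y hz.symm) (hdel _ _ a3 hz.symm v1u)
      (hdel _ _ a3'.symm v1u hz'.symm) (hdel _ _ a2'.symm hz'.symm v1y)
      (.cons (hdel _ _ a6 v1y n1.symm) (.cons (hdel _ _ a7 n1.symm n2.symm)
        (.cons (hdel _ _ a8 n2.symm v1u) .nil)))
      (.cons (hdel _ _ a5 hz.symm n7.symm) (.cons (hdel _ _ a5'.symm n7.symm hz'.symm) .nil)) ?_
    simp only [SimpleGraph.Walk.support_cons, SimpleGraph.Walk.support_nil, List.mem_cons,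
      List.not_mem_nil, or_false, forall_eq_or_imp, forall_eq]
    refine ⟨?_, ?_, ?_, ?_⟩ <;> (push Not; refine ⟨?_, ?_, ?_⟩ <;> intro he <;> grind)

lemma T1_cross {V ι : Type} [Fintype V] [Fintype ι] {G : SimpleGraph V} {F : ι → Chn V}
    (h : IsMac G F) (ht : NoTri G) {v1 v2 : V} (hna : ¬ G.Adj v1 v2)
    (hnc : ∀ w, G.Adj v1 w → ¬ G.Adj v2 w)
    {i j : ι} {y z u c d y' z' u' c' d' : V}
    (hi : T1 G (F i) v1 v2 y z u c d) (hj : T1 G (F j) v1 v2 y' z' u' c' d') :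
    (y' = y ∨ y' = u) ∨ (z' = c ∨ z' = d) := by
  have hsy : ∀ a b, G.Adj a b → G.Adj b a := fun a b h => h.symm
  have hir : ∀ a, ¬ G.Adj a a := fun a => G.irrefl
  obtain ⟨hF, hz, hyu, a1, a2, a3, a4, a5, a6, a7, a8⟩ := hi
  obtain ⟨hF', hz', hyu', a1', a2', a3', a4', a5', a6', a7', a8'⟩ := hj
  unfold NoTri at ht
  by_contra hcon
  push Not at hcon
  refine h.cross hF hz hyu a1 a2 a3 a4 (.cons a1' (.cons a2' (.cons a5' (.cons a5.symm .nil))))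
      (.cons a6 (.cons a7 (.cons a8 .nil))) ?_
  simp only [SimpleGraph.Walk.support_cons, SimpleGraph.Walk.support_nil, List.mem_cons,
      List.not_mem_nil, or_false, forall_eq_or_imp, forall_eq]
  refine ⟨?_, ?_, ?_, ?_, ?_⟩ <;> (push Not; refine ⟨?_, ?_, ?_, ?_⟩ <;> intro he <;> grind)

lemma T1_unique {V ι : Type} [Fintype V] [Fintype ι] {G : SimpleGraph V} {F : ι → Chn V}
    (h : IsMac G F) (ht : NoTri G) {v1 v2 : V} (hna : ¬ G.Adj v1 v2)
    (hnc : ∀ w, G.Adj v1 w → ¬ G.Adj v2 w)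
    {i j : ι} (hi : ∃ y z u c d, T1 G (F i) v1 v2 y z u c d)
    (hj : ∃ y z u c d, T1 G (F j) v1 v2 y z u c d) : i = j := by
  by_contra hij
  obtain ⟨y, z, u, c, d, hi⟩ := hi
  obtain ⟨y', z', u', c', d', hj⟩ := hj
  have e1 := T1_cross h ht hna hnc hi hj
  have e2 := T1_cross h ht hna hnc hi hj.refl
  have e3 := T1_cross h ht hna hnc hj hi
  have e4 := T1_cross h ht hna hnc hj hi.refl
  have n1 := hi.hyu
  have n2 := hj.hyu
  have hA : (y' = y ∧ u' = u) ∨ (y' = u ∧ u' = y) ∨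
      ((z' = c ∨ z' = d) ∧ (z = c' ∨ z = d')) := by
    clear hi hj h ht hna hnc
    grind
  rcases hA with ⟨rfl, rfl⟩ | ⟨rfl, rfl⟩ | ⟨h1 | h1, h2 | h2⟩
  · exact T1_caseII h ht hna hnc hij hi hj
  · exact T1_caseII h ht hna hnc hij hi hj.refl
  · subst h1; subst h2; exact T1_caseI h ht hna hi hj
  · subst h1; subst h2; exact T1_caseI h ht hna hi hj.refl
  · subst h1; subst h2; exact T1_caseI h ht hna hi.refl hj
  · subst h1; subst h2; exact T1_caseI h ht hna hi.refl hj.refl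

end Mac4
end RepProof

namespace RepProof
open scoped Classical

section Mac5

lemma imgG_card {V : Type} [Fintype V] (f : V → V) (G : SimpleGraph V) :
    (imgG f G).edgeFinset.card ≤ G.edgeFinset.card := by
  refine (Finset.card_le_card (t := G.edgeFinset.image (Sym2.map f)) ?_).trans Finset.card_image_le
  intro e
  induction e using Sym2.ind with
  | _ a b =>
    rw [SimpleGraph.mem_edgeFinset, SimpleGraph.mem_edgeSet]
    rintro ⟨hab, a1, b1, h1, rfl, rfl⟩
    rw [Finset.mem_image]
    exact ⟨s(a1, b1), by simpa using h1, rfl⟩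

lemma adjCount_le {V : Type} [Fintype V] (G : SimpleGraph V) (S : Finset V) :
    adjCount G S S ≤ 2 * (G.edgeFinset.card : ℤ) := by
  have h1 : adjCount G S S ≤ ∑ a : V, (G.degree a : ℤ) := by
    unfold adjCount
    have h2 : ∀ a, (∑ b ∈ S, if G.Adj a b then (1 : ℤ) else 0) ≤ (G.degree a : ℤ) := by
      intro a
      rw [Finset.sum_boole]
      norm_cast
      rw [← SimpleGraph.card_neighborFinset_eq_degree]
      apply Finset.card_le_card
      intro b
      simp
    calc _ ≤ ∑ a ∈ S, (G.degree a : ℤ) := Finset.sum_le_sum fun a _ => h2 a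
      _ ≤ _ := Finset.sum_le_sum_of_subset_of_nonneg (Finset.subset_univ _) (by intros; positivity)
  have h3 := G.sum_degrees_eq_twice_card_edges
  have h4 : ∑ a : V, (G.degree a : ℤ) = 2 * (G.edgeFinset.card : ℤ) := by exact_mod_cast h3
  linarith

lemma card_sub_lt {V : Type} [Fintype V] {G H : SimpleGraph V} (hle : H ≤ G) {a b : V}
    (hab : G.Adj a b) (hn : ¬ H.Adj a b) : H.edgeFinset.card < G.edgeFinset.card := by
  apply Finset.card_lt_card
  rw [Finset.ssubset_iff_of_subset (SimpleGraph.edgeFinset_mono hle)]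
  exact ⟨s(a, b), by simpa using hab, by simpa using hn⟩

set_option maxHeartbeats 1000000 in
theorem thmP {V ι : Type} [Fintype V] [Fintype ι] {v1 v2 : V} (hne : v1 ≠ v2) :
    ∀ (n : ℕ) (G : SimpleGraph V) (F : ι → Chn V), G.edgeFinset.card = n → IsMac G F → NoTri G →
      ¬ G.Adj v1 v2 → GoodCol G v1 v2 := by
  intro n
  induction n using Nat.strong_induction_on with
  | _ n ih =>
  intro G F hn h ht hna
  by_contra hbad
  have hmin : MinHyp ι G v1 v2 := by
    intro G' F' h' ht' hna' hlt
    exact ih _ (hn ▸ hlt) G' F' rfl h' ht' hna'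
  have hdel : ∀ a b, G.Adj a b → GoodCol (G.deleteEdges {s(a, b)}) v1 v2 := by
    intro a b hab
    obtain ⟨F', hF', -⟩ := h.del_ex a b
    refine hmin _ F' hF' ?_ ?_ ?_
    · intro p q r h1 h2 h3
      rw [SimpleGraph.deleteEdges_adj] at h1 h2 h3
      exact ht p q r h1.1 h2.1 h3.1
    · intro h1
      rw [SimpleGraph.deleteEdges_adj] at h1
      exact hna h1.1
    · exact card_sub_lt (SimpleGraph.deleteEdges_le _) hab (by simp)
  have hnc : ∀ w, G.Adj v1 w → ¬ G.Adj v2 w := by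
    intro w h1 h2
    obtain ⟨φ, k1, k2⟩ := hdel v2 w h2
    refine hbad ⟨φ, fun a b hab => ?_, k2⟩
    have k3 : φ v1 ≠ φ w := k1 _ _ (by
      rw [SimpleGraph.deleteEdges_adj]
      refine ⟨h1, ?_⟩
      have := h1.ne
      simp [Sym2.eq_iff]; grind)
    by_cases he : s(a, b) = s(v2, w)
    · rw [Sym2.eq_iff] at he
      rcases he with ⟨rfl, rfl⟩ | ⟨rfl, rfl⟩
      · rw [← k2]; exact k3
      · rw [← k2]; exact k3.symm
    · exact k1 a b (by rw [SimpleGraph.deleteEdges_adj]; exact ⟨hab, by simpa using he⟩)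
  set Q := imgG (idf v1 v2) G with hQ
  have hfib : ∀ a b, idf v1 v2 a = idf v1 v2 b → a = b ∨ (a = v1 ∧ b = v2) ∨ (a = v2 ∧ b = v1) := by
    intro a b hab
    unfold idf at hab
    split_ifs at hab <;> grind
  have hQc : ¬ Col Q Finset.univ := by
    rintro ⟨φ, hφ⟩
    refine hbad ⟨φ ∘ idf v1 v2, fun a b hab => ?_, by simp [idf]⟩
    refine hφ _ (Finset.mem_univ _) _ (Finset.mem_univ _) ⟨fun he => ?_, a, b, hab, rfl, rfl⟩
    have := hfib a b he
    have := hab.ne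
    have := hab.symm
    grind
  obtain ⟨S, -, hS⟩ := exists_crit Q _ hQc
  have hin : ∀ a b, G.Adj a b → idf v1 v2 a ∈ S ∧ idf v1 v2 b ∈ S := by
    intro a b hab
    by_contra hcon
    obtain ⟨ψ, k1, k2⟩ := hdel a b hab
    apply hS.1
    refine ⟨ψ, ?_⟩
    rintro p hp q hq ⟨hpq, a', b', h1, rfl, rfl⟩
    have hψ : ∀ w, ψ (idf v1 v2 w) = ψ w := by
      intro w; unfold idf; split_ifs with hw
      · rw [hw, k2]
      · rfl
    rw [hψ, hψ]
    apply k1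
    rw [SimpleGraph.deleteEdges_adj]
    refine ⟨h1, ?_⟩
    simp only [Set.mem_singleton_iff, Sym2.eq_iff]
    rintro (⟨rfl, rfl⟩ | ⟨rfl, rfl⟩)
    · exact hcon ⟨hp, hq⟩
    · exact hcon ⟨hq, hp⟩
  have hKY := KY_main hS
  have h2S := hS.two_le
  have hadj := adjCount_le Q S
  have hQe := imgG_card (idf v1 v2) G
  rw [← hQ] at hQe
  unfold rho at hKY
  have hX : ∀ a b, G.Adj a b → a ∈ insert v2 S := by
    intro a b hab
    have := (hin a b hab).1
    unfold idf at this
    rw [Finset.mem_insert]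
    split_ifs at this with hw
    · exact Or.inl hw
    · exact Or.inr this
  have hXc := Finset.card_insert_le v2 S
  have hE := h.euler (insert v2 S) hX ⟨v2, Finset.mem_insert_self _ _⟩
  have hDC := h.double_count
  set I := Finset.univ.filter (fun i => F i ≠ 0) with hI
  set f4 := I.filter (fun i => (sg (F i)).edgeFinset.card < 5) with hf4
  have hT : ∀ i ∈ f4, (∃ y z u c d, T1 G (F i) v1 v2 y z u c d) ∨
      (∃ y z u c d, T1 G (F i) v2 v1 y z u c d) := by
    intro i hi
    simp only [hf4, hI, Finset.mem_filter, Finset.mem_univ, true_and] at hi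
    rcases face_size ht (h.cyc i) hi.1 with ⟨-, x, y, z, u, hxz, hyu, g1, g2, g3, g4, hF⟩ | h5
    · exact face_T1 h ht hna hnc hbad hmin hF hxz hyu g1 g2 g3 g4
    · omega
  have h42 : f4.card ≤ 2 := by
    have hsub : f4 = f4.filter (fun i => ∃ y z u c d, T1 G (F i) v1 v2 y z u c d) ∪
        f4.filter (fun i => ∃ y z u c d, T1 G (F i) v2 v1 y z u c d) := by
      ext i
      rw [Finset.mem_union]
      constructor
      · intro hi
        rcases hT i hi with k | k
        · exact Or.inl (Finset.mem_filter.mpr ⟨hi, k⟩)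
        · exact Or.inr (Finset.mem_filter.mpr ⟨hi, k⟩)
      · rintro (hi | hi) <;> exact (Finset.mem_filter.mp hi).1
    rw [hsub]
    refine (Finset.card_union_le _ _).trans ?_
    have c1 : (f4.filter (fun i => ∃ y z u c d, T1 G (F i) v1 v2 y z u c d)).card ≤ 1 := by
      rw [Finset.card_le_one]
      intro i hi j hj
      exact T1_unique h ht hna hnc (Finset.mem_filter.mp hi).2 (Finset.mem_filter.mp hj).2
    have c2 : (f4.filter (fun i => ∃ y z u c d, T1 G (F i) v2 v1 y z u c d)).card ≤ 1 := by
      rw [Finset.card_le_one]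
      intro i hi j hj
      exact T1_unique h ht (fun k => hna k.symm) (fun w k1 k2 => hnc w k2 k1)
        (Finset.mem_filter.mp hi).2 (Finset.mem_filter.mp hj).2
    omega
  have hsum : 5 * I.card ≤ ∑ i, (sg (F i)).edgeFinset.card + f4.card := by
    have e1 : f4.card = ∑ i ∈ I, if (sg (F i)).edgeFinset.card < 5 then 1 else 0 := by
      rw [hf4, Finset.card_filter]
    calc 5 * I.card = ∑ i ∈ I, 5 := by rw [Finset.sum_const, smul_eq_mul, mul_comm]
      _ ≤ ∑ i ∈ I, ((sg (F i)).edgeFinset.card +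
            if (sg (F i)).edgeFinset.card < 5 then 1 else 0) := by
          refine Finset.sum_le_sum fun i hi => ?_
          simp only [hI, Finset.mem_filter, Finset.mem_univ, true_and] at hi
          rcases face_size ht (h.cyc i) hi with ⟨h4, -⟩ | h5
          · split_ifs <;> omega
          · omega
      _ = ∑ i ∈ I, (sg (F i)).edgeFinset.card + f4.card := by rw [Finset.sum_add_distrib, e1]
      _ ≤ _ := by
          gcongr
          exact Finset.subset_univ _
  rcases hE with ⟨hE, -⟩ | hE <;> omega

end Mac5
end RepProof

namespace RepProof
open scoped Classical

section Mac6

lemma IsMac.restrict {V V' ι : Type} [Fintype V] [Fintype V'] [Fintype ι] {G : SimpleGraph V}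
    {F : ι → Chn V} (h : IsMac G F) (e : V' → V) (he : Function.Injective e)
    (hr : ∀ a b, G.Adj a b → a ∈ Set.range e) :
    IsMac (G.comap e) (fun i a b => F i (e a) (e b)) := by
  refine ⟨fun i => ⟨⟨fun a b => (h.cyc i).1.1 _ _, fun a b hab => (h.cyc i).1.2 _ _ hab⟩, fun v => ?_⟩,
    fun a b => h.two _ _, ?_, ?_⟩
  · rw [← (h.cyc i).2 (e v)]
    unfold bd
    refine Fintype.sum_of_injective e he _ _ (fun w hw => ?_) (fun _ => rfl)
    by_contra h0
    exact hw (hr _ _ ((h.cyc i).1.adj h0).symm)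
  · funext a b
    have := congrFun (congrFun h.sum (e a)) (e b)
    simpa [Finset.sum_apply] using this
  · intro c hc
    have hpe : ∀ a b, RepProof.push e c (e a) (e b) = c a b := by
      intro a b
      unfold RepProof.push
      rw [Finset.sum_eq_single a, Finset.sum_eq_single b]
      · simp
      · intro b' _ hb'; rw [if_neg]; rintro ⟨-, hb⟩; exact hb' (he hb)
      · simp
      · intro a' _ ha'; refine Finset.sum_eq_zero fun b' _ => ?_
        rw [if_neg]; rintro ⟨ha, -⟩; exact ha' (he ha)
      · simp
    have hcyc : IsCyc G (RepProof.push e c) := by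
      refine ⟨push_supp (f := e) (G := G.comap e) (G' := G) (fun a b hab => Or.inr hab) hc.1, fun x => ?_⟩
      rw [bd_push]
      refine Finset.sum_eq_zero fun a _ => ?_
      rw [hc.2 a]; simp
    obtain ⟨D, hD⟩ := h.gen _ hcyc
    refine ⟨D, ?_⟩
    funext a b
    rw [← hpe a b, hD]
    simp [Finset.sum_apply]

lemma push_E_eq {V V' : Type} [Fintype V] (f : V → V') {a b : V} (hab : a ≠ b) (h : f a = f b) :
    push f (E a b) = 0 := by
  have hs : SuppOn (⊤ : SimpleGraph V) (E a b) := E_supp (by simpa using hab)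
  funext x y
  by_cases hxy : x = y
  · subst hxy; exact push_diag f _ hs.1 hs.diag x
  · unfold push
    refine Finset.sum_eq_zero fun p _ => Finset.sum_eq_zero fun q _ => ?_
    split_ifs with h1
    · unfold E
      rw [if_neg]
      rintro (⟨rfl, rfl⟩ | ⟨rfl, rfl⟩)
      · exact hxy (by rw [← h1.1, ← h1.2, h])
      · exact hxy (by rw [← h1.1, ← h1.2, h])
    · rfl

/-- planar minors -/
lemma IsMac.minor {V W ι : Type} [Fintype V] [Fintype W] [Fintype ι] {G : SimpleGraph V}
    {F : ι → Chn V} (h : IsMac G F) (H : SimpleGraph W) (B : W → Set V)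
    (hdis : ∀ p q x, x ∈ B p → x ∈ B q → p = q)
    (hcon : ∀ w, ∀ x ∈ B w, ∀ y ∈ B w,
      Relation.ReflTransGen (fun a b => G.Adj a b ∧ a ∈ B w ∧ b ∈ B w) x y)
    (hadj : ∀ p q, H.Adj p q → ∃ x ∈ B p, ∃ y ∈ B q, G.Adj x y) :
    ∃ F' : ι → Chn W, IsMac H F' := by
  have hr : ∀ e : Sym2 W, ∃ r : Option (Sym2 V), e ∈ H.edgeSet → ∃ p q x y, e = s(p, q) ∧ x ∈ B p ∧ y ∈ B q ∧
      G.Adj x y ∧ r = some s(x, y) := by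
    intro e
    induction e using Sym2.ind with
    | _ p q =>
      by_cases hpq : H.Adj p q
      · obtain ⟨x, hx, y, hy, hxy⟩ := hadj p q hpq
        exact ⟨some s(x, y), fun _ => ⟨p, q, x, y, rfl, hx, hy, hxy, rfl⟩⟩
      · exact ⟨none, fun h => absurd h hpq⟩
  choose r hr using hr
  let G1 : SimpleGraph V :=
    { Adj := fun a b => G.Adj a b ∧ ((∃ w, a ∈ B w ∧ b ∈ B w) ∨ ∃ e ∈ H.edgeSet, r e = some s(a, b))
      symm := by
        constructor
        rintro a b ⟨h1, ⟨w, h2, h3⟩ | ⟨e, he, h2⟩⟩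
        · exact ⟨h1.symm, Or.inl ⟨w, h3, h2⟩⟩
        · exact ⟨h1.symm, Or.inr ⟨e, he, by rw [h2, Sym2.eq_swap]⟩⟩
      loopless := by constructor; rintro a ⟨h1, -⟩; exact G.loopless.irrefl a h1 }
  obtain ⟨F1, hF1, -⟩ := h.sub (H := G1) (fun a b hab => hab.1)
  let f : V → W ⊕ V := fun v => if hv : ∃ w, v ∈ B w then Sum.inl hv.choose else Sum.inr v
  have hf1 : ∀ v w, v ∈ B w → f v = Sum.inl w := by
    intro v w hv
    have hv' : ∃ w, v ∈ B w := ⟨w, hv⟩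
    simp only [f, dif_pos hv']
    rw [hdis _ _ _ hv'.choose_spec hv]
  have hf2 : ∀ v w, f v = Sum.inl w → v ∈ B w := by
    intro v w hv
    by_cases hv' : ∃ w, v ∈ B w
    · simp only [f, dif_pos hv', Sum.inl.injEq] at hv
      rw [← hv]; exact hv'.choose_spec
    · simp [f, dif_neg hv'] at hv
  have hf3 : ∀ v u, f v = Sum.inr u → v = u := by
    intro v u hv
    by_cases hv' : ∃ w, v ∈ B w
    · simp [f, dif_pos hv'] at hv
    · simpa [f, dif_neg hv'] using hv
  have hrep : ∀ e ∈ H.edgeSet, ∀ a b p q, r e = some s(a, b) → a ∈ B p → b ∈ B q → e = s(p, q) := by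
    intro e he a b p q hab ha hb
    obtain ⟨p', q', x, y, rfl, hx, hy, -, hxy⟩ := hr e he
    rw [hxy, Option.some_inj, Sym2.eq_iff] at hab
    rcases hab with ⟨rfl, rfl⟩ | ⟨rfl, rfl⟩
    · rw [hdis _ _ _ hx ha, hdis _ _ _ hy hb]
    · rw [hdis _ _ _ hx hb, hdis _ _ _ hy ha, Sym2.eq_swap]
  have hmac := hF1.push (f := f) (G' := imgG Sum.inl H) ?_ ?_ ?_ ?_
  · have := hmac.restrict Sum.inl Sum.inl_injective ?_
    · suffices hH : SimpleGraph.comap (Sum.inl : W → W ⊕ V) (imgG Sum.inl H) = H by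
        rw [hH] at this; exact ⟨_, this⟩
      ext p q
      simp only [SimpleGraph.comap_adj, imgG]
      constructor
      · rintro ⟨-, p', q', hpq, h1, h2⟩
        rw [← Sum.inl_injective h1, ← Sum.inl_injective h2]; exact hpq
      · intro hpq; exact ⟨fun he => hpq.ne (Sum.inl_injective he), p, q, hpq, rfl, rfl⟩
    · rintro a b ⟨-, p, q, -, rfl, -⟩
      exact ⟨p, rfl⟩
  · rintro a b ⟨hab, ⟨w, h1, h2⟩ | ⟨e, he, h1⟩⟩
    · left; rw [hf1 _ _ h1, hf1 _ _ h2]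
    · right
      obtain ⟨p, q, x, y, rfl, hx, hy, -, hxy⟩ := hr e he
      have hpq : H.Adj p q := he
      rw [h1, Option.some_inj, Sym2.eq_iff] at hxy
      rcases hxy with ⟨rfl, rfl⟩ | ⟨rfl, rfl⟩
      · rw [hf1 _ _ hx, hf1 _ _ hy]
        exact ⟨fun he => hpq.ne (Sum.inl_injective he), p, q, hpq, rfl, rfl⟩
      · rw [hf1 _ _ hx, hf1 _ _ hy]
        exact ⟨fun he => hpq.ne (Sum.inl_injective he).symm, q, p, hpq.symm, rfl, rfl⟩
  · rintro x y ⟨-, p, q, hpq, rfl, rfl⟩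
    obtain ⟨p', q', x, y, he, hx, hy, hxy, hre⟩ := hr s(p, q) hpq
    rw [Sym2.eq_iff] at he
    rcases he with ⟨rfl, rfl⟩ | ⟨rfl, rfl⟩
    · exact ⟨x, y, ⟨hxy, Or.inr ⟨_, hpq, hre⟩⟩, hf1 _ _ hx, hf1 _ _ hy⟩
    · exact ⟨y, x, ⟨hxy.symm, Or.inr ⟨_, hpq, by rw [hre, Sym2.eq_swap]⟩⟩, hf1 _ _ hy, hf1 _ _ hx⟩
  · intro a b hab
    by_cases hv : ∃ w, a ∈ B w
    · obtain ⟨w, ha⟩ := hv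
      have hb : b ∈ B w := hf2 _ _ (by rw [← hab, hf1 _ _ ha])
      have := hcon w a ha b hb
      clear hab hb
      induction this with
      | refl => exact ⟨0, SuppOn.zero _, fun v => by simp [bd, zmod2_add_self], push_zero _⟩
      | @tail b c h1 h2 ih =>
        obtain ⟨κ, k1, k2, k3⟩ := ih
        have hG1 : G1.Adj b c := ⟨h2.1, Or.inl ⟨w, h2.2.1, h2.2.2⟩⟩
        refine ⟨κ + E b c, k1.add (E_supp hG1), fun v => ?_, ?_⟩
        · rw [bd_add, k2, bd_E hG1.ne]
          have := zmod2_add_self (dl b v)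
          linear_combination this
        · rw [push_add, k3, push_E_eq f hG1.ne, add_zero]
          rw [hf1 _ _ h2.2.1, hf1 _ _ h2.2.2]
    · have hfa : f a = Sum.inr a := by simp [f, dif_neg hv]
      have : b = a := hf3 _ _ (by rw [← hab, hfa])
      subst this
      exact ⟨0, SuppOn.zero _, fun v => by simp [bd, zmod2_add_self], push_zero _⟩
  · rintro x y ⟨-, p, q, hpq, rfl, rfl⟩
    have huniq : ∃ a0 b0, ∀ c, SuppOn G1 c → RepProof.push f c (Sum.inl p) (Sum.inl q) ≠ 0 → c a0 b0 ≠ 0 := by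
      have key : ∃ a0 b0, ∀ a b, G1.Adj a b → f a = Sum.inl p → f b = Sum.inl q → a = a0 ∧ b = b0 := by
        obtain ⟨p', q', x, y, he, hx, hy, hxy, hre⟩ := hr s(p, q) hpq
        have hmain : ∀ a b, G1.Adj a b → f a = Sum.inl p → f b = Sum.inl q → s(a, b) = s(x, y) := by
          rintro a b ⟨-, ⟨w, h1, h2⟩ | ⟨e, he, h1⟩⟩ ha hb
          · exfalso
            have e1 := hdis _ _ _ h1 (hf2 _ _ ha)
            have e2 := hdis _ _ _ h2 (hf2 _ _ hb)
            exact hpq.ne (e1.symm.trans e2)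
          · have := hrep e he a b p q h1 (hf2 _ _ ha) (hf2 _ _ hb)
            subst this
            rw [← Option.some_inj, ← h1, hre]
        rw [Sym2.eq_iff] at he
        rcases he with ⟨rfl, rfl⟩ | ⟨rfl, rfl⟩
        · refine ⟨x, y, fun a b hab ha hb => ?_⟩
          have := hmain a b hab ha hb
          rw [Sym2.eq_iff] at this
          rcases this with k | ⟨rfl, rfl⟩
          · exact k
          · exact (hpq.ne (hdis _ _ _ (hf2 _ _ ha) hy)).elim
        · refine ⟨y, x, fun a b hab ha hb => ?_⟩
          have := hmain a b hab ha hb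
          rw [Sym2.eq_iff] at this
          rcases this with ⟨rfl, rfl⟩ | k
          · exact (hpq.ne (hdis _ _ _ (hf2 _ _ ha) hx)).elim
          · exact k
      obtain ⟨a0, b0, hk⟩ := key
      refine ⟨a0, b0, fun c hc hne h0 => hne ?_⟩
      unfold RepProof.push
      refine Finset.sum_eq_zero fun a _ => Finset.sum_eq_zero fun b _ => ?_
      split_ifs with h1
      · by_contra h2
        obtain ⟨rfl, rfl⟩ := hk a b (hc.adj h2) h1.1 h1.2
        exact h2 h0
      · rfl
    obtain ⟨a0, b0, hk⟩ := huniq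
    refine le_trans (Finset.card_le_card ?_) (hF1.two a0 b0)
    intro i
    simp only [Finset.mem_filter, Finset.mem_univ, true_and]
    exact hk _ (hF1.cyc i).1

/-- adding a pendant edge -/
lemma IsMac.pendant {V ι : Type} [Fintype V] [Fintype ι] {G G' : SimpleGraph V} {F : ι → Chn V}
    (h : IsMac G F) {p b : V} (hp : ∀ a, ¬ G.Adj p a)
    (hG' : ∀ x y, G'.Adj x y ↔ G.Adj x y ∨ (x = p ∧ y = b) ∨ (x = b ∧ y = p)) : IsMac G' F := by
  refine ⟨fun i => ⟨(h.cyc i).1.mono (fun x y hxy => (hG' x y).mpr (Or.inl hxy)), (h.cyc i).2⟩, h.two,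
    h.sum, fun c hc => h.gen c ⟨⟨hc.1.1, fun x y hxy => ?_⟩, hc.2⟩⟩
  have hpb : c p b = 0 := by
    have := hc.2 p
    unfold bd at this
    rw [Finset.sum_eq_single b] at this
    · exact this
    · intro w _ hw
      apply hc.1.2
      rw [hG']
      rintro (h1 | h1 | h1)
      · exact hp _ h1
      · exact hw h1.2
      · exact hw (h1.2.trans h1.1)
    · simp
  by_contra h0
  rcases (hG' x y).mp (hc.1.adj h0) with h1 | ⟨rfl, rfl⟩ | ⟨rfl, rfl⟩
  · exact hxy h1
  · exact h0 hpb
  · exact h0 (by rw [hc.1.1]; exact hpb)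

end Mac6
end RepProof

namespace RepProof
open scoped Classical

section Grid

abbrev gbox (N : ℤ) : Finset (ℤ × ℤ) := Finset.Icc (-N) N ×ˢ Finset.Icc (-N) N
abbrev sbox (N : ℤ) : Finset (ℤ × ℤ) := Finset.Ico (-N) N ×ˢ Finset.Ico (-N) N

def GAdj (a b : ℤ × ℤ) : Prop :=
  (a.1 = b.1 ∧ (a.2 + 1 = b.2 ∨ b.2 + 1 = a.2)) ∨ (a.2 = b.2 ∧ (a.1 + 1 = b.1 ∨ b.1 + 1 = a.1))

lemma GAdj.symm {a b : ℤ × ℤ} (h : GAdj a b) : GAdj b a := by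
  unfold GAdj at *; grind

def gridG (N : ℤ) : SimpleGraph (gbox N) where
  Adj a b := GAdj a.1 b.1
  symm := by constructor; intro a b h; exact h.symm
  loopless := by constructor; intro a h; unfold GAdj at h; omega

lemma mem_gbox {N : ℤ} {p : ℤ × ℤ} : p ∈ gbox N ↔ (-N ≤ p.1 ∧ p.1 ≤ N) ∧ (-N ≤ p.2 ∧ p.2 ≤ N) := by
  simp [gbox, Finset.mem_product]

lemma mem_sbox {N : ℤ} {p : ℤ × ℤ} : p ∈ sbox N ↔ (-N ≤ p.1 ∧ p.1 < N) ∧ (-N ≤ p.2 ∧ p.2 < N) := by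
  simp [sbox, Finset.mem_product]

def corner {N : ℤ} (s : sbox N) (i j : ℤ) (hi : i = 0 ∨ i = 1) (hj : j = 0 ∨ j = 1) : gbox N :=
  ⟨(s.1.1 + i, s.1.2 + j), by
    have := mem_sbox.mp s.2
    rw [mem_gbox]; simp only; omega⟩

def sq {N : ℤ} (s : sbox N) : Chn (gbox N) :=
  cyc4 (corner s 0 0 (by simp) (by simp)) (corner s 1 0 (by simp) (by simp))
    (corner s 1 1 (by simp) (by simp)) (corner s 0 1 (by simp) (by simp))

lemma sq_cyc {N : ℤ} (s : sbox N) : IsCyc (gridG N) (sq s) := by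
  have a1 : (gridG N).Adj (corner s 0 0 (by simp) (by simp)) (corner s 1 0 (by simp) (by simp)) := by
    simp [gridG, GAdj, corner]
  have a2 : (gridG N).Adj (corner s 1 0 (by simp) (by simp)) (corner s 1 1 (by simp) (by simp)) := by
    simp [gridG, GAdj, corner]
  have a3 : (gridG N).Adj (corner s 1 1 (by simp) (by simp)) (corner s 0 1 (by simp) (by simp)) := by
    simp [gridG, GAdj, corner]
  have a4 : (gridG N).Adj (corner s 0 1 (by simp) (by simp)) (corner s 0 0 (by simp) (by simp)) := by
    simp [gridG, GAdj, corner]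
  refine ⟨(((E_supp a1).add (E_supp a2)).add (E_supp a3)).add (E_supp a4), fun v => ?_⟩
  unfold sq cyc4
  simp only [bd_add, bd_E a1.ne, bd_E a2.ne, bd_E a3.ne, bd_E a4.ne]
  have k := zmod2_add_self
  linear_combination k (dl (corner s 0 0 (by simp) (by simp)) v) +
    k (dl (corner s 1 0 (by simp) (by simp)) v) + k (dl (corner s 1 1 (by simp) (by simp)) v) +
    k (dl (corner s 0 1 (by simp) (by simp)) v)

/-- value of a square on a vertical edge -/
lemma sq_v {N : ℤ} (s : sbox N) {a b : gbox N} (h1 : a.1.1 = b.1.1) (h2 : a.1.2 + 1 = b.1.2) :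
    sq s a b = (if s.1 = a.1 then 1 else 0) + (if s.1 = (a.1.1 - 1, a.1.2) then 1 else 0) := by
  obtain ⟨⟨s1, s2⟩, hs⟩ := s
  obtain ⟨⟨a1, a2⟩, ha⟩ := a
  obtain ⟨⟨b1, b2⟩, hb⟩ := b
  simp only at h1 h2
  subst h1; subst h2
  simp only [sq, cyc4, Pi.add_apply, E, corner, Subtype.mk.injEq, Prod.mk.injEq]
  have z0 : (1 : ZMod 2) ≠ 0 := by decide
  by_cases e1 : s1 = a1
  · by_cases e2 : s2 = a2
    · subst e1; subst e2; simp <;> omega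
    · have f1 : ¬ (a2 = s2) := fun h => e2 h.symm
      simp [e1, e2, f1]
      try omega
  · by_cases e1' : s1 = a1 - 1
    · by_cases e2 : s2 = a2
      · subst e1'; subst e2
        have q1 : ¬ a1 - 1 = a1 := by omega
        have q2 : ¬ a1 = a1 - 1 := by omega
        simp [q1, q2]
      · have f1 : ¬ (a2 = s2) := fun h => e2 h.symm
        subst e1'
        have q1 : ¬ (a1 - 1 = a1) := by omega
        have q2 : ¬ a1 = a1 - 1 := by omega
        have q3 : ¬ (a2 = s2 + 1 ∧ a2 + 1 = s2) := by omega
        have q4 : ¬ (a2 + 1 = s2 ∧ a2 = s2 + 1) := by omega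
        simp [e2, f1, q1, q2, q3, q4]
    · have g1 : ¬ a1 = s1 := fun h => e1 h.symm
      have g2 : ¬ a1 = s1 + 1 := by omega
      simp [e1, e1', g1, g2]

lemma sq_h {N : ℤ} (s : sbox N) {a b : gbox N} (h1 : a.1.2 = b.1.2) (h2 : a.1.1 + 1 = b.1.1) :
    sq s a b = (if s.1 = a.1 then 1 else 0) + (if s.1 = (a.1.1, a.1.2 - 1) then 1 else 0) := by
  obtain ⟨⟨s1, s2⟩, hs⟩ := s
  obtain ⟨⟨a1, a2⟩, ha⟩ := a
  obtain ⟨⟨b1, b2⟩, hb⟩ := b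
  simp only at h1 h2
  subst h1; subst h2
  simp only [sq, cyc4, Pi.add_apply, E, corner, Subtype.mk.injEq, Prod.mk.injEq]
  by_cases e1 : s2 = a2
  · by_cases e2 : s1 = a1
    · subst e1; subst e2; simp <;> omega
    · have f1 : ¬ (a1 = s1) := fun h => e2 h.symm
      simp [e1, e2, f1]
      try omega
  · by_cases e1' : s2 = a2 - 1
    · by_cases e2 : s1 = a1
      · subst e1'; subst e2
        have q1 : ¬ a2 - 1 = a2 := by omega
        have q2 : ¬ a2 = a2 - 1 := by omega
        simp [q1, q2]
      · have f1 : ¬ (a1 = s1) := fun h => e2 h.symm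
        subst e1'
        have q1 : ¬ (a2 - 1 = a2) := by omega
        have q2 : ¬ a2 = a2 - 1 := by omega
        have q3 : ¬ (a1 = s1 + 1 ∧ a1 + 1 = s1) := by omega
        have q4 : ¬ (a1 + 1 = s1 ∧ a1 = s1 + 1) := by omega
        simp [e2, f1, q1, q2, q3, q4]
    · have g1 : ¬ a2 = s2 := fun h => e1 h.symm
      have g2 : ¬ a2 = s2 + 1 := by omega
      simp [e1, e1', g1, g2]

def ce {N : ℤ} (c : Chn (gbox N)) (p q : ℤ × ℤ) : ZMod 2 :=
  if h : p ∈ gbox N ∧ q ∈ gbox N then c ⟨p, h.1⟩ ⟨q, h.2⟩ else 0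

lemma ce_symm {N : ℤ} {c : Chn (gbox N)} (hc : SuppOn (gridG N) c) (p q : ℤ × ℤ) :
    ce c p q = ce c q p := by
  unfold ce
  by_cases h : p ∈ gbox N ∧ q ∈ gbox N
  · rw [dif_pos h, dif_pos h.symm]; exact hc.1 _ _
  · rw [dif_neg h, dif_neg (fun h' => h h'.symm)]

lemma ce_bd {N : ℤ} {c : Chn (gbox N)} (hc : IsCyc (gridG N) c) (i j : ℤ) :
    ce c (i, j) (i + 1, j) + ce c (i - 1, j) (i, j) + ce c (i, j) (i, j + 1) + ce c (i, j - 1) (i, j) = 0 := by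
  by_cases ha : (i, j) ∈ gbox N
  · have h0 := hc.2 ⟨(i, j), ha⟩
    unfold bd at h0
    have h1 : ∑ w : gbox N, c ⟨(i, j), ha⟩ w = ∑ w ∈ gbox N, ce c (i, j) w := by
      rw [← Finset.sum_coe_sort (gbox N)]
      refine Finset.sum_congr rfl fun w _ => ?_
      unfold ce
      rw [dif_pos ⟨ha, w.2⟩]
    rw [h1] at h0
    have hz : ∀ w, w ∉ ({(i + 1, j), (i - 1, j), (i, j + 1), (i, j - 1)} : Finset (ℤ × ℤ)) →
        ce c (i, j) w = 0 := by
      intro w hw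
      unfold ce
      split_ifs with h
      · apply hc.1.2
        intro hadj
        apply hw
        obtain ⟨w1, w2⟩ := w
        simp only [gridG, GAdj] at hadj
        simp only [Finset.mem_insert, Finset.mem_singleton, Prod.mk.injEq]
        omega
      · rfl
    have h2 : ∑ w ∈ gbox N, ce c (i, j) w =
        ∑ w ∈ ({(i + 1, j), (i - 1, j), (i, j + 1), (i, j - 1)} : Finset (ℤ × ℤ)), ce c (i, j) w := by
      have e1 : ∑ w ∈ gbox N, ce c (i, j) w =
          ∑ w ∈ gbox N ∪ {(i + 1, j), (i - 1, j), (i, j + 1), (i, j - 1)}, ce c (i, j) w := by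
        refine Finset.sum_subset Finset.subset_union_left fun w _ hw => ?_
        unfold ce; rw [dif_neg]; exact fun h => hw h.2
      rw [e1]
      symm
      exact Finset.sum_subset Finset.subset_union_right fun w _ hw => hz w hw
    rw [h2, Finset.sum_insert (by simp; omega), Finset.sum_insert (by simp),
      Finset.sum_insert (by simp; omega), Finset.sum_singleton] at h0
    rw [ce_symm hc.1 (i - 1, j), ce_symm hc.1 (i, j - 1), ← h0]
    ring
  · simp [ce, ha]

def ww {N : ℤ} (c : Chn (gbox N)) (i j : ℤ) : ZMod 2 :=
  ∑ k ∈ Finset.Icc (-N) i, ce c (k, j) (k, j + 1)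

lemma ce_out {N : ℤ} (c : Chn (gbox N)) {p q : ℤ × ℤ} (h : p ∉ gbox N ∨ q ∉ gbox N) : ce c p q = 0 := by
  unfold ce; rw [dif_neg]; tauto

lemma ww_rec {N : ℤ} (c : Chn (gbox N)) (i j : ℤ) :
    ww c i j = ww c (i - 1) j + ce c (i, j) (i, j + 1) := by
  unfold ww
  by_cases hi : -N ≤ i
  · rw [← Finset.insert_Icc_sub_one_right_eq_Icc hi, Finset.sum_insert (by simp), add_comm]
  · rw [Finset.Icc_eq_empty (by omega), Finset.Icc_eq_empty (by omega), ce_out]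
    · simp
    · left; rw [mem_gbox]; simp; omega

lemma ww_h {N : ℤ} {c : Chn (gbox N)} (hc : IsCyc (gridG N) c) (i j : ℤ) :
    ce c (i, j) (i + 1, j) = ww c i j + ww c i (j - 1) := by
  by_cases hi : -N - 1 ≤ i
  · induction i, hi using Int.le_induction with
    | base =>
      rw [ce_out c (by left; rw [mem_gbox]; simp)]
      simp [ww]
    | succ i hi ih =>
      have hb := ce_bd hc (i + 1) j
      have r1 := ww_rec c (i + 1) j
      have r2 := ww_rec c (i + 1) (j - 1)
      simp only [add_sub_cancel_right, sub_add_cancel] at hb r1 r2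
      rw [r1, r2]
      have k := zmod2_add_self
      linear_combination hb - ih - k (ww c i j) - k (ww c i (j-1)) - k (ce c (i + 1, j) (i + 1, j + 1)) - k (ce c (i + 1, j - 1) (i + 1, j)) + k 0
  · rw [ce_out c (by left; rw [mem_gbox]; simp; omega)]
    simp [ww, Finset.Icc_eq_empty (show ¬ (-N ≤ i) by omega)]

lemma ww_out {N : ℤ} {c : Chn (gbox N)} (hc : IsCyc (gridG N) c) (i j : ℤ) (h : (i, j) ∉ sbox N) :
    ww c i j = 0 := by
  have hj : ∀ i j, (j < -N ∨ N ≤ j) → ww c i j = 0 := by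
    intro i j h
    refine Finset.sum_eq_zero fun k _ => ce_out c ?_
    rw [mem_gbox, mem_gbox]; simp; omega
  rw [mem_sbox] at h
  simp only at h
  by_cases h1 : j < -N ∨ N ≤ j
  · exact hj i j h1
  · by_cases h2 : i < -N
    · simp [ww, Finset.Icc_eq_empty (show ¬ (-N ≤ i) by omega)]
    · have h3 : N ≤ i := by omega
      have h4 : -N - 1 ≤ j := by omega
      clear h h1
      induction j, h4 using Int.le_induction with
      | base => exact hj _ _ (by omega)
      | succ j _ ih =>
        have := ww_h hc i (j + 1)
        rw [ce_out c (by right; rw [mem_gbox]; simp; omega)] at this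
        simp only [add_sub_cancel_right, ih, add_zero] at this
        exact this.symm

lemma opt_two {κ : Type} [Fintype κ] (g : κ → ZMod 2)
    (h : (Finset.univ.filter (fun i => g i ≠ 0)).card ≤ 2) :
    (Finset.univ.filter (fun i : Option κ => (i.elim (∑ k, g k) g) ≠ 0)).card ≤ 2 := by
  set A := Finset.univ.filter (fun i => g i ≠ 0) with hA
  have hs : ∑ k, g k = (A.card : ZMod 2) := by
    have : ∀ k, g k = if g k ≠ 0 then 1 else 0 := by
      intro k; rcases zmod2_cases (g k) with h | h <;> simp [h]
    rw [Finset.sum_congr rfl (fun k _ => this k), Finset.sum_boole]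
  by_cases h2 : A.card = 2
  · have h0 : ∑ k, g k = 0 := by rw [hs, h2]; decide
    have : (Finset.univ.filter (fun i : Option κ => (i.elim (∑ k, g k) g) ≠ 0)) ⊆ A.map .some := by
      intro i
      cases i with
      | none => simp [h0]
      | some k => simp [hA]
    exact (Finset.card_le_card this).trans (by rw [Finset.card_map]; exact h)
  · have : (Finset.univ.filter (fun i : Option κ => (i.elim (∑ k, g k) g) ≠ 0)) ⊆
        insert none (A.map .some) := by
      intro i
      cases i with
      | none => simp
      | some k => simp [hA]
    refine (Finset.card_le_card this).trans ((Finset.card_insert_le _ _).trans ?_)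
    rw [Finset.card_map]; omega

lemma grid_mac (N : ℤ) : ∃ F : Option (sbox N) → Chn (gbox N), IsMac (gridG N) F := by
  refine ⟨fun i => i.elim (∑ s, sq s) sq, ?_, ?_, ?_, ?_⟩
  · intro i
    cases i with
    | none =>
      refine ⟨SuppOn.sum _ _ fun s _ => (sq_cyc s).1, fun v => ?_⟩
      show bd (∑ s, sq s) v = 0
      rw [bd_sum]; exact Finset.sum_eq_zero fun s _ => (sq_cyc s).2 v
    | some s => exact sq_cyc s
  · intro a b
    have key : (Finset.univ.filter (fun s : sbox N => sq s a b ≠ 0)).card ≤ 2 := by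
      have hcard2 : ∀ p q : ℤ × ℤ, (∀ s : sbox N, sq s a b ≠ 0 → s.1 = p ∨ s.1 = q) →
          (Finset.univ.filter (fun s : sbox N => sq s a b ≠ 0)).card ≤ 2 := by
        intro p q hpq
        rw [← Finset.card_map ⟨Subtype.val, Subtype.val_injective⟩]
        refine (Finset.card_le_card (t := {p, q}) ?_).trans Finset.card_le_two
        intro x
        simp only [Finset.mem_map, Finset.mem_filter, Finset.mem_univ, true_and,
          Function.Embedding.coeFn_mk, Finset.mem_insert, Finset.mem_singleton]
        rintro ⟨s, hs, rfl⟩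
        exact hpq s hs
      by_cases hab : (gridG N).Adj a b
      · rcases hab with ⟨h1, h2 | h2⟩ | ⟨h1, h2 | h2⟩
        · refine hcard2 a.1 (a.1.1 - 1, a.1.2) fun s hs => ?_
          rw [sq_v s h1 h2] at hs
          by_contra hcon; push Not at hcon; simp [hcon] at hs
        · refine hcard2 b.1 (b.1.1 - 1, b.1.2) fun s hs => ?_
          rw [(sq_cyc s).1.1, sq_v s h1.symm h2] at hs
          by_contra hcon; push Not at hcon; simp [hcon] at hs
        · refine hcard2 a.1 (a.1.1, a.1.2 - 1) fun s hs => ?_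
          rw [sq_h s h1 h2] at hs
          by_contra hcon; push Not at hcon; simp [hcon] at hs
        · refine hcard2 b.1 (b.1.1, b.1.2 - 1) fun s hs => ?_
          rw [(sq_cyc s).1.1, sq_h s h1.symm h2] at hs
          by_contra hcon; push Not at hcon; simp [hcon] at hs
      · have : (Finset.univ.filter (fun s : sbox N => sq s a b ≠ 0)) = ∅ := by
          rw [Finset.filter_eq_empty_iff]
          intro s _; rw [(sq_cyc s).1.2 a b hab]; simp
        rw [this]; simp
    have := opt_two (fun s : sbox N => sq s a b) key
    convert this using 3 with i
    cases i with
    | none => simp [Finset.sum_apply]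
    | some s => simp
  · rw [Fintype.sum_option]; exact chn_add_self _
  · intro c hc
    refine ⟨(Finset.univ.filter (fun s : sbox N => ww c s.1.1 s.1.2 ≠ 0)).map .some, ?_⟩
    rw [Finset.sum_map]
    show c = ∑ s ∈ (Finset.univ.filter (fun s : sbox N => ww c s.1.1 s.1.2 ≠ 0)), sq s
    have hval : ∀ a b, (∑ s ∈ (Finset.univ.filter (fun s : sbox N => ww c s.1.1 s.1.2 ≠ 0)), sq s) a b =
        ∑ s : sbox N, ww c s.1.1 s.1.2 * sq s a b := by
      intro a b
      rw [Finset.sum_apply, Finset.sum_apply, Finset.sum_filter]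
      refine Finset.sum_congr rfl fun s _ => ?_
      rcases zmod2_cases (ww c s.1.1 s.1.2) with h | h <;> simp [h]
    have hind : ∀ p : ℤ × ℤ, ∑ s : sbox N, ww c s.1.1 s.1.2 * (if s.1 = p then 1 else 0) = ww c p.1 p.2 := by
      intro p
      by_cases hp : p ∈ sbox N
      · rw [Finset.sum_eq_single ⟨p, hp⟩]
        · simp
        · intro s _ hs
          rw [if_neg (fun h => hs (Subtype.ext h)), mul_zero]
        · simp
      · rw [ww_out hc _ _ hp]
        refine Finset.sum_eq_zero fun s _ => ?_
        rw [if_neg, mul_zero]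
        rintro rfl; exact hp s.2
    have hce : ∀ a b : gbox N, c a b = ce c a.1 b.1 := by
      intro a b; unfold ce; rw [dif_pos ⟨a.2, b.2⟩]
    have hv : ∀ a b : gbox N, a.1.1 = b.1.1 → a.1.2 + 1 = b.1.2 →
        c a b = ∑ s : sbox N, ww c s.1.1 s.1.2 * sq s a b := by
      intro a b h1 h2
      have hb : b.1 = (a.1.1, a.1.2 + 1) := Prod.ext h1.symm h2.symm
      rw [Finset.sum_congr rfl (fun s _ => by rw [sq_v s h1 h2, mul_add]), Finset.sum_add_distrib,
        hind, hind, hce, hb]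
      have := ww_rec c a.1.1 a.1.2
      simp only at this ⊢
      rw [this]
      have k := zmod2_add_self (ww c (a.1.1 - 1) a.1.2)
      linear_combination - k
    have hh : ∀ a b : gbox N, a.1.2 = b.1.2 → a.1.1 + 1 = b.1.1 →
        c a b = ∑ s : sbox N, ww c s.1.1 s.1.2 * sq s a b := by
      intro a b h1 h2
      have hb : b.1 = (a.1.1 + 1, a.1.2) := Prod.ext h2.symm h1.symm
      rw [Finset.sum_congr rfl (fun s _ => by rw [sq_h s h1 h2, mul_add]), Finset.sum_add_distrib,
        hind, hind, hce, hb]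
      exact ww_h hc a.1.1 a.1.2
    funext a b
    rw [hval]
    by_cases hab : (gridG N).Adj a b
    · rcases hab with ⟨h1, h2 | h2⟩ | ⟨h1, h2 | h2⟩
      · exact hv a b h1 h2
      · rw [hc.1.1, hv b a h1.symm h2]
        exact Finset.sum_congr rfl fun s _ => by rw [(sq_cyc s).1.1]
      · exact hh a b h1 h2
      · rw [hc.1.1, hh b a h1.symm h2]
        exact Finset.sum_congr rfl fun s _ => by rw [(sq_cyc s).1.1]
    · rw [hc.1.2 a b hab]
      symm
      exact Finset.sum_eq_zero fun s _ => by rw [(sq_cyc s).1.2 a b hab, mul_zero]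

end Grid
end RepProof

namespace RepProof
open scoped Classical

section PlaneG

/-- `x, y` connected inside the set `S` along the relation `r` -/
abbrev Reach {U : Type} (r : U → U → Prop) (S : Set U) (x y : U) : Prop :=
  Relation.ReflTransGen (fun a b => r a b ∧ a ∈ S ∧ b ∈ S) x y

lemma Reach.mono {U : Type} {r : U → U → Prop} {S T : Set U} (h : S ⊆ T) {x y : U}
    (hx : Reach r S x y) : Reach r T x y :=
  Relation.ReflTransGen.mono (r := fun a b => r a b ∧ a ∈ S ∧ b ∈ S)
    (p := fun a b => r a b ∧ a ∈ T ∧ b ∈ T) (fun _ _ k => ⟨k.1, h k.2.1, h k.2.2⟩) _ _ hx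

lemma Reach.symm {U : Type} {r : U → U → Prop} (hr : ∀ a b, r a b → r b a) {S : Set U} {x y : U}
    (hx : Reach r S x y) : Reach r S y x := by
  induction hx with
  | refl => exact .refl
  | tail _ h ih => exact .head ⟨hr _ _ h.1, h.2.2, h.2.1⟩ ih

lemma comb_minor {U W Ed ι : Type} [Fintype U] [Fintype W] [Fintype ι] {G : SimpleGraph U}
    {F : ι → Chn U} (h : IsMac G F) (B : W → Set U) (D : Ed → Set U) (s t : Ed → W)
    (cB : ∀ w, ∀ x ∈ B w, ∀ y ∈ B w, Reach G.Adj (B w) x y)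
    (cD : ∀ e, ∀ x ∈ D e, ∀ y ∈ D e, Reach G.Adj (D e) x y)
    (dB : ∀ p q x, x ∈ B p → x ∈ B q → p = q)
    (dD : ∀ e f x, x ∈ D e → x ∈ D f → e = f)
    (dBD : ∀ w e x, x ∈ B w → x ∈ D e → w = s e ∨ w = t e)
    (hs : ∀ e, ∃ x ∈ D e, x ∈ B (s e)) (ht : ∀ e, ∃ x ∈ D e, x ∈ B (t e))
    (H : SimpleGraph W)
    (hH : ∀ p q, H.Adj p q → ∃ e, (p = s e ∧ q = t e) ∨ (p = t e ∧ q = s e)) :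
    ∃ F' : ι → Chn W, IsMac H F' := by
  let B' : W → Set U := fun w => B w ∪ {g | ∃ e, s e = w ∧ g ∈ D e ∧ g ∉ B (t e) ∧
    ∃ x ∈ B w, Reach G.Adj (B w ∪ (D e \ B (t e))) x g}
  have sub0 : ∀ w e, s e = w → ∀ x ∈ B w, ∀ y, Reach G.Adj (B w ∪ (D e \ B (t e))) x y →
      y ∈ B' w ∧ Reach G.Adj (B' w) x y := by
    intro w e he x hx y hy
    induction hy with
    | refl => exact ⟨Or.inl hx, .refl⟩
    | tail h1 h2 ih =>
      rename_i a b
      have hb : b ∈ B' w := by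
        rcases h2.2.2 with hb | hb
        · exact Or.inl hb
        · exact Or.inr ⟨e, he, hb.1, hb.2, x, hx, h1.tail h2⟩
      exact ⟨hb, ih.2.tail ⟨h2.1, ih.1, hb⟩⟩
  have sub := fun w e he x hx y hy => (sub0 w e he x hx y hy).1
  have sub2 := fun w e he x hx y hy => (sub0 w e he x hx y hy).2
  have hx0 : ∀ w, ∀ y ∈ B' w, ∃ x ∈ B w, Reach G.Adj (B' w) x y := by
    rintro w y (hy | ⟨e, he, h1, h2, x, hx, hr⟩)
    · exact ⟨y, hy, .refl⟩
    · exact ⟨x, hx, sub2 w e he x hx y hr⟩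
  refine h.minor H B' ?_ ?_ ?_
  · rintro p q x (h1 | ⟨e, rfl, h1, h1', -⟩) (h2 | ⟨f, rfl, h2, h2', -⟩)
    · exact dB _ _ _ h1 h2
    · rcases dBD _ _ _ h1 h2 with h | h
      · exact h
      · exact absurd (h ▸ h1) h2'
    · rcases dBD _ _ _ h2 h1 with h | h
      · exact h.symm
      · exact absurd (h ▸ h2) h1'
    · rw [dD _ _ _ h1 h2]
  · intro w x hx y hy
    obtain ⟨x', hx', rx⟩ := hx0 w x hx
    obtain ⟨y', hy', ry⟩ := hx0 w y hy
    exact (rx.symm (fun _ _ k => k.symm)).trans (((cB w x' hx' y' hy').mono subset_union_left).trans ry)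
  · have key : ∀ e, s e ≠ t e → ∃ x ∈ B' (s e), ∃ y ∈ B' (t e), G.Adj x y := by
      intro e hne
      obtain ⟨x, hxD, hxB⟩ := hs e
      obtain ⟨y, hyD, hyB⟩ := ht e
      by_contra hcon
      push Not at hcon
      have hr := cD e x hxD y hyD
      have : ∀ z, Reach G.Adj (D e) x z → (z ∈ B (t e) → False) ∧ Reach G.Adj (B (s e) ∪ (D e \ B (t e))) x z := by
        intro z hz
        induction hz with
        | refl => exact ⟨fun h => hne (dB _ _ _ hxB h), .refl⟩
        | tail h1 h2 ih =>
          rename_i a b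
          have ha : a ∈ B' (s e) := sub _ e rfl x hxB _ ih.2
          have hb : b ∉ B (t e) := fun hb => hcon a ha b (Or.inl hb) h2.1
          exact ⟨hb, ih.2.tail ⟨h2.1, Or.inr ⟨h2.2.1, ih.1⟩, Or.inr ⟨h2.2.2, hb⟩⟩⟩
      exact (this y hr).1 hyB
    intro p q hpq
    obtain ⟨e, ⟨rfl, rfl⟩ | ⟨rfl, rfl⟩⟩ := hH p q hpq
    · exact key e hpq.ne
    · obtain ⟨x, hx, y, hy, hxy⟩ := key e hpq.ne.symm
      exact ⟨y, hy, x, hx, hxy.symm⟩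

/-- cells touched by the point `x` at scale `h` -/
def cell (h : ℝ) (x : ℝ × ℝ) : Set (ℤ × ℤ) := {g | |h * g.1 - x.1| < h ∧ |h * g.2 - x.2| < h}

def pix (h : ℝ) (A : Set (ℝ × ℝ)) : Set (ℤ × ℤ) := {g | ∃ a ∈ A, g ∈ cell h a}

lemma cell_reach {h : ℝ} (hh : 0 < h) {x : ℝ × ℝ} {g g' : ℤ × ℤ} (hg : g ∈ cell h x) (hg' : g' ∈ cell h x) :
    Reach GAdj (cell h x) g g' := by
  have key : ∀ (a b : ℤ) (y : ℝ), |h * a - y| < h → |h * b - y| < h → a = b ∨ a + 1 = b ∨ b + 1 = a := by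
    intro a b y h1 h2
    rw [abs_lt] at h1 h2
    have e1 : h * ((a : ℝ) - b) < h * 2 := by nlinarith
    have e2 : h * ((b : ℝ) - a) < h * 2 := by nlinarith
    have e3 := lt_of_mul_lt_mul_left e1 hh.le
    have e4 := lt_of_mul_lt_mul_left e2 hh.le
    have e5 : a - b < 2 := by exact_mod_cast e3
    have e6 : b - a < 2 := by exact_mod_cast e4
    omega
  have hm : (g'.1, g.2) ∈ cell h x := ⟨hg'.1, hg.2⟩
  have r1 : Reach GAdj (cell h x) g (g'.1, g.2) := by
    rcases key _ _ _ hg.1 hg'.1 with h | h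
    · have : (g'.1, g.2) = g := Prod.ext h.symm rfl
      rw [this]
    · exact .single ⟨Or.inr ⟨rfl, h⟩, hg, hm⟩
  have r2 : Reach GAdj (cell h x) (g'.1, g.2) g' := by
    rcases key _ _ _ hg.2 hg'.2 with h | h
    · have : (g'.1, g.2) = g' := Prod.ext rfl h
      rw [this]
    · exact .single ⟨Or.inl ⟨rfl, h⟩, hm, hg'⟩
  exact r1.trans r2

lemma cell_nonempty {h : ℝ} (hh : 0 < h) (x : ℝ × ℝ) : (cell h x).Nonempty := by
  have key : ∀ y : ℝ, |h * ((⌊y / h⌋ : ℤ) : ℝ) - y| < h := by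
    intro y
    have h1 := Int.floor_le (y / h)
    have h2 := Int.lt_floor_add_one (y / h)
    rw [le_div_iff₀ hh] at h1
    rw [div_lt_iff₀ hh] at h2
    rw [abs_lt]; constructor <;> nlinarith
  exact ⟨(⌊x.1 / h⌋, ⌊x.2 / h⌋), key _, key _⟩

lemma cell_open {h : ℝ} (g : ℤ × ℤ) : IsOpen {x | g ∈ cell h x} := by
  have h1 : IsOpen {x : ℝ × ℝ | |h * g.1 - x.1| < h} := isOpen_lt (by fun_prop) continuous_const
  have h2 : IsOpen {x : ℝ × ℝ | |h * g.2 - x.2| < h} := isOpen_lt (by fun_prop) continuous_const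
  exact h1.inter h2

lemma pix_reach {h : ℝ} (hh : 0 < h) {A : Set (ℝ × ℝ)} (hA : IsPreconnected A) {g g' : ℤ × ℤ}
    (hg : g ∈ pix h A) (hg' : g' ∈ pix h A) : Reach GAdj (pix h A) g g' := by
  obtain ⟨a, ha, hga⟩ := hg
  obtain ⟨b, hb, hgb⟩ := hg'
  have sub : ∀ x ∈ A, cell h x ⊆ pix h A := fun x hx g hg => ⟨x, hx, hg⟩
  refine hA.induction₂ (fun x y => ∀ g ∈ cell h x, ∀ g' ∈ cell h y, Reach GAdj (pix h A) g g') ?_ ?_ ?_ ha hb g hga g' hgb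
  · intro x hx
    obtain ⟨k, hk⟩ := cell_nonempty hh x
    have : ∀ᶠ y in 𝓝[A] x, k ∈ cell h y :=
      mem_nhdsWithin_of_mem_nhds ((cell_open k).mem_nhds hk)
    filter_upwards [this, self_mem_nhdsWithin] with y hy hyA g hg g' hg'
    exact ((cell_reach hh hg hk).mono (sub x hx)).trans ((cell_reach hh hy hg').mono (sub y hyA))
  · intro x y z _ _ _ h1 h2 g hg g' hg'
    obtain ⟨k, hk⟩ := cell_nonempty hh y
    exact (h1 g hg k hk).trans (h2 k hk g' hg')
  · intro x y _ _ h1 g hg g' hg'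
    exact (h1 g' hg' g hg).symm fun _ _ => GAdj.symm

lemma cell_dist {h : ℝ} {x y : ℝ × ℝ} {g : ℤ × ℤ} (hx : g ∈ cell h x) (hy : g ∈ cell h y) : dist x y < 2 * h := by
  obtain ⟨x1, x2⟩ := hx
  obtain ⟨y1, y2⟩ := hy
  rw [abs_lt] at x1 x2 y1 y2
  rw [Prod.dist_eq, max_lt_iff, Real.dist_eq, Real.dist_eq, abs_lt, abs_lt]
  refine ⟨⟨?_, ?_⟩, ⟨?_, ?_⟩⟩ <;> linarith

lemma exists_scale {α : Type} [Finite α] (A : α → Set (ℝ × ℝ)) (hA : ∀ i, IsCompact (A i)) :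
    ∃ h : ℝ, 0 < h ∧ ∀ i j g, g ∈ pix h (A i) → g ∈ pix h (A j) → (A i ∩ A j).Nonempty := by
  have : ∀ ij : α × α, ∃ r : ℝ, 0 < r ∧ (A ij.1 ∩ A ij.2 = ∅ → ∀ x ∈ A ij.1, ∀ y ∈ A ij.2, r ≤ dist x y) := by
    intro ⟨i, j⟩
    by_cases hd : A i ∩ A j = ∅
    · obtain ⟨r, hr, h⟩ := Metric.exists_pos_forall_lt_edist (hA i) (hA j).isClosed
        (Set.disjoint_iff_inter_eq_empty.mpr hd)
      refine ⟨r, by exact_mod_cast hr, fun _ x hx y hy => ?_⟩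
      have := h x hx y hy
      rw [edist_nndist] at this
      have h2 : r < nndist x y := by exact_mod_cast this
      rw [dist_nndist]
      exact_mod_cast h2.le
    · exact ⟨1, one_pos, fun h => absurd h hd⟩
  choose r hr hr2 using this
  obtain ⟨m, hm, hmr⟩ : ∃ m : ℝ, 0 < m ∧ ∀ ij, m ≤ r ij := by
    rcases isEmpty_or_nonempty (α × α) with he | he
    · exact ⟨1, one_pos, fun ij => he.elim ij⟩
    · obtain ⟨i0, h0⟩ := Finite.exists_min r
      exact ⟨r i0, hr i0, h0⟩
  refine ⟨m / 2, by positivity, ?_⟩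
  rintro i j g ⟨x, hx, hgx⟩ ⟨y, hy, hgy⟩
  rw [Set.nonempty_iff_ne_empty]
  intro he
  have h1 := hr2 (i, j) he x hx y hy
  have h2 := cell_dist hgx hgy
  have h3 := hmr (i, j)
  linarith

lemma pix_bdd {h : ℝ} (hh : 0 < h) {A : Set (ℝ × ℝ)} (hA : IsCompact A) :
    ∃ N : ℤ, pix h A ⊆ (gbox N : Set (ℤ × ℤ)) := by
  obtain ⟨R, hR⟩ := hA.isBounded.exists_norm_le
  refine ⟨⌈R / h⌉ + 1, ?_⟩
  rintro g ⟨a, ha, h1, h2⟩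
  have hn := hR a ha
  rw [Prod.norm_def, max_le_iff, Real.norm_eq_abs, Real.norm_eq_abs, abs_le, abs_le] at hn
  have hc := Int.le_ceil (R / h)
  rw [div_le_iff₀ hh] at hc
  rw [abs_lt] at h1 h2
  rw [Finset.mem_coe, mem_gbox]
  have key : ∀ (k : ℤ) (y : ℝ), -R ≤ y → y ≤ R → -h < h * k - y → h * k - y < h →
      -(⌈R / h⌉ + 1) ≤ k ∧ k ≤ ⌈R / h⌉ + 1 := by
    intro k y a1 a2 a3 a4
    have e1 : h * (k : ℝ) ≤ h * ((⌈R / h⌉ + 1 : ℤ) : ℝ) := by push_cast; nlinarith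
    have e2 : h * ((-(⌈R / h⌉ + 1) : ℤ) : ℝ) ≤ h * (k : ℝ) := by push_cast; nlinarith
    exact ⟨by exact_mod_cast le_of_mul_le_mul_left e2 hh, by exact_mod_cast le_of_mul_le_mul_left e1 hh⟩
  exact ⟨key _ _ hn.1.1 hn.1.2 h1.1 h1.2, key _ _ hn.2.1 hn.2.2 h2.1 h2.2⟩

lemma gbox_mono {N M : ℤ} (h : N ≤ M) : (gbox N : Set (ℤ × ℤ)) ⊆ gbox M := by
  intro g; rw [Finset.mem_coe, Finset.mem_coe, mem_gbox, mem_gbox]; omega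

lemma reach_sub {N : ℤ} {S : Set (ℤ × ℤ)} (hS : S ⊆ (gbox N : Set (ℤ × ℤ))) {x y : gbox N}
    (h : Reach GAdj S x.1 y.1) : Reach (gridG N).Adj (Subtype.val ⁻¹' S) x y := by
  obtain ⟨x, hx⟩ := x
  obtain ⟨y, hy⟩ := y
  simp only at h
  induction h with
  | refl => exact .refl
  | tail h1 h2 ih => exact (ih (hS h2.2.1)).tail ⟨h2.1, h2.2.1, h2.2.2⟩

/-- Planar systems of compact connected sets give Mac graphs. -/
theorem planar_mac {W Ed : Type} [Fintype W] [Fintype Ed] (K : W → Set (ℝ × ℝ)) (M : Ed → Set (ℝ × ℝ))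
    (s t : Ed → W)
    (kK : ∀ w, IsCompact (K w)) (kM : ∀ e, IsCompact (M e))
    (cK : ∀ w, IsPreconnected (K w)) (cM : ∀ e, IsPreconnected (M e))
    (dK : ∀ p q, (K p ∩ K q).Nonempty → p = q)
    (dM : ∀ e f, (M e ∩ M f).Nonempty → e = f)
    (dKM : ∀ w e, (K w ∩ M e).Nonempty → w = s e ∨ w = t e)
    (hs : ∀ e, (M e ∩ K (s e)).Nonempty) (ht : ∀ e, (M e ∩ K (t e)).Nonempty)
    (H : SimpleGraph W)
    (hH : ∀ p q, H.Adj p q → ∃ e, (p = s e ∧ q = t e) ∨ (p = t e ∧ q = s e)) :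
    ∃ (ι : Type) (_ : Fintype ι) (F : ι → Chn W), IsMac H F := by
  let A : W ⊕ Ed → Set (ℝ × ℝ) := Sum.elim K M
  have kA : ∀ i, IsCompact (A i) := by rintro (w | e); exacts [kK w, kM e]
  obtain ⟨h, hh, hdis⟩ := exists_scale A kA
  have : ∃ N : ℤ, ∀ i, pix h (A i) ⊆ (gbox N : Set (ℤ × ℤ)) := by
    choose N hN using fun i => pix_bdd hh (kA i)
    refine ⟨∑ i, |N i|, fun i => (hN i).trans (gbox_mono ?_)⟩
    exact (le_abs_self _).trans (Finset.single_le_sum (f := fun i => |N i|) (fun j _ => abs_nonneg _) (Finset.mem_univ i))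
  obtain ⟨N, hN⟩ := this
  obtain ⟨F, hF⟩ := grid_mac N
  have meet : ∀ i j, (A i ∩ A j).Nonempty → ∃ x : gbox N, x.1 ∈ pix h (A i) ∧ x.1 ∈ pix h (A j) := by
    rintro i j ⟨x, hi, hj⟩
    obtain ⟨g, hg⟩ := cell_nonempty hh x
    exact ⟨⟨g, hN i ⟨x, hi, hg⟩⟩, ⟨x, hi, hg⟩, ⟨x, hj, hg⟩⟩
  obtain ⟨F', hF'⟩ := comb_minor hF (fun w => Subtype.val ⁻¹' pix h (K w)) (fun e => Subtype.val ⁻¹' pix h (M e)) s t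
    (fun w x hx y hy => reach_sub (hN (.inl w)) (pix_reach hh (cK w) hx hy))
    (fun e x hx y hy => reach_sub (hN (.inr e)) (pix_reach hh (cM e) hx hy))
    (fun p q x hp hq => dK p q (hdis (.inl p) (.inl q) x hp hq))
    (fun p q x hp hq => dM p q (hdis (.inr p) (.inr q) x hp hq))
    (fun w e x hp hq => dKM w e (hdis (.inl w) (.inr e) x hp hq))
    (fun e => by obtain ⟨x, h1, h2⟩ := meet (.inr e) (.inl (s e)) (hs e); exact ⟨x, h1, h2⟩)
    (fun e => by obtain ⟨x, h1, h2⟩ := meet (.inr e) (.inl (t e)) (ht e); exact ⟨x, h1, h2⟩)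
    H hH
  exact ⟨_, inferInstance, F', hF'⟩

end PlaneG
end RepProof

namespace RepProof
open scoped Classical

section PlaneP

theorem planar_paths {W Ed : Type} [Fintype W] [Fintype Ed] (C : W → Set (ℝ × ℝ)) (P : Ed → ℝ → ℝ × ℝ)
    (s t : Ed → W) (kC : ∀ w, IsCompact (C w)) (cC : ∀ w, IsConnected (C w))
    (dC : ∀ p q x, x ∈ C p → x ∈ C q → p = q) (hP : ∀ e, Continuous (P e))
    (h0 : ∀ e, P e 0 ∈ C (s e)) (h1 : ∀ e, P e 1 ∈ C (t e))
    (hintr : ∀ e, ∀ x ∈ Ioo (0 : ℝ) 1, ∀ w, P e x ∉ C w)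
    (hinj : ∀ e f, ∀ x ∈ Ioo (0 : ℝ) 1, ∀ y ∈ Ioo (0 : ℝ) 1, P e x = P f y → e = f ∧ x = y)
    (H : SimpleGraph W)
    (hH : ∀ p q, H.Adj p q → ∃ e, (p = s e ∧ q = t e) ∨ (p = t e ∧ q = s e)) :
    ∃ (ι : Type) (_ : Fintype ι) (F : ι → Chn W), IsMac H F := by
  let K : W → Set (ℝ × ℝ) := fun w => C w ∪ ((⋃ e : {e // s e = w}, P e.1 '' Icc 0 (1 / 3)) ∪
    (⋃ e : {e // t e = w}, P e.1 '' Icc (2 / 3) 1))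
  let M : Ed → Set (ℝ × ℝ) := fun e => P e '' Icc (1 / 3) (2 / 3)
  have nf : ∀ w x, x ∈ K w → x ∈ C w ∨ ∃ e, ∃ r ∈ Ioo (0 : ℝ) 1, x = P e r ∧
      ((s e = w ∧ r ≤ 1 / 3) ∨ (t e = w ∧ 2 / 3 ≤ r)) := by
    rintro w x (h | h | h)
    · exact Or.inl h
    · obtain ⟨⟨e, rfl⟩, r, hr, rfl⟩ := mem_iUnion.mp h
      rcases eq_or_lt_of_le hr.1 with h | h
      · left; rw [← h]; exact h0 e
      · right; exact ⟨e, r, ⟨h, by linarith [hr.2]⟩, rfl, Or.inl ⟨rfl, hr.2⟩⟩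
    · obtain ⟨⟨e, rfl⟩, r, hr, rfl⟩ := mem_iUnion.mp h
      rcases eq_or_lt_of_le hr.2 with h | h
      · left; rw [h]; exact h1 e
      · right; exact ⟨e, r, ⟨by linarith [hr.1], h⟩, rfl, Or.inr ⟨rfl, hr.1⟩⟩
  have mI : ∀ r ∈ Icc (1 / 3 : ℝ) (2 / 3), r ∈ Ioo (0 : ℝ) 1 := by
    intro r hr; exact ⟨by linarith [hr.1], by linarith [hr.2]⟩
  refine planar_mac K M s t ?_ ?_ ?_ ?_ ?_ ?_ ?_ ?_ ?_ H hH
  · intro w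
    exact (kC w).union ((isCompact_iUnion fun e => isCompact_Icc.image (hP _)).union
      (isCompact_iUnion fun e => isCompact_Icc.image (hP _)))
  · exact fun e => isCompact_Icc.image (hP _)
  · intro w
    obtain ⟨c0, hc0⟩ := (cC w).nonempty
    refine isPreconnected_of_forall c0 ?_
    rintro y (h | h | h)
    · exact ⟨C w, subset_union_left, hc0, h, (cC w).isPreconnected⟩
    · obtain ⟨⟨e, rfl⟩, hy⟩ := mem_iUnion.mp h
      refine ⟨C (s e) ∪ P e '' Icc 0 (1 / 3), ?_, Or.inl hc0, Or.inr hy, ?_⟩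
      · exact union_subset_union_right _ (fun x hx => Or.inl (mem_iUnion.mpr ⟨⟨e, rfl⟩, hx⟩))
      · exact IsPreconnected.union (P e 0) (h0 e) ⟨0, by norm_num, rfl⟩ (cC _).isPreconnected
          (isPreconnected_Icc.image _ (hP e).continuousOn)
    · obtain ⟨⟨e, rfl⟩, hy⟩ := mem_iUnion.mp h
      refine ⟨C (t e) ∪ P e '' Icc (2 / 3) 1, ?_, Or.inl hc0, Or.inr hy, ?_⟩
      · exact union_subset_union_right _ (fun x hx => Or.inr (mem_iUnion.mpr ⟨⟨e, rfl⟩, hx⟩))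
      · exact IsPreconnected.union (P e 1) (h1 e) ⟨1, by norm_num, rfl⟩ (cC _).isPreconnected
          (isPreconnected_Icc.image _ (hP e).continuousOn)
  · exact fun e => isPreconnected_Icc.image _ (hP e).continuousOn
  · rintro p q ⟨x, hp, hq⟩
    rcases nf p x hp with hp | ⟨e, r, hr, rfl, hp2⟩
    · rcases nf q x hq with hq | ⟨f, r', hr', rfl, hq⟩
      · exact dC _ _ _ hp hq
      · exact absurd hp (hintr f r' hr' p)
    · rcases nf q _ hq with hq | ⟨f, r', hr', he, hq⟩
      · exact absurd hq (hintr e r hr q)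
      · obtain ⟨rfl, rfl⟩ := hinj _ _ _ hr _ hr' he
        rcases hp2 with ⟨hp, hp'⟩ | ⟨hp, hp'⟩ <;> rcases hq with ⟨hq, hq'⟩ | ⟨hq, hq'⟩
        · exact hp.symm.trans hq
        · linarith
        · linarith
        · exact hp.symm.trans hq
  · rintro e f ⟨x, ⟨r, hr, rfl⟩, ⟨r', hr', h⟩⟩
    exact (hinj _ _ _ (mI r hr) _ (mI r' hr') h.symm).1
  · rintro w e ⟨x, hw, ⟨r, hr, rfl⟩⟩
    rcases nf w _ hw with hp | ⟨f, r', hr', he, hp⟩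
    · exact absurd hp (hintr e r (mI r hr) w)
    · obtain ⟨rfl, rfl⟩ := hinj _ _ _ (mI r hr) _ hr' he
      rcases hp with ⟨rfl, _⟩ | ⟨rfl, _⟩ <;> simp
  · intro e
    exact ⟨P e (1 / 3), ⟨1 / 3, by norm_num, rfl⟩, Or.inr (Or.inl (mem_iUnion.mpr
      ⟨⟨e, rfl⟩, 1 / 3, by norm_num, rfl⟩))⟩
  · intro e
    exact ⟨P e (2 / 3), ⟨2 / 3, by norm_num, rfl⟩, Or.inr (Or.inr (mem_iUnion.mpr
      ⟨⟨e, rfl⟩, 2 / 3, by norm_num, rfl⟩))⟩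

end PlaneP
end RepProof

namespace RepProof
open scoped Classical

section Inter

lemma exists_log_lift (F : C(ℂ, ℂ)) (hF : ∀ z, F z ≠ 0) : ∃ g : C(ℂ, ℂ), ∀ z, Complex.exp (g z) = F z := by
  obtain ⟨g, ⟨_, hg⟩, _⟩ := Complex.isCoveringMapOn_exp.existsUnique_continuousMap_lifts F (a₀ := 0)
    (e₀ := Complex.log (F 0)) (Complex.exp_log (hF 0)) (fun a => by simpa using hF a)
  exact ⟨g, fun z => congrFun hg z⟩

lemma periodic_bdd {α : ℝ → ℂ} (hα : Continuous α) {a : ℂ} (h : ∀ s, α (s + 1) = α s + a) :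
    ∃ C, ∀ s, ‖α s - s * a‖ ≤ C := by
  have hper : Function.Periodic (fun s : ℝ => α s - s * a) 1 := by
    intro s; simp only [h]; push_cast; ring
  have hc : Continuous (fun s : ℝ => α s - s * a) := by fun_prop
  obtain ⟨C, hC⟩ := (isCompact_Icc (a := (0 : ℝ)) (b := 1)).exists_bound_of_continuousOn hc.continuousOn
  refine ⟨C, fun s => ?_⟩
  obtain ⟨y, hy, hy2⟩ := hper.exists_mem_Ico₀ one_pos s
  have := hC y ⟨hy.1, hy.2.le⟩
  rw [hy2]; exact this

/-- Periodic curves with independent periods meet. -/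
theorem curves_meet {α β : ℝ → ℂ} (hα : Continuous α) (hβ : Continuous β) {m : ℝ} {M K : ℝ}
    (hm : m ≠ 0) (hK : K ≠ 0) (pα : ∀ s, α (s + 1) = α s + m)
    (pβ : ∀ s, β (s + 1) = β s + (M + K * Complex.I)) : ∃ s t, α s = β t := by
  by_contra hcon
  push Not at hcon
  let F : C(ℂ, ℂ) := ⟨fun z => α z.re - β z.im, by fun_prop⟩
  have hF : ∀ z, F z ≠ 0 := fun z => sub_ne_zero.mpr (hcon _ _)
  obtain ⟨g, hg⟩ := exists_log_lift F hF
  obtain ⟨C1, hC1⟩ := periodic_bdd hα pα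
  obtain ⟨C2, hC2⟩ := periodic_bdd hβ pβ
  let L : ℂ → ℂ := fun z => z.re * m - z.im * (M + K * Complex.I)
  have hLc : Continuous L := by fun_prop
  have hFL : ∀ z, ‖F z - L z‖ ≤ C1 + C2 := by
    intro z
    have : F z - L z = (α z.re - z.re * m) - (β z.im - z.im * (M + K * Complex.I)) := by
      show α z.re - β z.im - (z.re * m - z.im * (M + K * Complex.I)) = _
      ring
    rw [this]
    exact (norm_sub_le _ _).trans (add_le_add (hC1 _) (hC2 _))
  have hC0 : 0 ≤ C1 + C2 := (norm_nonneg _).trans (hFL 0)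
  obtain ⟨D, hD, hLD⟩ : ∃ D : ℝ, 0 < D ∧ ∀ z, ‖z‖ ≤ D * ‖L z‖ := by
    have hm' : 0 < |m| := abs_pos.mpr hm
    have hK' : 0 < |K| := abs_pos.mpr hK
    refine ⟨1 / |K| + (1 + |M| / |K|) / |m|, by positivity, fun z => ?_⟩
    have hi : |z.im| * |K| ≤ ‖L z‖ := by
      have h1 := Complex.abs_im_le_norm (L z)
      have h2 : (L z).im = -(z.im * K) := by simp [L]
      rw [h2, abs_neg, abs_mul] at h1
      exact h1
    have hr : |z.re| * |m| ≤ ‖L z‖ + |z.im| * |M| := by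
      have h1 := Complex.abs_re_le_norm (L z)
      have h2 : (L z).re = z.re * m - z.im * M := by simp [L]
      have h3 : z.re * m = (L z).re + z.im * M := by rw [h2]; ring
      rw [← abs_mul, h3, ← abs_mul]
      exact (abs_add_le _ _).trans (by linarith)
    have hi' : |z.im| ≤ ‖L z‖ / |K| := by rw [le_div_iff₀ hK']; exact hi
    have hr' : |z.re| ≤ (‖L z‖ + ‖L z‖ / |K| * |M|) / |m| := by
      rw [le_div_iff₀ hm']
      have : |z.im| * |M| ≤ ‖L z‖ / |K| * |M| := mul_le_mul_of_nonneg_right hi' (abs_nonneg _)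
      linarith
    have hn := Complex.norm_le_abs_re_add_abs_im z
    calc ‖z‖ ≤ (‖L z‖ + ‖L z‖ / |K| * |M|) / |m| + ‖L z‖ / |K| := by linarith
      _ = (1 / |K| + (1 + |M| / |K|) / |m|) * ‖L z‖ := by field_simp; ring
  set R := D * (C1 + C2 + 1) with hR
  have hRpos : 0 < R := by positivity
  have hL : ∀ z ∈ Metric.sphere (0 : ℂ) R, C1 + C2 + 1 ≤ ‖L z‖ := by
    intro z hz
    have h1 := hLD z
    rw [mem_sphere_zero_iff_norm] at hz
    rw [hz, hR] at h1
    exact le_of_mul_le_mul_left h1 hD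
  have hL0 : ∀ z ∈ Metric.sphere (0 : ℂ) R, L z ≠ 0 := by
    intro z hz h
    have := hL z hz
    rw [h, norm_zero] at this
    linarith
  have hsl : ∀ z ∈ Metric.sphere (0 : ℂ) R, F z / L z ∈ Complex.slitPlane := by
    intro z hz
    left
    have h1 : ‖F z / L z - 1‖ < 1 := by
      rw [div_sub_one (hL0 z hz), norm_div, div_lt_one (norm_pos_iff.mpr (hL0 z hz))]
      linarith [hL z hz, hFL z]
    have h2 := Complex.abs_re_le_norm (F z / L z - 1)
    rw [Complex.sub_re, Complex.one_re] at h2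
    have := (abs_lt.mp (h2.trans_lt h1)).1
    linarith
  have hneg : ∀ z ∈ Metric.sphere (0 : ℂ) R, -z ∈ Metric.sphere (0 : ℂ) R := by
    intro z hz; simpa using hz
  have hlogc : ContinuousOn (fun z => Complex.log (F z / L z)) (Metric.sphere (0 : ℂ) R) :=
    ContinuousOn.clog (F.continuous.continuousOn.div hLc.continuousOn hL0) hsl
  let k : ℂ → ℂ := fun z => g (-z) - g z - (Complex.log (F (-z) / L (-z)) - Complex.log (F z / L z))
  have hk : ContinuousOn k (Metric.sphere (0 : ℂ) R) := by
    refine ContinuousOn.sub (by fun_prop) (ContinuousOn.sub ?_ hlogc)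
    exact hlogc.comp continuous_neg.continuousOn hneg
  have hkexp : ∀ z ∈ Metric.sphere (0 : ℂ) R, Complex.exp (k z) = -1 := by
    intro z hz
    have e1 : F (-z) / L (-z) ≠ 0 := div_ne_zero (hF _) (hL0 _ (hneg z hz))
    have e2 : F z / L z ≠ 0 := div_ne_zero (hF _) (hL0 _ hz)
    simp only [k]
    rw [Complex.exp_sub, Complex.exp_sub, Complex.exp_sub, hg, hg, Complex.exp_log e1, Complex.exp_log e2]
    have e3 : L (-z) = - L z := by simp only [L, Complex.neg_re, Complex.neg_im]; push_cast; ring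
    rw [e3]
    have := hF z; have := hF (-z); have := hL0 z hz
    field_simp
  have hodd : ∀ z, k (-z) = - k z := by intro z; simp only [k, neg_neg]; ring
  have hpre : IsPreconnected (Metric.sphere (0 : ℂ) R) :=
    isPreconnected_sphere (by rw [Complex.rank_real_complex]; exact_mod_cast Nat.one_lt_two) _ _
  have hzero : ∃ w ∈ Metric.sphere (0 : ℂ) R, (k w).im = 0 := by
    have hz0 : (R : ℂ) ∈ Metric.sphere (0 : ℂ) R := by
      rw [mem_sphere_zero_iff_norm, Complex.norm_real, Real.norm_eq_abs, abs_of_pos hRpos]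
    have hkim : ContinuousOn (fun z => (k z).im) (Metric.sphere (0 : ℂ) R) :=
      Complex.continuous_im.comp_continuousOn hk
    have e := hodd (R : ℂ)
    have e' : (k (-(R : ℂ))).im = - (k R).im := by rw [e]; simp
    rcases le_total 0 (k (R : ℂ)).im with h | h
    · obtain ⟨w, hw, hw2⟩ := hpre.intermediate_value (hneg _ hz0) hz0 hkim (show (0 : ℝ) ∈ Icc _ _ from ⟨by linarith, h⟩)
      exact ⟨w, hw, hw2⟩
    · obtain ⟨w, hw, hw2⟩ := hpre.intermediate_value hz0 (hneg _ hz0) hkim (show (0 : ℝ) ∈ Icc _ _ from ⟨h, by linarith⟩)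
      exact ⟨w, hw, hw2⟩
  obtain ⟨w, hw, hw0⟩ := hzero
  have h1 := congrArg Complex.re (hkexp w hw)
  rw [Complex.exp_re, hw0, Real.cos_zero] at h1
  have := Real.exp_pos (k w).re
  simp at h1
  linarith

end Inter
end RepProof

namespace RepProof
open scoped Classical

section Tor

lemma circ_eq {x y : ℝ} : (x : Circle1) = y ↔ ∃ n : ℤ, y = x + n := by
  rw [eq_comm, ← sub_eq_zero, ← AddCircle.coe_sub, AddCircle.coe_eq_zero_iff]
  constructor
  · rintro ⟨n, hn⟩; exact ⟨n, by simp at hn; linarith⟩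
  · rintro ⟨n, hn⟩; exact ⟨n, by simp [hn]⟩

lemma circ_cov : IsCoveringMap ((↑) : ℝ → Circle1) := AddCircle.isCoveringMap_coe 1

lemma circ_lift (f : C(ℝ, Circle1)) (a x : ℝ) (h : (x : Circle1) = f a) :
    ∃ g : C(ℝ, ℝ), g a = x ∧ ∀ t, (g t : Circle1) = f t := by
  obtain ⟨g, ⟨h1, h2⟩, _⟩ := circ_cov.existsUnique_continuousMap_lifts f a x h
  exact ⟨g, h1, fun t => congrFun h2 t⟩

lemma circ_deg (f : C(Circle1, Circle1)) : ∃ (g : C(ℝ, ℝ)) (c : ℤ), (∀ t, (g t : Circle1) = f t) ∧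
    ∀ t, g (t + 1) = g t + c := by
  obtain ⟨x, hx⟩ := QuotientAddGroup.mk_surjective (f ((0 : ℝ) : Circle1))
  obtain ⟨g, h0, hg⟩ := circ_lift ⟨fun t => f (t : Circle1), by
    have : Continuous ((↑) : ℝ → Circle1) := circ_cov.continuous
    fun_prop⟩ 0 x hx
  simp only [ContinuousMap.coe_mk] at hg
  have h1 : ((g 0 : ℝ) : Circle1) = (g 1 : ℝ) := by
    rw [hg, hg]; congr 1; rw [circ_eq]; exact ⟨1, by simp⟩
  obtain ⟨c, hc⟩ := circ_eq.mp h1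
  refine ⟨g, c, hg, fun t => ?_⟩
  have := circ_cov.eq_of_comp_eq (g₁ := fun t : ℝ => g (t + 1)) (g₂ := fun t => g t + c)
    (by fun_prop) (by fun_prop) (by
      funext t
      simp only [Function.comp]
      have e1 : ((g t + c : ℝ) : Circle1) = (g t : ℝ) := (circ_eq.mpr ⟨c, rfl⟩).symm
      rw [e1, hg, hg]; congr 1; symm; rw [circ_eq]; exact ⟨1, by simp⟩) 0 (by simpa using hc)
  exact congrFun this t

def p0 : C(ℝ × ℝ, Torus) := ⟨fun x => ((x.1 : Circle1), (x.2 : Circle1)), by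
  have : Continuous ((↑) : ℝ → Circle1) := circ_cov.continuous
  fun_prop⟩

lemma null_of_zero (γ : C(Circle1, Torus)) (g1 g2 : C(ℝ, ℝ)) (h1 : ∀ t, (g1 t : Circle1) = (γ t).1)
    (h2 : ∀ t, (g2 t : Circle1) = (γ t).2) (q1 : ∀ t, g1 (t + 1) = g1 t) (q2 : ∀ t, g2 (t + 1) = g2 t) :
    NullHomotopic γ := by
  have hd : ∀ g : C(ℝ, ℝ), (∀ t, g (t + 1) = g t) → ∃ f : C(Circle1, ℝ), ∀ t : ℝ, f t = g t := by
    intro g hg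
    have hp : Function.Periodic g 1 := hg
    refine ⟨⟨hp.lift, ?_⟩, fun t => rfl⟩
    exact Continuous.quotient_lift g.continuous _
  obtain ⟨f1, hf1⟩ := hd g1 q1
  obtain ⟨f2, hf2⟩ := hd g2 q2
  have e : γ = p0.comp (f1.prodMk f2) := by
    ext z
    all_goals
      obtain ⟨t, rfl⟩ := QuotientAddGroup.mk_surjective z
      simp only [p0, ContinuousMap.comp_apply, ContinuousMap.coe_mk]
    · exact (h1 t).symm.trans (congrArg _ (hf1 t).symm)
    · exact (h2 t).symm.trans (congrArg _ (hf2 t).symm)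
  have := ((id_nullhomotopic (ℝ × ℝ)).comp_left (f1.prodMk f2)).comp_right p0
  rw [ContinuousMap.id_comp, ← e] at this
  exact this

/-- A chart of the torus adapted to the curve. -/
structure Chart (γ : C(Circle1, Torus)) where
  p : ℝ × ℝ → Torus
  cont : Continuous p
  surj : Function.Surjective p
  eq_iff : ∀ x y, p x = p y ↔ ∃ i j : ℤ, y = x + ((i : ℝ), (j : ℝ))
  lift : ∀ f : C(ℝ, Torus), ∀ x, p x = f 0 → ∃ g : C(ℝ, ℝ × ℝ), g 0 = x ∧ ∀ t, p (g t) = f t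
  g : ℝ → ℝ × ℝ
  gcont : Continuous g
  pg : ∀ t, p (g t) = γ (t : Circle1)
  m : ℤ
  m0 : m ≠ 0
  per : ∀ t, g (t + 1) = g t + ((m : ℝ), 0)

lemma exists_chart (γ : C(Circle1, Torus)) (hn : ¬ NullHomotopic γ) : Nonempty (Chart γ) := by
  obtain ⟨g1, c1, hg1, hc1⟩ := circ_deg ((ContinuousMap.fst).comp γ)
  obtain ⟨g2, c2, hg2, hc2⟩ := circ_deg ((ContinuousMap.snd).comp γ)
  simp only [ContinuousMap.comp_apply, ContinuousMap.fst_apply, ContinuousMap.snd_apply] at hg1 hg2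
  have hc : ¬ (c1 = 0 ∧ c2 = 0) := by
    rintro ⟨rfl, rfl⟩
    exact hn (null_of_zero γ g1 g2 hg1 hg2 (by simpa using hc1) (by simpa using hc2))
  obtain ⟨m, a, b, r, s, hm, ha, hb, hdet⟩ : ∃ m a b r s : ℤ, m ≠ 0 ∧ c1 = m * a ∧ c2 = m * b ∧ a * r + b * s = 1 := by
    have h0 : (Int.gcd c1 c2 : ℤ) ≠ 0 := by
      rw [Ne, Int.natCast_eq_zero, Int.gcd_eq_zero_iff]; exact hc
    obtain ⟨a, ha⟩ := Int.gcd_dvd_left c1 c2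
    obtain ⟨b, hb⟩ := Int.gcd_dvd_right c1 c2
    refine ⟨Int.gcd c1 c2, a, b, Int.gcdA c1 c2, Int.gcdB c1 c2, h0, ha, hb, ?_⟩
    have := Int.gcd_eq_gcd_ab c1 c2
    apply mul_left_cancel₀ h0
    calc (Int.gcd c1 c2 : ℤ) * (a * Int.gcdA c1 c2 + b * Int.gcdB c1 c2)
        = ((Int.gcd c1 c2 : ℤ) * a) * Int.gcdA c1 c2 + ((Int.gcd c1 c2 : ℤ) * b) * Int.gcdB c1 c2 := by ring
      _ = c1 * Int.gcdA c1 c2 + c2 * Int.gcdB c1 c2 := by rw [← ha, ← hb]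
      _ = _ := by rw [← this, mul_one]
  have hdetR : (a : ℝ) * r + b * s = 1 := by exact_mod_cast hdet
  let A : ℝ × ℝ → ℝ × ℝ := fun x => (a * x.1 - s * x.2, b * x.1 + r * x.2)
  let B : ℝ × ℝ → ℝ × ℝ := fun x => (r * x.1 + s * x.2, -b * x.1 + a * x.2)
  have hA : Continuous A := by fun_prop
  have hB : Continuous B := by fun_prop
  have hAB : ∀ x, A (B x) = x := by
    intro x
    refine Prod.ext ?_ ?_
    · show a * (r * x.1 + s * x.2) - s * (-b * x.1 + a * x.2) = x.1
      linear_combination x.1 * hdetR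
    · show b * (r * x.1 + s * x.2) + r * (-b * x.1 + a * x.2) = x.2
      linear_combination x.2 * hdetR
  have hBA : ∀ x, B (A x) = x := by
    intro x
    refine Prod.ext ?_ ?_
    · show r * (a * x.1 - s * x.2) + s * (b * x.1 + r * x.2) = x.1
      linear_combination x.1 * hdetR
    · show -b * (a * x.1 - s * x.2) + a * (b * x.1 + r * x.2) = x.2
      linear_combination x.2 * hdetR
  have hp0 : ∀ x y, p0 x = p0 y ↔ ∃ i j : ℤ, y = x + ((i : ℝ), (j : ℝ)) := by
    intro x y
    simp only [p0, ContinuousMap.coe_mk, Prod.mk.injEq, circ_eq]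
    constructor
    · rintro ⟨⟨i, hi⟩, ⟨j, hj⟩⟩; exact ⟨i, j, Prod.ext hi hj⟩
    · rintro ⟨i, j, rfl⟩; exact ⟨⟨i, rfl⟩, ⟨j, rfl⟩⟩
  refine ⟨{ p := fun x => p0 (A x), cont := p0.continuous.comp hA, surj := ?_, eq_iff := ?_, lift := ?_,
            g := fun t => B (g1 t, g2 t), gcont := by fun_prop, pg := ?_, m := m, m0 := hm, per := ?_ }⟩
  · rintro ⟨z1, z2⟩
    obtain ⟨x1, rfl⟩ := QuotientAddGroup.mk_surjective z1
    obtain ⟨x2, rfl⟩ := QuotientAddGroup.mk_surjective z2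
    refine ⟨B (x1, x2), ?_⟩
    simp only [hAB]; rfl
  · intro x y
    rw [hp0]
    constructor
    · rintro ⟨i, j, h⟩
      refine ⟨r * i + s * j, -b * i + a * j, ?_⟩
      rw [← hBA y, h, ← hBA x, hAB]
      refine Prod.ext ?_ ?_
      · simp [B]; ring
      · simp [B]; ring
    · rintro ⟨i, j, rfl⟩
      refine ⟨a * i - s * j, b * i + r * j, ?_⟩
      refine Prod.ext ?_ ?_
      · simp [A]; ring
      · simp [A]; ring
  · intro f x hx
    have hx1 := congrArg Prod.fst hx
    have hx2 := congrArg Prod.snd hx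
    obtain ⟨u1, h1, k1⟩ := circ_lift (ContinuousMap.fst.comp f) 0 (A x).1 hx1
    obtain ⟨u2, h2, k2⟩ := circ_lift (ContinuousMap.snd.comp f) 0 (A x).2 hx2
    refine ⟨⟨fun t => B (u1 t, u2 t), by fun_prop⟩, ?_, ?_⟩
    · simp only [ContinuousMap.coe_mk, h1, h2]; exact hBA x
    · intro t
      simp only [ContinuousMap.coe_mk, hAB]
      exact Prod.ext (k1 t) (k2 t)
  · intro t
    simp only [hAB]
    exact Prod.ext (hg1 t) (hg2 t)
  · intro t
    simp only [hc1, hc2, ha, hb]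
    refine Prod.ext ?_ ?_
    · simp [B]; linear_combination (m : ℝ) * hdetR
    · simp [B]; ring

end Tor
end RepProof

namespace RepProof
open scoped Classical

section Tor2

variable {γ : C(Circle1, Torus)}

lemma Chart.per_int (χ : Chart γ) (t : ℝ) (n : ℤ) : χ.g (t + n) = χ.g t + ((n : ℝ) * χ.m, 0) := by
  induction n using Int.induction_on with
  | zero => simp
  | succ i ih =>
    have : t + ((i + 1 : ℤ) : ℝ) = (t + (i : ℤ)) + 1 := by push_cast; ring
    rw [this, χ.per, ih]
    refine Prod.ext ?_ ?_ <;> simp <;> ring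
  | pred i ih =>
    have h := χ.per (t + ((-i - 1 : ℤ) : ℝ))
    have : t + ((-i - 1 : ℤ) : ℝ) + 1 = t + ((-i : ℤ) : ℝ) := by push_cast; ring
    rw [this, ih] at h
    rw [← sub_eq_iff_eq_add] at h
    rw [← h]
    refine Prod.ext ?_ ?_ <;> simp <;> ring

def Chart.Gam (χ : Chart γ) (k : ℤ) : Set (ℝ × ℝ) := {x | ∃ (t : ℝ) (i : ℤ), x = χ.g t + ((i : ℝ), (k : ℝ))}

lemma Chart.p_add (χ : Chart γ) (x : ℝ × ℝ) (i j : ℤ) : χ.p (x + ((i : ℝ), (j : ℝ))) = χ.p x :=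
  ((χ.eq_iff _ _).mpr ⟨i, j, rfl⟩).symm

lemma Chart.gam_range (χ : Chart γ) {x : ℝ × ℝ} {k : ℤ} (h : x ∈ χ.Gam k) : χ.p x ∈ range γ := by
  obtain ⟨t, i, rfl⟩ := h
  rw [χ.p_add, χ.pg]; exact ⟨_, rfl⟩

lemma Chart.range_gam (χ : Chart γ) {x : ℝ × ℝ} (h : χ.p x ∈ range γ) : ∃ k, x ∈ χ.Gam k := by
  obtain ⟨z, hz⟩ := h
  obtain ⟨t, rfl⟩ := QuotientAddGroup.mk_surjective z
  have : χ.p (χ.g t) = χ.p x := by rw [χ.pg]; exact hz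
  obtain ⟨i, j, rfl⟩ := (χ.eq_iff _ _).mp this
  exact ⟨j, t, i, rfl⟩

lemma Chart.gam_unique (χ : Chart γ) (hinj : Function.Injective γ) {x : ℝ × ℝ} {k l : ℤ}
    (hk : x ∈ χ.Gam k) (hl : x ∈ χ.Gam l) : k = l := by
  obtain ⟨t, i, rfl⟩ := hk
  obtain ⟨t', i', h⟩ := hl
  have hp := congrArg χ.p h
  rw [χ.p_add, χ.p_add, χ.pg, χ.pg] at hp
  obtain ⟨n, rfl⟩ := circ_eq.mp (hinj hp)
  rw [χ.per_int] at h
  have := congrArg Prod.snd h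
  simp at this
  exact_mod_cast this

lemma Chart.gam_shift (χ : Chart γ) {x : ℝ × ℝ} {k : ℤ} (h : x ∈ χ.Gam k) (i j : ℤ) :
    x + ((i : ℝ), (j : ℝ)) ∈ χ.Gam (k + j) := by
  obtain ⟨t, i', rfl⟩ := h
  refine ⟨t, i' + i, ?_⟩
  refine Prod.ext ?_ ?_ <;> simp <;> ring

/-- periodic extension of a path -/
lemma periodic_ext (f : ℝ → ℝ × ℝ) (hf : Continuous f) (c : ℝ × ℝ) (h1 : f 1 = f 0 + c) :
    ∃ b : ℝ → ℝ × ℝ, Continuous b ∧ (∀ t, b (t + 1) = b t + c) ∧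
      ∀ t, ∃ t0 ∈ Icc (0 : ℝ) 1, ∃ n : ℤ, b t = f t0 + (n : ℝ) • c := by
  let φ : Circle1 → ℝ × ℝ := AddCircle.liftIco 1 0 (fun t => f t - t • c)
  have hφ : Continuous φ := by
    apply AddCircle.liftIco_continuous
    · simp [h1]
    · fun_prop
  have hcoe : Continuous ((↑) : ℝ → Circle1) := circ_cov.continuous
  refine ⟨fun t => φ t + t • c, by fun_prop, ?_, ?_⟩
  · intro t
    have : ((t + 1 : ℝ) : Circle1) = t := by symm; rw [circ_eq]; exact ⟨1, by simp⟩
    simp only [this, add_smul, one_smul, add_assoc]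
  · intro t
    refine ⟨Int.fract t, ⟨Int.fract_nonneg t, (Int.fract_lt_one t).le⟩, ⌊t⌋, ?_⟩
    have e : (t : Circle1) = (Int.fract t : ℝ) := by
      rw [circ_eq]; exact ⟨-⌊t⌋, by push_cast; rw [← Int.self_sub_floor]; ring⟩
    have e2 : φ ((Int.fract t : ℝ) : Circle1) = f (Int.fract t) - (Int.fract t) • c :=
      AddCircle.liftIco_coe_apply ⟨Int.fract_nonneg t, by simpa using Int.fract_lt_one t⟩
    simp only [e, e2]
    conv_lhs => rw [← Int.self_sub_floor t]
    rw [sub_smul, ← Int.self_sub_floor t]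
    abel

lemma Chart.meet (χ : Chart γ) {a b : ℝ × ℝ} (Pa : Path a b) {M K : ℤ} (hb : b = a + ((M : ℝ), (K : ℝ)))
    (hK : K ≠ 0) (j : ℤ) : ∃ x ∈ range Pa, ∃ n : ℤ, x ∈ χ.Gam (j + n * K) := by
  obtain ⟨β, hβ, pβ, fβ⟩ := periodic_ext Pa.extend Pa.continuous_extend ((M : ℝ), (K : ℝ)) (by simp [hb])
  let cx : ℝ × ℝ → ℂ := fun x => x.1 + x.2 * Complex.I
  have hcx : Continuous cx := by fun_prop
  have cinj : ∀ x y, cx x = cx y → x = y := by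
    intro x y h
    have h1 := congrArg Complex.re h
    have h2 := congrArg Complex.im h
    simp [cx] at h1 h2
    exact Prod.ext h1 h2
  obtain ⟨s, t, hst⟩ := curves_meet (α := fun s => cx (χ.g s + (0, (j : ℝ)))) (β := fun t => cx (β t))
    (m := χ.m) (M := M) (K := K)
    (hcx.comp (χ.gcont.add continuous_const)) (hcx.comp hβ) (by exact_mod_cast χ.m0) (by exact_mod_cast hK)
    (by intro s; simp only [χ.per, cx]; simp; ring)
    (by intro s; simp only [pβ, cx]; simp; ring)
  have h := cinj _ _ hst
  obtain ⟨t0, ht0, n, hn⟩ := fβ t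
  refine ⟨Pa.extend t0, ?_, -n, s, -n * M, ?_⟩
  · rw [← Path.extend_range]; exact ⟨t0, rfl⟩
  · rw [hn] at h
    rw [← sub_eq_iff_eq_add] at h
    rw [← h]
    refine Prod.ext ?_ ?_ <;> simp <;> ring

lemma Chart.joined_zero (χ : Chart γ) {a : ℝ × ℝ} {M K : ℤ}
    (h : JoinedIn {x | χ.p x ∉ range γ} a (a + ((M : ℝ), (K : ℝ)))) : K = 0 := by
  by_contra hK
  obtain ⟨x, ⟨t, rfl⟩, n, hx⟩ := χ.meet h.somePath rfl hK 0
  exact h.somePath_mem t (χ.gam_range hx)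

lemma Chart.near (χ : Chart γ) (hinj : Function.Injective γ) {a b : ℝ × ℝ} (Pa : Path a b) {j k : ℤ}
    (ha : a ∈ χ.Gam j) (hb : b ∈ χ.Gam k) (hab : χ.p a = χ.p b)
    (hPa : ∀ x ∈ range Pa, x = a ∨ x = b ∨ χ.p x ∉ range γ) : |k - j| ≤ 1 := by
  obtain ⟨M, K, h⟩ := (χ.eq_iff a b).mp hab
  have hk : k = j + K := χ.gam_unique hinj hb (h ▸ χ.gam_shift ha M K)
  by_cases hK : K = 0
  · simp [hk, hK]
  · obtain ⟨x, hx, n, hg⟩ := χ.meet Pa h hK (j + 1)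
    have : K ∣ 1 := by
      rcases hPa x hx with rfl | rfl | h
      · have := χ.gam_unique hinj ha hg
        exact ⟨-n, by linarith⟩
      · have := χ.gam_unique hinj hb hg
        exact ⟨1 - n, by linarith⟩
      · exact absurd (χ.gam_range hg) h
    have h1 := Int.isUnit_iff.mp (isUnit_of_dvd_one this)
    rcases h1 with h1 | h1 <;> simp [hk, h1]

def qq (x : ℝ × ℝ) : ℝ × ℝ :=
  ((Complex.exp (x.2 + x.1 * (2 * Real.pi * Complex.I))).re, (Complex.exp (x.2 + x.1 * (2 * Real.pi * Complex.I))).im)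

lemma qq_cont : Continuous qq := by unfold qq; fun_prop

lemma qq_eq {x y : ℝ × ℝ} : qq x = qq y ↔ ∃ i : ℤ, y = x + ((i : ℝ), 0) := by
  have h1 : qq x = qq y ↔ Complex.exp (y.2 + y.1 * (2 * Real.pi * Complex.I)) =
      Complex.exp (x.2 + x.1 * (2 * Real.pi * Complex.I)) := by
    simp only [qq, Prod.mk.injEq]
    rw [← Complex.ext_iff, eq_comm]
  rw [h1, Complex.exp_eq_exp_iff_exists_int]
  constructor
  · rintro ⟨n, hn⟩
    have hr := congrArg Complex.re hn
    have hi := congrArg Complex.im hn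
    simp at hr hi
    refine ⟨n, Prod.ext ?_ ?_⟩
    · have hpi := Real.pi_pos
      have : (2 * Real.pi) * y.1 = (2 * Real.pi) * (x.1 + n) := by linarith
      exact mul_left_cancel₀ (by positivity) this
    · simpa using hr
  · rintro ⟨n, rfl⟩
    refine ⟨n, ?_⟩
    push_cast [Prod.fst_add, Prod.snd_add]; simp; ring

end Tor2
end RepProof

namespace RepProof
open scoped Classical

section Tor3

variable {γ : C(Circle1, Torus)}

lemma Chart.lift_joined (χ : Chart γ) {x : ℝ × ℝ} {b : Torus} (h : JoinedIn (range γ)ᶜ (χ.p x) b) :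
    ∃ y, χ.p y = b ∧ JoinedIn {x | χ.p x ∉ range γ} x y := by
  let f : C(ℝ, Torus) := ⟨h.somePath.extend, h.somePath.continuous_extend⟩
  obtain ⟨g, g0, hg⟩ := χ.lift f x (by simp [f])
  refine ⟨g 1, by rw [hg]; simp [f], ?_⟩
  refine JoinedIn.ofLine (f := g) g.continuous.continuousOn g0 rfl ?_
  rintro _ ⟨t, ht, rfl⟩
  show χ.p (g t) ∉ range γ
  rw [hg]
  have : h.somePath.extend t ∈ range h.somePath := by rw [← Path.extend_range]; exact ⟨t, rfl⟩
  obtain ⟨t', e⟩ := this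
  show h.somePath.extend t ∉ range γ
  rw [← e]; exact h.somePath_mem t'

lemma Chart.gam_qq (χ : Chart γ) (k : ℤ) :
    qq '' χ.Gam k = (fun t => qq (χ.g t + (0, (k : ℝ)))) '' Icc (0 : ℝ) 1 := by
  ext z
  constructor
  · rintro ⟨_, ⟨t, i, rfl⟩, rfl⟩
    refine ⟨Int.fract t, ⟨Int.fract_nonneg t, (Int.fract_lt_one t).le⟩, ?_⟩
    show qq _ = qq _
    rw [qq_eq]
    refine ⟨i + ⌊t⌋ * χ.m, ?_⟩
    have h := χ.per_int (Int.fract t) ⌊t⌋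
    rw [Int.fract_add_floor] at h
    rw [h]
    refine Prod.ext ?_ ?_
    · simp; ring
    · simp
  · rintro ⟨t, -, rfl⟩
    exact ⟨_, ⟨t, 0, rfl⟩, by simp⟩

lemma Chart.gam_compact (χ : Chart γ) (k : ℤ) : IsCompact (qq '' χ.Gam k) := by
  rw [χ.gam_qq]
  exact isCompact_Icc.image (qq_cont.comp (χ.gcont.add continuous_const))

lemma Chart.gam_conn (χ : Chart γ) (k : ℤ) : IsConnected (qq '' χ.Gam k) := by
  rw [χ.gam_qq]
  exact (isConnected_Icc zero_le_one).image _ (qq_cont.comp (χ.gcont.add continuous_const)).continuousOn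

theorem thmT {V Ed : Type} [Fintype V] [Fintype Ed] (u : V) (vm : V → Torus)
    (vinj : Function.Injective vm) (s t : Ed → V) (P : Ed → C(ℝ, Torus))
    (P0 : ∀ e, P e 0 = vm (s e)) (P1 : ∀ e, P e 1 = vm (t e)) (su : ∀ e, s e ≠ u)
    (Pv : ∀ e, ∀ x ∈ Ioo (0 : ℝ) 1, ∀ v, P e x ≠ vm v)
    (Pi : ∀ e f, ∀ x ∈ Ioo (0 : ℝ) 1, ∀ y ∈ Ioo (0 : ℝ) 1, P e x = P f y → e = f ∧ x = y)
    (hinj : Function.Injective γ) (hnn : ¬ NullHomotopic γ)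
    (hu : vm u ∈ range γ) (hv : ∀ v, v ≠ u → vm v ∉ range γ)
    (Pg : ∀ e, ∀ x ∈ Ioo (0 : ℝ) 1, P e x ∉ range γ) :
    ∃ N1 : Ed → Option V, (∀ e, N1 e = some (t e) ∨ (t e = u ∧ N1 e = none)) ∧
      ∀ H : SimpleGraph (Option V), (∀ x y, H.Adj x y →
        ∃ e, (x = some (s e) ∧ y = N1 e) ∨ (x = N1 e ∧ y = some (s e))) →
        ∃ (ι : Type) (_ : Fintype ι) (F : ι → Chn (Option V)), IsMac H F := by
  obtain ⟨χ⟩ := exists_chart γ hnn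
  set X : Set (ℝ × ℝ) := {x | χ.p x ∉ range γ} with hX
  let J : V → V → Prop := fun v w => JoinedIn (range γ)ᶜ (vm v) (vm w)
  have Jr : ∀ v, v ≠ u → J v v := fun v h => JoinedIn.refl (hv v h)
  have Js : ∀ {v w}, J v w → J w v := fun h => h.symm
  have Jt : ∀ {v w z}, J v w → J w z → J v z := fun h h' => JoinedIn.trans h h'
  have Jeq : ∀ {v w}, J v w → J v = J w := by
    intro v w h
    funext z
    exact propext ⟨fun h' => Jt (Js h) h', fun h' => Jt h h'⟩
  let x0 : V → ℝ × ℝ := fun v => (χ.surj (vm v)).choose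
  have hx0 : ∀ v, χ.p (x0 v) = vm v := fun v => (χ.surj (vm v)).choose_spec
  have hne : Nonempty V := ⟨u⟩
  let rep : V → V := fun v => Classical.epsilon (J v)
  have hrep : ∀ v, v ≠ u → J v (rep v) := fun v h => Classical.epsilon_spec (p := J v) ⟨v, Jr v h⟩
  have hrepeq : ∀ {v w}, J v w → rep v = rep w := by
    intro v w h
    show Classical.epsilon (J v) = Classical.epsilon (J w)
    rw [Jeq h]
  have hex : ∀ v, v ≠ u → ∃ y, χ.p y = vm v ∧ JoinedIn X (x0 (rep v)) y := by
    intro v h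
    apply χ.lift_joined
    rw [hx0]
    exact (hrep v h).symm
  let xh : V → ℝ × ℝ := fun v => if h : v ≠ u then (hex v h).choose else 0
  have hxh : ∀ v, v ≠ u → χ.p (xh v) = vm v ∧ JoinedIn X (x0 (rep v)) (xh v) := by
    intro v h
    have : xh v = (hex v h).choose := by simp [xh, h]
    rw [this]; exact (hex v h).choose_spec
  have hJ : ∀ v w, v ≠ u → w ≠ u → J v w → JoinedIn X (xh v) (xh w) := by
    intro v w h1 h2 h
    have h3 := (hxh w h2).2
    rw [← hrepeq h] at h3
    exact (hxh v h1).2.symm.trans h3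
  have hQ : ∀ e, ∃ g : C(ℝ, ℝ × ℝ), g 0 = xh (s e) ∧ ∀ t, χ.p (g t) = P e t := fun e =>
    χ.lift (P e) (xh (s e)) (by rw [P0]; exact (hxh _ (su e)).1)
  choose Q Q0 hQp using hQ
  have hPico : ∀ e, ∀ x ∈ Ico (0 : ℝ) 1, P e x ∉ range γ := by
    intro e x hx
    rcases eq_or_lt_of_le hx.1 with rfl | h
    · rw [P0]; exact hv _ (su e)
    · exact Pg e x ⟨h, hx.2⟩
  have hJst : ∀ e, t e ≠ u → J (s e) (t e) := by
    intro e h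
    refine JoinedIn.ofLine (f := P e) (P e).continuous.continuousOn (P0 e) (P1 e) ?_
    rintro _ ⟨x, hx, rfl⟩
    rcases eq_or_lt_of_le hx.2 with rfl | h'
    · show P e 1 ∉ _
      rw [P1]; exact hv _ h
    · exact hPico e x ⟨hx.1, h'⟩
  have hQX : ∀ e, t e ≠ u → JoinedIn X (xh (s e)) (Q e 1) := by
    intro e h
    refine JoinedIn.ofLine (f := Q e) (Q e).continuous.continuousOn (Q0 e) rfl ?_
    rintro _ ⟨x, hx, rfl⟩
    show χ.p _ ∉ _
    rw [hQp]
    rcases eq_or_lt_of_le hx.2 with rfl | h'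
    · rw [P1]; exact hv _ h
    · exact hPico e x ⟨hx.1, h'⟩
  have hend : ∀ e, t e ≠ u → ∃ M : ℤ, Q e 1 = xh (t e) + ((M : ℝ), 0) := by
    intro e h
    have h1 : χ.p (xh (t e)) = χ.p (Q e 1) := by rw [(hxh _ h).1, hQp, P1]
    obtain ⟨M, K, hMK⟩ := (χ.eq_iff _ _).mp h1
    have h2 : JoinedIn X (xh (t e)) (Q e 1) := (hJ _ _ (su e) h (hJst e h)).symm.trans (hQX e h)
    rw [hMK] at h2
    have h3 := χ.joined_zero h2
    refine ⟨M, ?_⟩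
    rw [hMK, h3]; simp
  have hk : ∀ e, ∃ k : ℤ, t e = u → Q e 1 ∈ χ.Gam k := by
    intro e
    by_cases h : t e = u
    · obtain ⟨k, hk⟩ := χ.range_gam (x := Q e 1) (by rw [hQp, P1, h]; exact hu)
      exact ⟨k, fun _ => hk⟩
    · exact ⟨0, fun h' => absurd h' h⟩
  choose k hk using hk
  have hnear : ∀ e f, t e = u → t f = u → J (s e) (s f) → |k f - k e| ≤ 1 := by
    intro e f he hf hJJ
    let A : ∀ e, Path (xh (s e)) (Q e 1) := fun e =>
      { toFun := fun x => Q e x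
        continuous_toFun := by fun_prop
        source' := by simp [Q0]
        target' := by simp }
    have hA : ∀ e, ∀ x ∈ range (A e), x = Q e 1 ∨ χ.p x ∉ range γ := by
      rintro e _ ⟨x, rfl⟩
      show Q e x = Q e 1 ∨ χ.p (Q e x) ∉ range γ
      rcases eq_or_lt_of_le x.2.2 with h | h
      · left; rw [h]
      · right; rw [hQp]; exact hPico e x ⟨x.2.1, h⟩
    have hB := hJ _ _ (su e) (su f) hJJ
    refine χ.near hinj ((A e).symm.trans (hB.somePath.trans (A f))) (hk e he) (hk f hf)
      (by rw [hQp, hQp, P1, P1, he, hf]) ?_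
    intro x hx
    rw [Path.trans_range, Path.trans_range, Path.symm_range] at hx
    rcases hx with hx | hx | hx
    · rcases hA e x hx with h | h
      · exact Or.inl h
      · exact Or.inr (Or.inr h)
    · obtain ⟨y, rfl⟩ := hx
      exact Or.inr (Or.inr (hB.somePath_mem y))
    · rcases hA f x hx with h | h
      · exact Or.inr (Or.inl h)
      · exact Or.inr (Or.inr h)
  let S : V → Set ℤ := fun v => {m | ∃ e, t e = u ∧ J v (s e) ∧ k e = m}
  let h : V → ℤ := fun v => sInf (S v)
  have hh : ∀ {v w}, J v w → h v = h w := by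
    intro v w h
    show sInf (S v) = sInf (S w)
    simp only [S, Jeq h]
  have hk01 : ∀ e, t e = u → k e = h (s e) ∨ k e = h (s e) + 1 := by
    intro e he
    have hm : k e ∈ S (s e) := ⟨e, he, Jr _ (su e), rfl⟩
    have hb : BddBelow (S (s e)) := by
      refine ⟨k e - 1, ?_⟩
      rintro _ ⟨f, hf, hj, rfl⟩
      have := abs_le.mp (hnear e f he hf hj)
      linarith [this.1]
    have h1 : h (s e) ≤ k e := csInf_le hb hm
    obtain ⟨f, hf, hj, hkf⟩ := Int.csInf_mem ⟨_, hm⟩ hb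
    have h2 := abs_le.mp (hnear e f he hf hj)
    have h3 : k f = h (s e) := hkf
    omega
  let N1 : Ed → Option V := fun e => if t e = u then (if k e = h (s e) then some u else none) else some (t e)
  refine ⟨N1, ?_, ?_⟩
  · intro e
    by_cases he : t e = u
    · by_cases hke : k e = h (s e)
      · left; simp [N1, he, hke]
      · right; exact ⟨he, by simp [N1, he, hke]⟩
    · left; simp [N1, he]
  intro H hH
  let sh : V → ℝ × ℝ := fun v => (((0 : ℤ) : ℝ), ((-h v : ℤ) : ℝ))
  have psh : ∀ x v, χ.p (x + sh v) = χ.p x := fun x v => χ.p_add x 0 (-h v)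
  let C : Option V → Set (ℝ × ℝ) := fun o => match o with
    | none => qq '' χ.Gam 1
    | some v => if v = u then qq '' χ.Gam 0 else {qq (xh v + sh v)}
  have Cu : C (some u) = qq '' χ.Gam 0 := by simp [C]
  have Cv : ∀ v, v ≠ u → C (some v) = {qq (xh v + sh v)} := by intro v hvu; simp [C, hvu]
  have Cn : C none = qq '' χ.Gam 1 := rfl
  have qp : ∀ {x y}, qq x = qq y → χ.p x = χ.p y := by
    intro x y hxy
    obtain ⟨i, rfl⟩ := qq_eq.mp hxy
    have := χ.p_add x i 0
    rw [Int.cast_zero] at this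
    exact this.symm
  have qg : ∀ {x y : ℝ × ℝ} {a b : ℤ}, x ∈ χ.Gam a → y ∈ χ.Gam b → qq x = qq y → a = b := by
    intro x y a b hx hy hxy
    obtain ⟨i, rfl⟩ := qq_eq.mp hxy
    have h1 := χ.gam_shift hx i 0
    rw [Int.cast_zero, add_zero] at h1
    exact χ.gam_unique hinj h1 hy
  refine planar_paths (C := C) (P := fun e x => qq (Q e x + sh (s e))) (s := fun e => some (s e)) (t := N1)
    ?_ ?_ ?_ ?_ ?_ ?_ ?_ ?_ H ?_
  · rintro (_ | v)
    · exact χ.gam_compact 1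
    · by_cases hvu : v = u
      · rw [hvu, Cu]; exact χ.gam_compact 0
      · rw [Cv v hvu]; exact isCompact_singleton
  · rintro (_ | v)
    · exact χ.gam_conn 1
    · by_cases hvu : v = u
      · rw [hvu, Cu]; exact χ.gam_conn 0
      · rw [Cv v hvu]; exact isConnected_singleton
  · have mix : ∀ v a x, v ≠ u → x ∈ C (some v) → x ∈ qq '' χ.Gam a → False := by
      intro v a x hvu h1 ⟨y, hy, hyx⟩
      rw [Cv v hvu] at h1
      have h2 := qp (hyx.trans h1)
      rw [psh, (hxh v hvu).1] at h2
      exact hv v hvu (h2 ▸ χ.gam_range hy)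
    have g01 : ∀ x, x ∈ qq '' χ.Gam 0 → x ∈ qq '' χ.Gam 1 → False := by
      rintro _ ⟨y, hy, rfl⟩ ⟨z, hz, hzy⟩
      have := qg hy hz hzy.symm
      omega
    rintro (_ | v) (_ | w) x hx hy
    · rfl
    · by_cases hw : w = u
      · rw [hw, Cu] at hy; exact (g01 _ hy hx).elim
      · exact (mix w 1 x hw hy hx).elim
    · by_cases hw : v = u
      · rw [hw, Cu] at hx; exact (g01 _ hx hy).elim
      · exact (mix v 1 x hw hx hy).elim
    · by_cases hvu : v = u
      · by_cases hw : w = u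
        · rw [hvu, hw]
        · rw [hvu, Cu] at hx; exact (mix w 0 x hw hy hx).elim
      · by_cases hw : w = u
        · rw [hw, Cu] at hy; exact (mix v 0 x hvu hx hy).elim
        · rw [Cv v hvu] at hx
          rw [Cv w hw] at hy
          have h2 := qp (hx.symm.trans hy)
          rw [psh, psh, (hxh v hvu).1, (hxh w hw).1] at h2
          rw [vinj h2]
  · intro e
    exact qq_cont.comp ((Q e).continuous.add continuous_const)
  · intro e
    rw [Cv _ (su e)]
    show qq _ = _
    rw [Q0]
  · intro e
    show qq (Q e 1 + sh (s e)) ∈ C (N1 e)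
    by_cases he : t e = u
    · have hg := χ.gam_shift (hk e he) 0 (-h (s e))
      by_cases hke : k e = h (s e)
      · have : N1 e = some u := by simp [N1, he, hke]
        rw [this, Cu]
        rw [hke, add_neg_cancel] at hg
        exact ⟨_, hg, rfl⟩
      · have : N1 e = none := by simp [N1, he, hke]
        rw [this, Cn]
        have h1 : k e + -h (s e) = 1 := by have := hk01 e he; omega
        rw [h1] at hg
        exact ⟨_, hg, rfl⟩
    · have : N1 e = some (t e) := by simp [N1, he]
      rw [this, Cv _ he]
      obtain ⟨M, hM⟩ := hend e he
      show qq _ = qq _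
      symm
      rw [qq_eq]
      refine ⟨M, ?_⟩
      have : sh (s e) = sh (t e) := by simp only [sh, hh (hJst e he)]
      rw [hM, this]; abel
  · rintro e x hx w hw
    have hp : ∀ y, qq (Q e x + sh (s e)) = qq y → P e x = χ.p y := by
      intro y hy
      have := qp hy
      rwa [psh, hQp] at this
    have hG : ∀ a, qq (Q e x + sh (s e)) ∈ qq '' χ.Gam a → False := by
      rintro a ⟨y, hy, hyx⟩
      exact Pg e x hx (hp y hyx.symm ▸ χ.gam_range hy)
    rcases w with _ | v
    · exact hG 1 hw
    · by_cases hvu : v = u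
      · rw [hvu, Cu] at hw; exact hG 0 hw
      · rw [Cv v hvu] at hw
        have := hp _ hw
        rw [psh, (hxh v hvu).1] at this
        exact Pv e x hx v this
  · intro e f x hx y hy hxy
    have := qp hxy
    rw [psh, psh, hQp, hQp] at this
    exact Pi e f x hx y hy this
  · intro x y hxy
    obtain ⟨e, he⟩ := hH x y hxy
    exact ⟨e, by tauto⟩

end Tor3
end RepProof

namespace RepProof
open scoped Classical

section Arcs
open Filter

lemma end_limit {S : Type} [TopologicalSpace S] [T2Space S] [CompactSpace S] (f : ℝ → S) (a b : S)
    (hf : ContinuousOn f (Ioo 0 1))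
    (hcl : ∀ x, MapClusterPt x (𝓝[>] (0 : ℝ)) f → x = a ∨ x = b) :
    Tendsto f (𝓝[>] 0) (𝓝 a) ∨ Tendsto f (𝓝[>] 0) (𝓝 b) := by
  by_cases hab : a = b
  · subst hab
    left
    exact le_nhds_of_unique_clusterPt (fun y hy => by simpa using hcl y hy)
  obtain ⟨U, W, oU, oW, aU, bW, dUW⟩ := t2_separation hab
  have ev : ∀ᶠ x in 𝓝[>] (0 : ℝ), f x ∈ U ∪ W := by
    have hle : Tendsto f (𝓝[>] (0:ℝ)) (𝓝ˢ {a, b}) :=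
      isCompact_univ.tendsto_nhdsSet_of_mapClusterPt (by simp) (fun x _ h => by simpa using hcl x h)
    exact hle ((oU.union oW).mem_nhdsSet.mpr (by rintro x (rfl | rfl); exacts [Or.inl aU, Or.inr bW]))
  obtain ⟨ε, hε, hsub⟩ := (mem_nhdsGT_iff_exists_Ioo_subset' (show (0:ℝ) < 1 by norm_num)).mp ev
  have hε0 : (0:ℝ) < min ε 1 := lt_min hε one_pos
  have hpre : IsPreconnected (f '' Ioo 0 (min ε 1)) :=
    isPreconnected_Ioo.image f (hf.mono (Ioo_subset_Ioo_right (min_le_right _ _)))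
  have hin : f '' Ioo 0 (min ε 1) ⊆ U ∪ W := by
    rintro _ ⟨x, hx, rfl⟩
    exact hsub ⟨hx.1, hx.2.trans_le (min_le_left _ _)⟩
  have hmem : Ioo 0 (min ε 1) ∈ 𝓝[>] (0:ℝ) := Ioo_mem_nhdsGT hε0
  rcases (isPreconnected_iff_subset_of_disjoint.mp hpre) U W oU oW hin (by rw [dUW.inter_eq, inter_empty]) with h | h
  · left
    refine le_nhds_of_unique_clusterPt (fun y hy => ?_)
    rcases hcl y hy with rfl | rfl
    · rfl
    · exfalso
      have := (mapClusterPt_iff_frequently.mp hy) W (oW.mem_nhds bW)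
      obtain ⟨x, h1, h2⟩ := (this.and_eventually hmem).exists
      exact dUW.le_bot ⟨h ⟨x, h2, rfl⟩, h1⟩
  · right
    refine le_nhds_of_unique_clusterPt (fun y hy => ?_)
    rcases hcl y hy with rfl | rfl
    · exfalso
      have := (mapClusterPt_iff_frequently.mp hy) U (oU.mem_nhds aU)
      obtain ⟨x, h1, h2⟩ := (this.and_eventually hmem).exists
      exact dUW.le_bot ⟨h1, h ⟨x, h2, rfl⟩⟩
    · rfl

lemma cluster_end {S : Type} [TopologicalSpace S] {A : Set S} (h : Ioo (0:ℝ) 1 ≃ₜ A) (f : ℝ → S)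
    (hfh : ∀ x : Ioo (0:ℝ) 1, f x = h x) (a b : S) (hcl : closure A = A ∪ {a, b}) :
    ∀ x, MapClusterPt x (𝓝[>] (0 : ℝ)) f → x = a ∨ x = b := by
  intro x hx
  have hf := mapClusterPt_iff_frequently.mp hx
  have hmem : ∀ ε > 0, Ioo 0 ε ∈ 𝓝[>] (0:ℝ) := fun ε hε => Ioo_mem_nhdsGT hε
  have hxA : x ∈ closure A := by
    rw [mem_closure_iff_nhds]
    intro N hN
    obtain ⟨z, h1, h2⟩ := ((hf N hN).and_eventually (hmem 1 one_pos)).exists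
    refine ⟨f z, h1, ?_⟩
    rw [hfh ⟨z, h2⟩]; exact (h _).2
  rw [hcl] at hxA
  rcases hxA with hxA | hxA
  · exfalso
    set y := h.symm ⟨x, hxA⟩ with hy
    have hy0 : (0:ℝ) < y := y.2.1
    have hopen : IsOpen (h '' {z : Ioo (0:ℝ) 1 | (y:ℝ) / 2 < z}) :=
      h.isOpenMap _ (isOpen_lt continuous_const continuous_subtype_val)
    obtain ⟨O, oO, hO⟩ := isOpen_induced_iff.mp hopen
    have hxO : x ∈ O := by
      have : (⟨x, hxA⟩ : A) ∈ Subtype.val ⁻¹' O := by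
        rw [hO]
        exact ⟨y, by show (y:ℝ) / 2 < y; linarith, by simp [hy]⟩
      exact this
    obtain ⟨z, h1, h2⟩ := ((hf O (oO.mem_nhds hxO)).and_eventually (hmem (min (y / 2) 1) (lt_min (by linarith) one_pos))).exists
    have hz1 : z ∈ Ioo (0:ℝ) 1 := ⟨h2.1, h2.2.trans_le (min_le_right _ _)⟩
    rw [hfh ⟨z, hz1⟩] at h1
    have h3 : h ⟨z, hz1⟩ ∈ Subtype.val ⁻¹' O := h1
    rw [hO] at h3
    obtain ⟨w, hw, hwz⟩ := h3
    have := h.injective hwz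
    rw [this] at hw
    have h4 : (y:ℝ) / 2 < z := hw
    linarith [h2.2, min_le_left ((y:ℝ) / 2) 1]
  · simpa using hxA

lemma arc_path {S : Type} [TopologicalSpace S] [T2Space S] [CompactSpace S] {A : Set S} (hA : IsArc A)
    {a b : S} (hab : a ≠ b) (ha : a ∉ A) (hb : b ∉ A) (hcl : closure A = A ∪ {a, b}) :
    ∃ P : C(ℝ, S), P 0 = a ∧ P 1 = b ∧ InjOn P (Ioo 0 1) ∧ ∀ x ∈ Ioo (0:ℝ) 1, P x ∈ A := by
  obtain ⟨h⟩ := hA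
  let f : ℝ → S := fun x => if hx : x ∈ Ioo (0:ℝ) 1 then h ⟨x, hx⟩ else a
  have hfh : ∀ x : Ioo (0:ℝ) 1, f x = h x := by intro x; simp only [f, x.2, dite_true]
  have hf : ContinuousOn f (Ioo 0 1) := by
    rw [continuousOn_iff_continuous_domRestrict]
    have : (Ioo (0:ℝ) 1).domRestrict f = fun x => (h x : S) := by funext x; exact hfh x
    rw [this]
    exact continuous_subtype_val.comp h.continuous
  have finj : InjOn f (Ioo 0 1) := by
    intro x hx y hy hxy
    rw [hfh ⟨x, hx⟩, hfh ⟨y, hy⟩] at hxy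
    have := h.injective (Subtype.ext hxy)
    exact congrArg Subtype.val this
  have fA : ∀ x ∈ Ioo (0:ℝ) 1, f x ∈ A := by
    intro x hx; rw [hfh ⟨x, hx⟩]; exact (h _).2
  have fsurj : ∀ y ∈ A, ∃ x ∈ Ioo (0:ℝ) 1, f x = y := by
    intro y hy
    refine ⟨h.symm ⟨y, hy⟩, (h.symm ⟨y, hy⟩).2, ?_⟩
    rw [hfh]; simp
  have l0 := end_limit f a b hf (cluster_end h f hfh a b hcl)
  let σ : Ioo (0:ℝ) 1 ≃ₜ Ioo (0:ℝ) 1 :=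
    { toFun := fun x => ⟨1 - x, by linarith [x.2.2], by linarith [x.2.1]⟩
      invFun := fun x => ⟨1 - x, by linarith [x.2.2], by linarith [x.2.1]⟩
      left_inv := fun x => by ext; simp
      right_inv := fun x => by ext; simp
      continuous_toFun := by fun_prop
      continuous_invFun := by fun_prop }
  have hmap : MapsTo (fun x : ℝ => 1 - x) (Ioo 0 1) (Ioo 0 1) := by
    intro x hx
    exact ⟨by linarith [hx.2], by linarith [hx.1]⟩
  have l1' := end_limit (fun x => f (1 - x)) a b (hf.comp (by fun_prop) hmap)
    (cluster_end (σ.trans h) _ (fun x => hfh (σ x)) a b hcl)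
  have tr : ∀ c, Tendsto (fun x => f (1 - x)) (𝓝[>] 0) (𝓝 c) → Tendsto f (𝓝[<] 1) (𝓝 c) := by
    intro c hc
    have h1 : Tendsto (fun x : ℝ => 1 - x) (𝓝[<] 1) (𝓝[>] 0) := by
      refine tendsto_nhdsWithin_iff.mpr ⟨?_, ?_⟩
      · have : Tendsto (fun x : ℝ => 1 - x) (𝓝 1) (𝓝 (1 - 1)) := (continuous_const.sub continuous_id).tendsto 1
        rw [sub_self] at this
        exact this.mono_left nhdsWithin_le_nhds
      · filter_upwards [self_mem_nhdsWithin] with x hx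
        have : x < 1 := hx
        show (0:ℝ) < 1 - x
        linarith
    have := hc.comp h1
    simpa [Function.comp_def] using this
  have key : ∀ c d, Tendsto f (𝓝[>] 0) (𝓝 c) → Tendsto f (𝓝[<] 1) (𝓝 d) →
      ∃ P : C(ℝ, S), P 0 = c ∧ P 1 = d ∧ ∀ x ∈ Ioo (0:ℝ) 1, P x = f x := by
    intro c d hc hd
    have hco := continuousOn_Icc_extendFrom_Ioo hf hc hd
    refine ⟨⟨IccExtend zero_le_one ((Icc (0:ℝ) 1).domRestrict (extendFrom (Ioo 0 1) f)),
      (continuousOn_iff_continuous_domRestrict.mp hco).Icc_extend'⟩, ?_, ?_, ?_⟩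
    · show IccExtend (zero_le_one (α := ℝ)) ((Icc (0:ℝ) 1).domRestrict (extendFrom (Ioo 0 1) f)) _ = _
      rw [IccExtend_of_mem _ _ (by simp : (0:ℝ) ∈ Icc (0:ℝ) 1)]
      exact eq_lim_at_left_extendFrom_Ioo one_pos hc
    · show IccExtend (zero_le_one (α := ℝ)) ((Icc (0:ℝ) 1).domRestrict (extendFrom (Ioo 0 1) f)) _ = _
      rw [IccExtend_of_mem _ _ (by simp : (1:ℝ) ∈ Icc (0:ℝ) 1)]
      exact eq_lim_at_right_extendFrom_Ioo one_pos hd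
    · intro x hx
      show IccExtend (zero_le_one (α := ℝ)) ((Icc (0:ℝ) 1).domRestrict (extendFrom (Ioo 0 1) f)) _ = _
      rw [IccExtend_of_mem _ _ (Ioo_subset_Icc_self hx)]
      exact extendFrom_eq (subset_closure hx) (hf x hx)
  have nosame : ∀ c d, Tendsto f (𝓝[>] 0) (𝓝 c) → Tendsto f (𝓝[<] 1) (𝓝 d) → ∀ z, z ∈ ({a, b} : Set S) → z ∉ A →
      z = c ∨ z = d := by
    intro c d hc hd z hz hzA
    obtain ⟨P, P0, P1, hP⟩ := key c d hc hd
    have hK : IsClosed (P '' Icc 0 1) := (isCompact_Icc.image P.continuous).isClosed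
    have hsub : A ⊆ P '' Icc 0 1 := by
      intro y hy
      obtain ⟨x, hx, rfl⟩ := fsurj y hy
      exact ⟨x, Ioo_subset_Icc_self hx, hP x hx⟩
    have hzc : z ∈ closure A := by rw [hcl]; exact Or.inr hz
    obtain ⟨x, hx, hxz⟩ := closure_minimal hsub hK hzc
    rcases eq_or_lt_of_le hx.1 with h0 | h0
    · left; rw [← hxz, ← h0, P0]
    · rcases eq_or_lt_of_le hx.2 with h1 | h1
      · right; rw [← hxz, h1, P1]
      · exact absurd (hxz ▸ hP x ⟨h0, h1⟩ ▸ fA x ⟨h0, h1⟩) hzA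
  have fin : ∀ P : C(ℝ, S), (∀ x ∈ Ioo (0:ℝ) 1, P x = f x) → InjOn P (Ioo 0 1) ∧ ∀ x ∈ Ioo (0:ℝ) 1, P x ∈ A := by
    intro P hP
    refine ⟨fun x hx y hy hxy => finj hx hy (by rw [← hP x hx, ← hP y hy, hxy]), fun x hx => ?_⟩
    rw [hP x hx]; exact fA x hx
  rcases l0 with l0 | l0 <;> rcases l1' with l1 | l1
  · rcases nosame a a l0 (tr _ l1) b (by simp) hb with h | h <;> exact absurd h.symm hab
  · obtain ⟨P, P0, P1, hP⟩ := key a b l0 (tr _ l1)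
    exact ⟨P, P0, P1, fin P hP⟩
  · obtain ⟨P, P0, P1, hP⟩ := key b a l0 (tr _ l1)
    obtain ⟨h1, h2⟩ := fin P hP
    refine ⟨⟨fun x => P (1 - x), by fun_prop⟩, by simp [P1], by simp [P0], ?_, ?_⟩
    · intro x hx y hy hxy
      have := h1 (hmap hx) (hmap hy) hxy
      simp at this
      exact this
    · intro x hx
      exact h2 _ (hmap hx)
  · rcases nosame b b l0 (tr _ l1) a (by simp) ha with h | h <;> exact absurd h hab

end Arcs
end RepProof

namespace RepProof
open scoped Classical

section Fin1

variable {V : Type} [Fintype V] {G : SimpleGraph V}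

lemma noTri_of (htf : TriangleFree G) : NoTri G := by
  intro a b c hab hbc hac
  refine htf a (.cons hab (.cons hbc (.cons hac.symm .nil))) ?_ rfl
  have h1 := hab.ne
  have h2 := hbc.ne
  have h3 := hac.ne
  rw [SimpleGraph.Walk.cons_isCycle_iff]
  constructor
  · rw [SimpleGraph.Walk.isPath_def]
    simp [h2, h3.symm, h1.symm]
  · simp [h1, h2, h3, h1.symm, h2.symm, h3.symm]

lemma NoTri.of_hom {W : Type} {H : SimpleGraph W} (h : NoTri G) (ρ : W → V)
    (hρ : ∀ x y, H.Adj x y → G.Adj (ρ x) (ρ y)) : NoTri H :=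
  fun a b c hab hbc hac => h _ _ _ (hρ _ _ hab) (hρ _ _ hbc) (hρ _ _ hac)

lemma not_col (hcrit : FourCritical G) (φ : V → Fin 3) (hφ : ∀ a b, G.Adj a b → φ a ≠ φ b) : False := by
  have hc : G.Colorable 3 := ⟨SimpleGraph.Coloring.mk φ (fun {a b} h => hφ a b h)⟩
  have h1 := hc.chromaticNumber_le
  rw [hcrit.1] at h1
  exact absurd h1 (by decide)

lemma edge_paths (d : Drawing G Torus) (s t : G.edgeSet → V) (hst : ∀ e : G.edgeSet, (e : Sym2 V) = s(s e, t e)) :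
    ∃ P : G.edgeSet → C(ℝ, Torus), (∀ e, P e 0 = d.vmap (s e)) ∧ (∀ e, P e 1 = d.vmap (t e)) ∧
      (∀ e, InjOn (P e) (Ioo 0 1)) ∧ ∀ e, ∀ x ∈ Ioo (0:ℝ) 1, P e x ∈ d.emap e := by
  have : ∀ e, ∃ P : C(ℝ, Torus), P 0 = d.vmap (s e) ∧ P 1 = d.vmap (t e) ∧
      InjOn P (Ioo 0 1) ∧ ∀ x ∈ Ioo (0:ℝ) 1, P x ∈ d.emap e := by
    intro e
    have hadj : G.Adj (s e) (t e) := by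
      have := e.2
      rwa [hst e] at this
    exact arc_path (d.arc e) (fun h => hadj.ne (d.vinj h)) (d.vertex_notin e _) (d.vertex_notin e _)
      (d.closure_emap e _ _ (hst e))
  choose P h0 h1 h2 h3 using this
  exact ⟨P, h0, h1, h2, h3⟩

lemma paths_inj (d : Drawing G Torus) {P : G.edgeSet → C(ℝ, Torus)} (h2 : ∀ e, InjOn (P e) (Ioo 0 1))
    (h3 : ∀ e, ∀ x ∈ Ioo (0:ℝ) 1, P e x ∈ d.emap e) :
    ∀ e f, ∀ x ∈ Ioo (0 : ℝ) 1, ∀ y ∈ Ioo (0 : ℝ) 1, P e x = P f y → e = f ∧ x = y := by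
  intro e f x hx y hy hxy
  have hef : e = f := by
    by_contra hne
    have : P e x ∈ d.emap e ∩ d.emap f := ⟨h3 e x hx, hxy ▸ h3 f y hy⟩
    rw [d.edges_disj e f hne] at this
    exact this
  subst hef
  exact ⟨rfl, h2 e hx hy hxy⟩

/-- The curve meets the drawing exactly in one vertex. -/
lemma case_vertex (d : Drawing G Torus) (hcrit : FourCritical G) (htf : TriangleFree G)
    (γ : C(Circle1, Torus)) (hinj : Function.Injective γ) (hnn : ¬ NullHomotopic γ) (u : V)
    (hu : d.vmap u ∈ range γ) (honly : ∀ x ∈ range γ, x ∈ d.image → x = d.vmap u) : False := by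
  have hor : ∀ e : G.edgeSet, ∃ a b, (e : Sym2 V) = s(a, b) ∧ a ≠ u := by
    rintro ⟨e, he⟩
    induction e with
    | _ a b =>
      by_cases h : a = u
      · refine ⟨b, a, Sym2.eq_swap, ?_⟩
        rintro rfl
        exact G.ne_of_adj he h
      · exact ⟨a, b, rfl, h⟩
  choose s t hst hsu using hor
  obtain ⟨P, h0, h1, h2, h3⟩ := edge_paths d s t hst
  have hadj : ∀ e, G.Adj (s e) (t e) := by
    intro e
    have := e.2
    rwa [hst e] at this
  obtain ⟨N1, hN, hM⟩ := thmT (γ := γ) u d.vmap d.vinj s t P h0 h1 hsu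
    (fun e x hx v h => d.vertex_notin e v (h ▸ h3 e x hx)) (paths_inj d h2 h3) hinj hnn hu
    (fun v hv h => hv (d.vinj (honly _ h (Or.inl ⟨v, rfl⟩))))
    (fun e x hx h => d.vertex_notin e u
      (honly _ h (Or.inr (mem_iUnion.mpr ⟨e, h3 e x hx⟩)) ▸ h3 e x hx))
  let ρ : Option V → V := fun o => o.getD u
  have hρN : ∀ e, ρ (N1 e) = t e := by
    intro e
    rcases hN e with h | ⟨h, h'⟩
    · rw [h]; rfl
    · rw [h', h]; rfl
  have hadj' : ∀ x y, (∃ e, (x = some (s e) ∧ y = N1 e) ∨ (x = N1 e ∧ y = some (s e))) → G.Adj (ρ x) (ρ y) := by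
    rintro x y ⟨e, ⟨rfl, rfl⟩ | ⟨rfl, rfl⟩⟩
    · rw [hρN]; exact hadj e
    · rw [hρN]; exact (hadj e).symm
  let H : SimpleGraph (Option V) :=
    { Adj := fun x y => ∃ e, (x = some (s e) ∧ y = N1 e) ∨ (x = N1 e ∧ y = some (s e))
      symm := ⟨fun x y ⟨e, h⟩ => ⟨e, by tauto⟩⟩
      loopless := ⟨fun x h => (hadj' x x h).ne rfl⟩ }
  obtain ⟨ι, _, F, hF⟩ := hM H (fun x y h => h)
  obtain ⟨φ, hφ, hφu⟩ := thmP (v1 := some u) (v2 := none) (by simp) _ H F rfl hF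
    ((noTri_of htf).of_hom ρ hadj') (fun h => (hadj' _ _ h).ne rfl)
  have hcol : ∀ e, φ (some (s e)) ≠ φ (some (t e)) := by
    intro e
    have h := hφ (some (s e)) (N1 e) ⟨e, Or.inl ⟨rfl, rfl⟩⟩
    rcases hN e with h' | ⟨h', h''⟩
    · rwa [h'] at h
    · rw [h'', ← hφu] at h
      rwa [h']
  refine not_col hcrit (fun v => φ (some v)) (fun a b hab => ?_)
  have h := hst ⟨s(a, b), hab⟩
  have hc := hcol ⟨s(a, b), hab⟩
  rcases Sym2.eq_iff.mp h with ⟨h1, h2⟩ | ⟨h1, h2⟩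
  · rw [← h1, ← h2] at hc; exact hc
  · rw [← h1, ← h2] at hc; exact hc.symm

/-- The curve avoids all vertices and all edges but those in `D`. -/
lemma mac_of_avoid (d : Drawing G Torus)
    (γ : C(Circle1, Torus)) (hinj : Function.Injective γ) (hnn : ¬ NullHomotopic γ) (z : Torus)
    (hz : z ∈ range γ) (D : Set (Sym2 V)) (hv : ∀ v, d.vmap v ∉ range γ)
    (he : ∀ e : G.edgeSet, (e : Sym2 V) ∉ D → ∀ x ∈ d.emap e, x ∉ range γ)
    (H : SimpleGraph (Option (Option V)))
    (hH : ∀ x y, H.Adj x y → ∃ v w, x = some (some v) ∧ y = some (some w) ∧ G.Adj v w ∧ s(v, w) ∉ D) :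
    ∃ (ι : Type) (_ : Fintype ι) (F : ι → Chn (Option (Option V))), IsMac H F := by
  have hor : ∀ e : G.edgeSet, ∃ a b, (e : Sym2 V) = s(a, b) := by
    rintro ⟨e, he⟩
    induction e with
    | _ a b => exact ⟨a, b, rfl⟩
  choose s t hst using hor
  obtain ⟨P, h0, h1, h2, h3⟩ := edge_paths d s t hst
  let Ed := {e : G.edgeSet // (e : Sym2 V) ∉ D}
  haveI : Fintype Ed := Fintype.ofFinite _
  let vm : Option V → Torus := fun o => match o with
    | none => z
    | some v => d.vmap v
  have vminj : Function.Injective vm := by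
    rintro (_ | a) (_ | b) h
    · rfl
    · exact (hv b (show d.vmap b ∈ _ from (show z = d.vmap b from h) ▸ hz)).elim
    · exact (hv a (show d.vmap a ∈ _ from (show d.vmap a = z from h) ▸ hz)).elim
    · exact congrArg some (d.vinj h)
  have hPg : ∀ e : Ed, ∀ x ∈ Ioo (0 : ℝ) 1, P e.1 x ∉ range γ := fun e x hx =>
    he e.1 e.2 _ (h3 e.1 x hx)
  obtain ⟨N1, hN, hM⟩ := thmT (γ := γ) (none : Option V) vm vminj (fun e : Ed => some (s e.1))
    (fun e : Ed => some (t e.1)) (fun e => P e.1) (fun e => h0 e.1) (fun e => h1 e.1) (by simp)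
    (by
      rintro e x hx (_ | v) h
      · exact hPg e x hx (h ▸ hz)
      · exact d.vertex_notin e.1 v ((show P e.1 x = d.vmap v from h) ▸ h3 e.1 x hx))
    (fun e f x hx y hy h => by
      have := paths_inj d h2 h3 e.1 f.1 x hx y hy h
      exact ⟨Subtype.ext this.1, this.2⟩) hinj hnn hz
    (by
      rintro (_ | v) hne
      · exact absurd rfl hne
      · exact hv v) hPg
  refine hM H ?_
  intro x y hxy
  obtain ⟨v, w, rfl, rfl, hvw, hD⟩ := hH x y hxy
  let e : Ed := ⟨⟨s(v, w), hvw⟩, hD⟩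
  have hNe : N1 e = some (some (t e.1)) := by
    rcases hN e with h | ⟨h, -⟩
    · exact h
    · simp at h
  refine ⟨e, ?_⟩
  rw [hNe]
  rcases Sym2.eq_iff.mp (hst e.1) with ⟨h1, h2⟩ | ⟨h1, h2⟩
  · left; rw [h1, h2]; exact ⟨rfl, rfl⟩
  · right; rw [h1, h2]; exact ⟨rfl, rfl⟩

def avoidG (G : SimpleGraph V) (D : Set (Sym2 V)) : SimpleGraph (Option (Option V)) where
  Adj x y := ∃ v w, x = some (some v) ∧ y = some (some w) ∧ G.Adj v w ∧ s(v, w) ∉ D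
  symm := ⟨fun x y ⟨v, w, h1, h2, h3, h4⟩ => ⟨w, v, h2, h1, h3.symm, by rwa [Sym2.eq_swap]⟩⟩
  loopless := ⟨fun x ⟨v, w, h1, h2, h3, _⟩ => by
    rw [h1] at h2
    simp at h2
    exact h3.ne h2⟩

lemma case_empty (d : Drawing G Torus) (hcrit : FourCritical G) (htf : TriangleFree G)
    (γ : C(Circle1, Torus)) (hinj : Function.Injective γ) (hnn : ¬ NullHomotopic γ)
    (honly : ∀ x ∈ range γ, x ∉ d.image) : False := by
  obtain ⟨ι, _, F, hF⟩ := mac_of_avoid d γ hinj hnn (γ 0) ⟨0, rfl⟩ ∅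
    (fun v h => honly _ h (Or.inl ⟨v, rfl⟩))
    (fun e _ x hx h => honly _ h (Or.inr (mem_iUnion.mpr ⟨e, hx⟩))) (avoidG G ∅) (fun x y h => h)
  have hnt : NoTri (avoidG G ∅) := by
    rintro a b c ⟨v, w, rfl, rfl, h, -⟩ ⟨v', w', h1, rfl, h', -⟩ ⟨v'', w'', h2, h3, h'', -⟩
    simp at h1 h2 h3
    subst h1 h2 h3
    exact noTri_of htf _ _ _ h h' h''
  obtain ⟨φ, hφ, -⟩ := thmP (v1 := none) (v2 := some none) (by simp) _ (avoidG G ∅) F rfl hF hnt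
    (by rintro ⟨v, w, h, -⟩; simp at h)
  exact not_col hcrit (fun v => φ (some (some v))) (fun a b hab => hφ _ _ ⟨a, b, rfl, rfl, hab, by simp⟩)

lemma case_edge (d : Drawing G Torus) (hcrit : FourCritical G) (htf : TriangleFree G)
    (γ : C(Circle1, Torus)) (hinj : Function.Injective γ) (hnn : ¬ NullHomotopic γ) (e0 : G.edgeSet)
    (z : Torus) (hz : z ∈ d.emap e0) (hzγ : z ∈ range γ)
    (honly : ∀ x ∈ range γ, x ∈ d.image → x = z) : False := by
  obtain ⟨a, b, hab⟩ : ∃ a b, (e0 : Sym2 V) = s(a, b) := by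
    obtain ⟨e, he⟩ := e0
    induction e with
    | _ a b => exact ⟨a, b, rfl⟩
  have hadj : G.Adj a b := by
    have := e0.2
    rwa [hab] at this
  obtain ⟨ι, _, F, hF⟩ := mac_of_avoid d γ hinj hnn z hzγ {s(a, b)}
    (fun v h => d.vertex_notin e0 v (honly _ h (Or.inl ⟨v, rfl⟩) ▸ hz))
    (fun e he x hx h => by
      have h1 := honly _ h (Or.inr (mem_iUnion.mpr ⟨e, hx⟩))
      have hne : e ≠ e0 := by
        rintro rfl
        exact he hab
      have : z ∈ d.emap e ∩ d.emap e0 := ⟨h1 ▸ hx, hz⟩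
      rw [d.edges_disj e e0 hne] at this
      exact this) (avoidG G {s(a, b)}) (fun x y h => h)
  let ρ : Option (Option V) → V := fun o => (o.getD none).getD a
  let A' : Option (Option V) → Option (Option V) → Prop := fun x y => (avoidG G {s(a, b)}).Adj x y ∨
    (x = some none ∧ y = some (some b)) ∨ (x = some (some b) ∧ y = some none)
  have hadj' : ∀ x y, A' x y → G.Adj (ρ x) (ρ y) := by
    rintro x y (⟨v, w, rfl, rfl, h, -⟩ | ⟨rfl, rfl⟩ | ⟨rfl, rfl⟩)
    · exact h
    · exact hadj
    · exact hadj.symm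
  let H : SimpleGraph (Option (Option V)) :=
    { Adj := A'
      symm := ⟨fun x y h => by
        rcases h with h | h | h
        · exact Or.inl h.symm
        · exact Or.inr (Or.inr ⟨h.2, h.1⟩)
        · exact Or.inr (Or.inl ⟨h.2, h.1⟩)⟩
      loopless := ⟨fun x h => (hadj' x x h).ne rfl⟩ }
  have hF' : IsMac H F := hF.pendant (p := some none) (b := some (some b))
    (by rintro x ⟨v, w, h, -⟩; simp at h) (fun x y => Iff.rfl)
  obtain ⟨φ, hφ, hφa⟩ := thmP (v1 := some (some a)) (v2 := some none) (by simp) _ H F rfl hF'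
    ((noTri_of htf).of_hom ρ hadj') (fun h => (hadj' _ _ h).ne rfl)
  have hab' : φ (some (some a)) ≠ φ (some (some b)) := by
    rw [hφa]; exact hφ _ _ (Or.inr (Or.inl ⟨rfl, rfl⟩))
  refine not_col hcrit (fun v => φ (some (some v))) (fun v w hvw => ?_)
  by_cases h : s(v, w) = s(a, b)
  · rcases Sym2.eq_iff.mp h with ⟨rfl, rfl⟩ | ⟨rfl, rfl⟩
    · exact hab'
    · exact hab'.symm
  · exact hφ _ _ (Or.inl ⟨v, w, rfl, rfl, hvw, h⟩)

theorem rep_main (d : Drawing G Torus) (hcrit : FourCritical G) (htf : TriangleFree G) : RepAtLeast d 2 := by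
  intro γ hinj hnn hfin
  by_contra hlt
  have hle : (range γ ∩ d.image).ncard ≤ 1 := by omega
  have hall : ∀ x y, x ∈ range γ ∩ d.image → y ∈ range γ ∩ d.image → x = y := by
    intro x y hx hy
    exact (ncard_le_one hfin).mp hle x hx y hy
  by_cases hemp : ∃ z, z ∈ range γ ∩ d.image
  · obtain ⟨z, hz⟩ := hemp
    rcases hz.2 with ⟨u, rfl⟩ | hze
    · exact case_vertex d hcrit htf γ hinj hnn u hz.1 (fun x h1 h2 => hall x _ ⟨h1, h2⟩ hz)
    · obtain ⟨e0, he0⟩ := mem_iUnion.mp hze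
      exact case_edge d hcrit htf γ hinj hnn e0 z he0 hz.1 (fun x h1 h2 => hall x _ ⟨h1, h2⟩ hz)
  · exact case_empty d hcrit htf γ hinj hnn (fun x h1 h2 => hemp ⟨x, h1, h2⟩)

end Fin1
end RepProof

/-- Every 4-critical triangle-free graph drawn in the torus has
representativity at least 2. -/
theorem representativity_ge_two {V : Type} [Fintype V] {G : SimpleGraph V}
    (d : Drawing G Torus) (hcrit : FourCritical G) (htf : TriangleFree G) :
    RepAtLeast d 2 := by
  exact RepProof.rep_main d hcrit htf
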